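/- arXiv:0908.0906 — 2 statements merged into one kernel-verified Lean document; each statement's English description precedes it below -/
import Mathlib

section
/- Let F be an algebraically closed field with char F ≠ 2, let n = 2m with m ≥ 2, let J ∈ M_n(F) be the standard symplectic matrix J = [[0, I_m], [−I_m, 0]], and let L = sp_n(F) = {X ∈ M_n(F) : Xᵀ J = −J X}, a Lie algebra under the commutator bracket. Let G be an abelian group and L = ⊕_{g∈G} L_g a G-grading of the Lie algebra L (a vector space decomposition with [L_g, L_h] ⊆ L_{gh}). Then there exists a G-grading M_n(F) = ⊕_{g∈G} R_g of the associative algebra M_n(F) such that the symplectic involution φ(X) = J⁻¹ Xᵀ J satisfies φ(R_g) = R_g for all g ∈ G, and L_g = R_g ∩ L for all g ∈ G. -/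
open Matrix

/-- The standard symplectic matrix `J = [[0, I], [−I, 0]]`. -/
def sympJ (F : Type*) [Field F] (m : ℕ) :
    Matrix (Fin m ⊕ Fin m) (Fin m ⊕ Fin m) F :=
  Matrix.fromBlocks 0 1 (-1) 0

/-- The symplectic Lie algebra `sp_{2m}(F) = {X | Xᵀ J = −J X}` as a subspace. -/
def spMatrix (F : Type*) [Field F] (m : ℕ) :
    Submodule F (Matrix (Fin m ⊕ Fin m) (Fin m ⊕ Fin m) F) where
  carrier := {X | Xᵀ * sympJ F m = -(sympJ F m * X)}
  add_mem' := fun {a b} ha hb => by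
    simp only [Set.mem_setOf_eq] at *
    rw [Matrix.transpose_add, Matrix.add_mul, ha, hb, Matrix.mul_add, neg_add]
  zero_mem' := by simp
  smul_mem' := fun c a ha => by
    simp only [Set.mem_setOf_eq] at *
    rw [Matrix.transpose_smul, Matrix.smul_mul, ha, Matrix.mul_smul, smul_neg]

/-- The symplectic involution `φ(X) = J⁻¹ Xᵀ J` as a linear map. -/
noncomputable def sympInvolution (F : Type*) [Field F] (m : ℕ) :
    Matrix (Fin m ⊕ Fin m) (Fin m ⊕ Fin m) F →ₗ[F]
      Matrix (Fin m ⊕ Fin m) (Fin m ⊕ Fin m) F where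
  toFun X := (sympJ F m)⁻¹ * Xᵀ * sympJ F m
  map_add' a b := by
    simp only [Matrix.transpose_add, Matrix.mul_add, Matrix.add_mul]
  map_smul' c a := by
    simp only [Matrix.transpose_smul, Matrix.mul_smul, Matrix.smul_mul,
      RingHom.id_apply]

section Symplectic

variable {A V : Type*} [CommRing A] [AddCommGroup V] [Module A V] (ω : V →ₗ[A] V →ₗ[A] A)

/-- The endomorphisms that are skew with respect to the bilinear form `ω`. -/
def IsSkewEnd (X : Module.End A V) : Prop := ∀ a b, ω (X a) b = -ω a (X b)

/-- The rank-one operator `z ↦ ω a z • a`. -/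
def rankOneEnd (a : V) : Module.End A V := (ω a).smulRight a

/-- The operator `z ↦ ω b z • a + ω a z • b`, polarizing `rankOneEnd`. -/
def polarEnd (a b : V) : Module.End A V := (ω b).smulRight a + (ω a).smulRight b

@[simp] theorem rankOneEnd_apply (a z : V) : rankOneEnd ω a z = ω a z • a := rfl

@[simp] theorem polarEnd_apply (a b z : V) : polarEnd ω a b z = ω b z • a + ω a z • b := rfl

variable {ω}

theorem IsSkewEnd.add {X Y : Module.End A V} (hX : IsSkewEnd ω X) (hY : IsSkewEnd ω Y) :
    IsSkewEnd ω (X + Y) := fun a b => by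
  simp only [LinearMap.add_apply, map_add, hX a b, hY a b]; ring

theorem IsSkewEnd.smul {X : Module.End A V} (c : A) (hX : IsSkewEnd ω X) :
    IsSkewEnd ω (c • X) := fun a b => by
  simp only [LinearMap.smul_apply, map_smul, hX a b, smul_eq_mul]; ring

theorem IsSkewEnd.sub {X Y : Module.End A V} (hX : IsSkewEnd ω X) (hY : IsSkewEnd ω Y) :
    IsSkewEnd ω (X - Y) := fun a b => by
  simp only [LinearMap.sub_apply, map_sub, hX a b, hY a b]; ring

theorem IsSkewEnd.commutator {X Y : Module.End A V} (hX : IsSkewEnd ω X) (hY : IsSkewEnd ω Y) :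
    IsSkewEnd ω (X * Y - Y * X) := fun a b => by
  simp only [LinearMap.sub_apply, map_sub, Module.End.mul_apply, hX (Y a), hY (X a), hX a, hY a]
  ring

theorem form_swap (hω : ω.IsAlt) (a b : V) : ω a b = -ω b a := by
  rw [hω.neg]

theorem isSkewEnd_rankOneEnd (hω : ω.IsAlt) (a : V) : IsSkewEnd ω (rankOneEnd ω a) := fun z t => by
  simp only [rankOneEnd_apply, map_smul, LinearMap.smul_apply, smul_eq_mul, form_swap hω z a]; ring

theorem isSkewEnd_polarEnd (hω : ω.IsAlt) (a b : V) : IsSkewEnd ω (polarEnd ω a b) := fun z t => by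
  simp only [polarEnd_apply, map_smul, map_add, LinearMap.add_apply, LinearMap.smul_apply,
    smul_eq_mul, form_swap hω z a, form_swap hω z b]
  ring

/-- An element `X` is extremal if `[X, [X, Y]]` is a multiple of `X` for every skew `Y`. -/
def IsExtremalEnd (ω : V →ₗ[A] V →ₗ[A] A) (X : Module.End A V) : Prop :=
  ∀ Y, IsSkewEnd ω Y → ∃ c : A, X * (X * Y - Y * X) - (X * Y - Y * X) * X = c • X

theorem isExtremalEnd_rankOneEnd (hω : ω.IsAlt) (e : V) : IsExtremalEnd ω (rankOneEnd ω e) := by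
  intro Y _
  refine ⟨-2 * ω e (Y e), LinearMap.ext fun z => ?_⟩
  simp only [LinearMap.sub_apply, Module.End.mul_apply, rankOneEnd_apply, map_sub, map_smul,
    hω e, LinearMap.smul_apply]
  module

theorem smul_cancel {c : A} (hc : IsUnit c) {v : V} (h : c • v = 0) : v = 0 :=
  hc.smul_eq_zero.1 h

/-- In the orthogonal complement of a nondegenerate plane in a symplectic space containing two
orthogonal hyperbolic pairs there are vectors whose product is a unit. -/
theorem exists_isUnit_form_orthogonal [IsLocalRing A] (hω : ω.IsAlt) {w y : V}
    (hwy : IsUnit (ω y w)) {e₁ f₁ e₂ f₂ : V} (h₁ : ω e₁ f₁ = 1) (h₂ : ω e₂ f₂ = 1)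
    (hee : ω e₁ e₂ = 0) (hef : ω e₁ f₂ = 0) (hfe : ω f₁ e₂ = 0) (hff : ω f₁ f₂ = 0) :
    ∃ z t, ω w z = 0 ∧ ω y z = 0 ∧ ω w t = 0 ∧ ω y t = 0 ∧ IsUnit (ω z t) := by
  obtain ⟨d, hd⟩ := hwy.exists_left_inv
  let π : V → V := fun v => v - (d * ω y v) • w + (d * ω w v) • y
  have hw : ∀ v, ω w (π v) = 0 := fun v => by
    simp only [π, map_sub, map_add, map_smul, smul_eq_mul, hω w, form_swap hω w y]
    linear_combination (-ω w v) * hd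
  have hy : ∀ v, ω y (π v) = 0 := fun v => by
    simp only [π, map_sub, map_add, map_smul, smul_eq_mul, hω y]
    linear_combination (-ω y v) * hd
  have hπ : ∀ v v', ω (π v) (π v') =
      ω v v' + d * (ω w v * ω y v' - ω w v' * ω y v) := fun v v' => by
    have : ω (π v) (π v') = ω v (π v') := by
      simp only [show π v = v - (d * ω y v) • w + (d * ω w v) • y from rfl, map_add, map_sub,
        map_smul, LinearMap.add_apply, LinearMap.sub_apply, LinearMap.smul_apply, hw, hy]
      simp
    rw [this]
    simp only [π, map_sub, map_add, map_smul, smul_eq_mul, form_swap hω v w, form_swap hω v y]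
    ring
  by_contra! hcon
  have hmem : ∀ v v', ω (π v) (π v') ∈ IsLocalRing.maximalIdeal A := fun v v' =>
    (IsLocalRing.mem_maximalIdeal _).2 (hcon _ _ (hw v) (hy v) (hw v') (hy v'))
  have key : (1 : A) = ω (π e₁) (π f₁) + ω (π e₂) (π f₂) - ω (π e₁) (π f₁) * ω (π e₂) (π f₂)
      + ω (π e₁) (π e₂) * ω (π f₁) (π f₂) - ω (π e₁) (π f₂) * ω (π f₁) (π e₂) := by
    simp only [hπ, h₁, h₂, hee, hef, hfe, hff]; ring
  have : (1 : A) ∈ IsLocalRing.maximalIdeal A := by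
    rw [key]
    exact Ideal.sub_mem _ (Ideal.add_mem _ (Ideal.sub_mem _ (Ideal.add_mem _ (hmem _ _) (hmem _ _))
      (Ideal.mul_mem_left _ _ (hmem _ _))) (Ideal.mul_mem_left _ _ (hmem _ _)))
      (Ideal.mul_mem_left _ _ (hmem _ _))
  exact (IsLocalRing.mem_maximalIdeal _).1 this isUnit_one

/-- An extremal element that does not vanish modulo the maximal ideal is, up to a unit,
a rank-one operator. -/
theorem IsExtremalEnd.exists_eq_smul_rankOneEnd [IsLocalRing A] (hω : ω.IsAlt)
    (h2 : IsUnit (2 : A)) {e₁ f₁ e₂ f₂ : V} (h₁ : ω e₁ f₁ = 1) (h₂ : ω e₂ f₂ = 1)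
    (hee : ω e₁ e₂ = 0) (hef : ω e₁ f₂ = 0) (hfe : ω f₁ e₂ = 0) (hff : ω f₁ f₂ = 0)
    {X : Module.End A V} (hX : IsSkewEnd ω X) (hext : IsExtremalEnd ω X) {w : V}
    (hw : IsUnit (ω (X w) w)) :
    ∃ (u : A) (y : V), IsUnit u ∧ X = u • rankOneEnd ω y ∧ IsUnit (ω y w) := by
  set y := X w with hy
  set s := X y with hs
  set b := ω y w with hb
  have hwy : ω w y = -b := by rw [hb, form_swap hω]
  have hsw : ω s w = 0 := by rw [hs, hX y w, ← hy, hω y, neg_zero]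
  have hXX : ∀ p q, ω (X (X p)) q = ω p (X (X q)) := fun p q => by rw [hX, hX, neg_neg]
  obtain ⟨c, hc⟩ := hext _ (isSkewEnd_rankOneEnd hω w)
  have E1 : ∀ z, ω w z • s + (2 * ω y z) • y + ω s z • w = c • X z := fun z => by
    have := LinearMap.congr_fun hc z
    simp only [LinearMap.sub_apply, Module.End.mul_apply, rankOneEnd_apply, map_sub, map_smul,
      LinearMap.smul_apply, ← hy, ← hs] at this
    rw [← this, show ω y z = - ω w (X z) from hX w z, show ω s z = ω w (X (X z)) from hXX w z]
    module
  have hcb : c = 2 * b := by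
    have h := congrArg (fun v => ω v w) (E1 w)
    simp only [hω w, hsw, ← hy, ← hb, zero_smul, zero_add, add_zero, map_smul,
      LinearMap.smul_apply, smul_eq_mul] at h
    exact (hw.mul_right_cancel h).symm
  have hcu : IsUnit c := hcb ▸ h2.mul hw
  have h3s' : (3 * b) • s = ω s y • w := by
    have h := E1 y
    simp only [hwy, hω y, ← hs, hcb] at h
    linear_combination (norm := module) -h
  have hsy : ω s y = 0 := by
    have h := congrArg (fun v => ω v y) h3s'
    simp only [map_smul, LinearMap.smul_apply, smul_eq_mul, hwy] at h
    refine ((h2.mul h2).mul hw).mul_right_eq_zero.1 ?_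
    linear_combination h
  have h3s : (3 : A) • s = 0 := by
    refine smul_cancel hw ?_
    rw [smul_smul, mul_comm, h3s', hsy, zero_smul]
  have hXs : X s = 0 := by
    refine smul_cancel hcu ?_
    rw [← E1 s, form_swap hω w s, hsw, form_swap hω y s, hsy, hω s]
    simp
  obtain ⟨z, t, hwz, hyz, hwt, hyt, hzt⟩ :=
    exists_isUnit_form_orthogonal hω hw h₁ h₂ hee hef hfe hff
  have E2 : ∀ z, ω w z = 0 → ω y z = 0 → ∀ t, ω z t • s + ω s t • z = 0 := by
    intro z hwz hyz t
    have hXz : c • X z = ω s z • w := by rw [← E1 z, hwz, hyz]; simp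
    have hSz : c • X (X z) = ω s z • y := by rw [← map_smul, hXz, map_smul]
    have h3 : 3 * ω s z = 0 := by
      have := congrArg (fun v => ω v z) h3s
      simpa using this
    obtain ⟨d, hd⟩ := hext _ (isSkewEnd_polarEnd hω w z)
    have E3 : ∀ t, ω z t • s + ω s t • z = d • X t := fun t => by
      have := LinearMap.congr_fun hd t
      simp only [LinearMap.sub_apply, Module.End.mul_apply, polarEnd_apply, map_sub, map_add,
        map_smul, LinearMap.smul_apply, ← hy, ← hs] at this
      have e1 : c * ω z (X t) = -(ω s z * ω w t) := by
        have := congrArg (fun v => ω v t) hXz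
        simp only [map_smul, LinearMap.smul_apply, smul_eq_mul, hX z t] at this
        linear_combination -this
      have e2 : c * ω z (X (X t)) = ω s z * ω y t := by
        have := congrArg (fun v => ω v t) hSz
        simpa only [map_smul, LinearMap.smul_apply, smul_eq_mul, hXX z t] using this
      have e3 : ω w (X t) = - ω y t := by rw [hy, hX w t, neg_neg]
      have e4 : ω w (X (X t)) = ω s t := by rw [hs, hy, hXX w t]
      refine hcu.smul_left_cancel.1 ?_
      rw [← this, e3, e4]
      linear_combination (norm := module) (-ω w t) • hSz + (-2 * ω y t) • hXz
        + 2 • congrArg (fun r => r • y) e1 - congrArg (fun r => r • w) e2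
        - congrArg (fun r => (r * ω w t) • y) h3 - congrArg (fun r => (r * ω y t) • w) h3
    have hd0 : d = 0 := by
      have h := congrArg (fun v => ω v w) (E3 w)
      simp only [hsw, form_swap hω z w, hwz, ← hy] at h
      refine hw.mul_left_eq_zero.1 ?_
      simpa using h.symm
    rw [E3 t, hd0, zero_smul]
  have hs0 : s = 0 := by
    have hA := E2 z hwz hyz t
    have hB := E2 t hwt hyt z
    rw [form_swap hω t z] at hB
    have hsz : ω s z = 0 := by
      have h := congrArg (fun v => ω v z) hB
      simp only [map_add, map_smul, LinearMap.add_apply, LinearMap.smul_apply, smul_eq_mul,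
        form_swap hω t z, map_zero, LinearMap.zero_apply] at h
      refine (h2.mul hzt).mul_right_eq_zero.1 ?_
      linear_combination -h
    refine smul_cancel hzt ?_
    rw [hsz] at hB
    linear_combination (norm := module) -hB
  obtain ⟨c', hc'⟩ := hcu.exists_left_inv
  refine ⟨c' * 2, y, (IsUnit.of_mul_eq_one _ hc').mul h2, LinearMap.ext fun z => ?_, hw⟩
  have h := E1 z
  rw [hs0] at h
  simp only [LinearMap.smul_apply, rankOneEnd_apply, map_zero, LinearMap.zero_apply] at h ⊢
  linear_combination (norm := module) (-c') • h - congrArg (fun r => r • X z) hc'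

/-- Mutually inverse linear maps `Φ` and `Θ` preserving the skew endomorphisms, such that `Φ`
respects commutators of skew endomorphisms. -/
structure IsSkewAut (ω : V →ₗ[A] V →ₗ[A] A)
    (Φ Θ : Module.End A V →ₗ[A] Module.End A V) : Prop where
  skew : ∀ X, IsSkewEnd ω X → IsSkewEnd ω (Φ X)
  skew_inv : ∀ X, IsSkewEnd ω X → IsSkewEnd ω (Θ X)
  left_inv : ∀ X, IsSkewEnd ω X → Θ (Φ X) = X
  right_inv : ∀ X, IsSkewEnd ω X → Φ (Θ X) = X
  commutator : ∀ X Y, IsSkewEnd ω X → IsSkewEnd ω Y → Φ (X * Y - Y * X) = Φ X * Φ Y - Φ Y * Φ X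

variable {Φ Θ : Module.End A V →ₗ[A] Module.End A V}

theorem IsSkewAut.isExtremalEnd (h : IsSkewAut ω Φ Θ) {X : Module.End A V} (hX : IsSkewEnd ω X)
    (hext : IsExtremalEnd ω X) : IsExtremalEnd ω (Φ X) := by
  intro Y hY
  obtain ⟨c, hc⟩ := hext (Θ Y) (h.skew_inv Y hY)
  have hY' := h.skew_inv Y hY
  refine ⟨c, ?_⟩
  have := congrArg Φ hc
  rwa [h.commutator _ _ hX (hX.commutator hY'), h.commutator _ _ hX hY', h.right_inv Y hY,
    map_smul] at this

theorem two_smul_eq_sum_polarEnd {κ : Type*} [Fintype κ] {b c : κ → V}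
    (hbc : ∀ z, z = ∑ i, ω (c i) z • b i) (hω : ω.IsAlt) {X : Module.End A V}
    (hX : IsSkewEnd ω X) :
    (2 : A) • X = ∑ i, ∑ j, (ω (X (c i)) (c j)) • polarEnd ω (b i) (b j) := by
  have hsymm : ∀ p q, ω (X p) q = ω (X q) p := fun p q => by
    rw [hX p q, form_swap hω p, neg_neg]
  have h1 : ∀ z, X z = ∑ i, ∑ j, (ω (X (c i)) (c j)) • ω (b j) z • b i := fun z => by
    conv_lhs => rw [hbc (X z)]
    refine Finset.sum_congr rfl fun i _ => ?_
    have : ω (c i) (X z) = ∑ j, ω (X (c i)) (c j) * ω (b j) z := by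
      rw [← neg_neg (ω (c i) (X z)), ← hX]
      conv_lhs => rw [hbc (X (c i))]
      simp only [map_sum, LinearMap.sum_apply, map_smul, LinearMap.smul_apply, smul_eq_mul,
        ← Finset.sum_neg_distrib]
      refine Finset.sum_congr rfl fun j _ => ?_
      rw [form_swap hω (c j)]; ring
    rw [this, Finset.sum_smul]
    exact Finset.sum_congr rfl fun j _ => mul_smul _ _ _
  refine LinearMap.ext fun z => ?_
  have h2 : X z = ∑ i, ∑ j, (ω (X (c i)) (c j)) • ω (b i) z • b j := by
    rw [h1, Finset.sum_comm]
    exact Finset.sum_congr rfl fun i _ => Finset.sum_congr rfl fun j _ => by rw [hsymm]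
  simp only [LinearMap.smul_apply, LinearMap.sum_apply, polarEnd_apply, smul_add,
    Finset.sum_add_distrib, ← h1, ← h2, two_smul, LinearMap.add_apply]

theorem IsSkewAut.exists_isUnit_form [IsLocalRing A] (h : IsSkewAut ω Φ Θ) (hω : ω.IsAlt)
    (h2 : IsUnit (2 : A)) {κ : Type*} [Fintype κ] {b c : κ → V}
    (hbc : ∀ z, z = ∑ i, ω (c i) z • b i) {X : Module.End A V} (hX : IsSkewEnd ω X) {v : V}
    (hv : IsUnit (ω (X v) v)) : ∃ w, IsUnit (ω (Φ X w) w) := by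
  by_contra! hcon
  have hY := h.skew X hX
  set Y := Φ X with hYdef
  have hmem : ∀ w, ω (Y w) w ∈ IsLocalRing.maximalIdeal A := fun w =>
    (IsLocalRing.mem_maximalIdeal _).2 (hcon w)
  have hmem2 : ∀ p q, ω (Y p) q ∈ IsLocalRing.maximalIdeal A := fun p q => by
    have h1 : (2 : A) * ω (Y p) q ∈ IsLocalRing.maximalIdeal A := by
      have : (2 : A) * ω (Y p) q = ω (Y (p + q)) (p + q) - ω (Y p) p - ω (Y q) q := by
        simp only [map_add, LinearMap.add_apply]
        rw [hY q p, form_swap hω q]; ring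
      rw [this]
      exact Ideal.sub_mem _ (Ideal.sub_mem _ (hmem _) (hmem _)) (hmem _)
    exact (Ideal.unit_mul_mem_iff_mem _ h2).1 h1
  have key := congrArg Θ (two_smul_eq_sum_polarEnd hbc hω hY)
  simp only [map_smul, map_sum, hYdef, h.left_inv X hX] at key
  have key2 := congrArg (fun Z : Module.End A V => ω (Z v) v) key
  simp only [LinearMap.smul_apply, LinearMap.sum_apply, map_smul, map_sum, smul_eq_mul] at key2
  have : (2 : A) * ω (X v) v ∈ IsLocalRing.maximalIdeal A := by
    rw [key2]
    exact Ideal.sum_mem _ fun i _ => Ideal.sum_mem _ fun j _ =>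
      Ideal.mul_mem_right _ _ (hmem2 _ _)
  exact (IsLocalRing.mem_maximalIdeal _).1 this (h2.mul hv)

/-- If `Y` scales `e`, then its image scales the vector spanning the image of the rank-one
operator of `e`, by the same factor. -/
theorem IsSkewAut.apply_eq_smul (h : IsSkewAut ω Φ Θ) (hω : ω.IsAlt) (h2 : IsUnit (2 : A))
    {e y : V} {u : A} (hu : IsUnit u) (he : Φ (rankOneEnd ω e) = u • rankOneEnd ω y)
    {w : V} (hw : IsUnit (ω y w)) {Y : Module.End A V} (hY : IsSkewEnd ω Y) {l : A}
    (hYe : Y e = l • e) : Φ Y y = l • y := by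
  have h1 : Y * rankOneEnd ω e - rankOneEnd ω e * Y = (2 * l) • rankOneEnd ω e := by
    refine LinearMap.ext fun z => ?_
    have : ω e (Y z) = - (l * ω e z) := by
      rw [← smul_eq_mul, ← LinearMap.smul_apply, ← map_smul, ← hYe, hY, neg_neg]
    simp only [LinearMap.sub_apply, Module.End.mul_apply, rankOneEnd_apply, map_smul,
      LinearMap.smul_apply, this, hYe]
    module
  have h3 := congrArg Φ h1
  rw [h.commutator _ _ hY (isSkewEnd_rankOneEnd hω e), map_smul, he] at h3
  have hΦ := h.skew Y hY
  set M := Φ Y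
  set r := M y - l • y with hr
  have h4 : ∀ z, ω y z • r + ω r z • y = 0 := fun z => by
    have := LinearMap.congr_fun h3 z
    simp only [LinearMap.sub_apply, Module.End.mul_apply, rankOneEnd_apply, map_smul,
      LinearMap.smul_apply] at this
    have e1 : ω r z = -ω y (M z) - l * ω y z := by
      simp only [hr, map_sub, LinearMap.sub_apply, hΦ y z, map_smul, LinearMap.smul_apply,
        smul_eq_mul]
    refine smul_cancel hu ?_
    rw [e1, hr]
    linear_combination (norm := module) this
  obtain ⟨k, hk⟩ := hw.exists_left_inv
  have h5 : r = (-k * ω r w) • y := by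
    have := h4 w
    linear_combination (norm := module) k • this - congrArg (fun a => a • r) hk
  have h6 : (2 * ω y w) • ((-k * ω r w) • y) = 0 := by
    have := h4 w
    rw [h5] at this
    simp only [map_smul, LinearMap.smul_apply, smul_eq_mul] at this
    linear_combination (norm := module) this
  have h7 : r = 0 := by rw [h5]; exact smul_cancel (h2.mul hw) h6
  rw [← sub_eq_zero]; exact h7

/-- A skew operator sending `e` to `v`, provided that `ω f e = 1`. -/
def transvecEnd (ω : V →ₗ[A] V →ₗ[A] A) (f e : V) : V →ₗ[A] Module.End A V where
  toFun v := polarEnd ω f v - ω v e • rankOneEnd ω f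
  map_add' v v' := LinearMap.ext fun z => by
    simp only [LinearMap.sub_apply, polarEnd_apply, LinearMap.smul_apply, rankOneEnd_apply,
      map_add, LinearMap.add_apply]
    module
  map_smul' a v := LinearMap.ext fun z => by
    simp only [LinearMap.sub_apply, polarEnd_apply, LinearMap.smul_apply, rankOneEnd_apply,
      map_smul, smul_eq_mul, RingHom.id_apply]
    module

theorem isSkewEnd_transvecEnd (hω : ω.IsAlt) (f e v : V) : IsSkewEnd ω (transvecEnd ω f e v) :=
  (isSkewEnd_polarEnd hω f v).sub ((isSkewEnd_rankOneEnd hω f).smul _)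

theorem transvecEnd_apply_self {f e : V} (hfe : ω f e = 1) (v : V) :
    transvecEnd ω f e v e = v := by
  change ω v e • f + ω f e • v - ω v e • (ω f e • f) = v
  rw [hfe]; module

theorem commutator_rankOneEnd (hω : ω.IsAlt) {e f : V} (hfe : ω f e = 1) :
    rankOneEnd ω f * rankOneEnd ω e - rankOneEnd ω e * rankOneEnd ω f = polarEnd ω e f :=
  LinearMap.ext fun z => by
    simp only [LinearMap.sub_apply, Module.End.mul_apply, rankOneEnd_apply, map_smul,
      polarEnd_apply, form_swap hω e f, hfe]
    module

theorem IsSkewAut.exists_intertwiner (h : IsSkewAut ω Φ Θ) (hω : ω.IsAlt)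
    (h2 : IsUnit (2 : A)) {e f : V} (hfe : ω f e = 1) {y y' : V} {u u' : A} (hu : IsUnit u)
    (hu' : IsUnit u') (hE : Φ (rankOneEnd ω e) = u • rankOneEnd ω y)
    (hF : Φ (rankOneEnd ω f) = u' • rankOneEnd ω y') {w w' : V} (hw : IsUnit (ω y w))
    (hw' : IsUnit (ω y' w')) :
    ∃ P : V →ₗ[A] V, Function.Surjective P ∧
      ∀ Y, IsSkewEnd ω Y → ∀ z, P (Y z) = Φ Y (P z) := by
  have hef : ω e f = -1 := by rw [form_swap hω, hfe]
  have fixE : ∀ Y, IsSkewEnd ω Y → ∀ l : A, Y e = l • e → Φ Y y = l • y := fun Y hY l =>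
    h.apply_eq_smul hω h2 hu hE hw hY
  have fixF : ∀ Y, IsSkewEnd ω Y → Y f = 0 → Φ Y y' = 0 := fun Y hY hYf => by
    have := h.apply_eq_smul hω h2 hu' hF hw' hY (l := 0) (by rw [hYf, zero_smul])
    rwa [zero_smul] at this
  have sE := isSkewEnd_rankOneEnd hω e
  have sF := isSkewEnd_rankOneEnd hω f
  have sH := isSkewEnd_polarEnd hω e f
  have hHe : polarEnd ω e f e = e := by simp [hω e, hfe]
  set H := Φ (polarEnd ω e f) with hH
  set κ := ω y' y with hκ
  have hyy' : ω y y' = -κ := by rw [form_swap hω]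
  have hHz : ∀ z, H z = (u * u' * κ) • (ω y' z • y + ω y z • y') := fun z => by
    rw [hH, ← commutator_rankOneEnd hω hfe, h.commutator _ _ sF sE, hE, hF]
    simp only [LinearMap.sub_apply, Module.End.mul_apply, LinearMap.smul_apply, rankOneEnd_apply,
      map_smul, ← hκ, hyy']
    module
  have hHy : H y = y := by rw [hH, fixE _ sH 1 (by rw [hHe, one_smul]), one_smul]
  have hκu : u * u' * κ * κ = 1 := by
    have := congrArg (fun v => ω v w) hHy
    simp only [hHz y, ← hκ, hω y, map_smul, LinearMap.smul_apply, smul_eq_mul, zero_smul,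
      add_zero] at this
    refine hw.mul_right_cancel ?_
    linear_combination this
  have hneg : ∀ q, H q = -q → q = -(u * u' * κ * ω y q) • y' := fun q hq => by
    have h1 : ω y' q = 0 := by
      have := congrArg (fun v => ω y' v) hq
      simp only [hHz q, ← hκ, hω y', map_smul, map_add, smul_eq_mul, map_neg, mul_zero,
        add_zero] at this
      refine h2.mul_right_eq_zero.1 ?_
      linear_combination this - ω y' q * hκu
    have h3 := hHz q
    rw [hq, h1] at h3
    linear_combination (norm := module) -h3
  let P : V →ₗ[A] V := (LinearMap.applyₗ y) ∘ₗ Φ ∘ₗ transvecEnd ω f e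
  have hP : ∀ Y, IsSkewEnd ω Y → P (Y e) = Φ Y y := fun Y hY => by
    have sT := isSkewEnd_transvecEnd hω f e (Y e)
    have := fixE _ (sT.sub hY) 0 (by
      rw [LinearMap.sub_apply, transvecEnd_apply_self hfe, sub_self, zero_smul])
    rw [map_sub, LinearMap.sub_apply, zero_smul, sub_eq_zero] at this
    exact this
  have hPe : P e = y := by
    have := hP _ sH
    rwa [hHe, ← hH, hHy] at this
  have hPf : P f = Φ (rankOneEnd ω f) y := by
    rw [← hP _ sF, rankOneEnd_apply, hfe, one_smul]
  -- operators preserving the line spanned by `e`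
  have stab : ∀ Y, IsSkewEnd ω Y → ∀ l : A, Y e = l • e → ∀ z, P (Y z) = Φ Y (P z) := by
    intro Y hY l hl z
    have sT := isSkewEnd_transvecEnd hω f e z
    have hTe := transvecEnd_apply_self hfe z
    set Z := transvecEnd ω f e z
    have e1 : Y z = (Y * Z - Z * Y) e + l • z := by
      simp only [LinearMap.sub_apply, Module.End.mul_apply, hTe, hl, map_smul]
      module
    have e2 : P z = Φ Z y := by rw [← hP _ sT, hTe]
    rw [e1, map_add, hP _ (hY.commutator sT), h.commutator _ _ hY sT, map_smul, e2]
    simp only [LinearMap.sub_apply, Module.End.mul_apply, fixE Y hY l hl, map_smul]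
    module
  have decomp : ∀ z, ∃ (a b : A) (v : V), z = a • e + b • f + v ∧ ω e v = 0 ∧ ω f v = 0 :=
    fun z => ⟨ω f z, -ω e z, z - ω f z • e + ω e z • f, by module,
      by simp [hω e, hef], by simp [hω f, hfe]⟩
  have hNe : ∀ v, ω e v = 0 → polarEnd ω f v e = v := fun v hv => by
    simp [hfe, form_swap hω v, hv]
  have hNf : ∀ v, ω f v = 0 → polarEnd ω f v f = 0 := fun v hv => by
    simp [hω f, form_swap hω v, hv]
  have hPv : ∀ v, ω e v = 0 → P v = Φ (polarEnd ω f v) y := fun v hv => by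
    rw [← hP _ (isSkewEnd_polarEnd hω f v), hNe v hv]
  have hPf' : P f = (u' * κ) • y' := by
    rw [hPf, hF, LinearMap.smul_apply, rankOneEnd_apply, smul_smul]
  have hNN : ∀ v v', ω e v = 0 → ω f v = 0 → ω e v' = 0 → ω f v' = 0 →
      Φ (polarEnd ω f v) (Φ (polarEnd ω f v') y) = ω v v' • P f := by
    have hq : ∀ v v', ω e v = 0 → ω f v = 0 → ω e v' = 0 → ω f v' = 0 →
        H (Φ (polarEnd ω f v) (Φ (polarEnd ω f v') y)) =
          -Φ (polarEnd ω f v) (Φ (polarEnd ω f v') y) := by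
      have hcomm : ∀ v, ω e v = 0 → ω f v = 0 → ∀ z,
          H (Φ (polarEnd ω f v) z) = Φ (polarEnd ω f v) (H z) - Φ (polarEnd ω f v) z := by
        intro v hev hfv z
        have e1 : polarEnd ω e f * polarEnd ω f v - polarEnd ω f v * polarEnd ω e f
            = - polarEnd ω f v := LinearMap.ext fun z => by
          simp only [LinearMap.sub_apply, Module.End.mul_apply, LinearMap.neg_apply,
            map_add, map_smul, polarEnd_apply, hω f, hfe, hef, hev, hfv, form_swap hω v e,
            form_swap hω v f]
          module
        have e2 := congrArg Φ e1
        rw [h.commutator _ _ sH (isSkewEnd_polarEnd hω f v), map_neg] at e2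
        have e3 := LinearMap.congr_fun e2 z
        simp only [LinearMap.sub_apply, Module.End.mul_apply, LinearMap.neg_apply] at e3
        linear_combination (norm := module) e3
      intro v v' h1 h3 h4 h5
      rw [hcomm v h1 h3, hcomm v' h4 h5, hHy, sub_self, map_zero, zero_sub]
    intro v v' h1 h3 h4 h5
    have sv := isSkewEnd_polarEnd hω f v
    have sv' := isSkewEnd_polarEnd hω f v'
    have q1 := hneg _ (hq v v' h1 h3 h4 h5)
    have q2 := hneg _ (hq v' v h4 h5 h1 h3)
    have e1 : polarEnd ω f v * polarEnd ω f v' - polarEnd ω f v' * polarEnd ω f v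
        = (2 * ω v v') • rankOneEnd ω f := LinearMap.ext fun z => by
      simp only [LinearMap.sub_apply, Module.End.mul_apply, LinearMap.smul_apply,
        map_add, map_smul, polarEnd_apply, rankOneEnd_apply, hω f, h3, h5, form_swap hω v f,
        form_swap hω v' f, form_swap hω v' v]
      module
    have e2 := LinearMap.congr_fun (congrArg Φ e1) y
    rw [h.commutator _ _ sv sv', map_smul, LinearMap.smul_apply, ← hPf] at e2
    simp only [LinearMap.sub_apply, Module.End.mul_apply] at e2
    have hsw : ω y (Φ (polarEnd ω f v') (Φ (polarEnd ω f v) y)) =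
        -ω y (Φ (polarEnd ω f v) (Φ (polarEnd ω f v') y)) := by
      rw [← neg_neg (ω y (Φ (polarEnd ω f v') _)), ← h.skew _ sv', form_swap hω,
        ← neg_eq_iff_eq_neg.2 (h.skew _ sv y _)]
    rw [hsw] at q2
    refine h2.smul_left_cancel.1 ?_
    linear_combination (norm := module) e2 + q1 + q2
  have lower : ∀ v, ω e v = 0 → ω f v = 0 → ∀ z,
      P (polarEnd ω f v z) = Φ (polarEnd ω f v) (P z) := by
    intro v hev hfv z
    have sN := isSkewEnd_polarEnd hω f v
    obtain ⟨a, b, t, rfl, het, hft⟩ := decomp z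
    have hNt : polarEnd ω f v t = ω v t • f := by simp [hft]
    have hNy' := fixF _ sN (hNf v hfv)
    simp only [map_add, map_smul, hNf v hfv, hP _ sN, hPe, map_zero, hNt, hPv t het,
      hNN v t hev hfv het hft]
    rw [hPf', map_smul, hNy']
    simp
  have lowest : ∀ z, P (rankOneEnd ω f z) = Φ (rankOneEnd ω f) (P z) := by
    intro z
    obtain ⟨a, b, t, rfl, het, hft⟩ := decomp z
    have sN := isSkewEnd_polarEnd hω f t
    have hNy' := fixF _ sN (hNf t hft)
    have e1 : Φ (rankOneEnd ω f) (Φ (polarEnd ω f t) y) = 0 := by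
      rw [hF, LinearMap.smul_apply, rankOneEnd_apply, ← neg_neg (ω y' _), ← h.skew _ sN, hNy']
      simp
    have e2 : Φ (rankOneEnd ω f) (P f) = 0 := by
      rw [hPf', hF]; simp [hω y']
    have e3 : rankOneEnd ω f f = 0 := by simp [hω f]
    have e4 : rankOneEnd ω f t = 0 := by simp [hft]
    simp only [map_add, map_smul, hP _ sF, hPe, hPv t het, e1, e2, e3, e4, map_zero]
  refine ⟨P, fun z => ?_, fun Y hY z => ?_⟩
  · obtain ⟨k, hk⟩ := hw.exists_left_inv
    have hky : ω (-k • w) y = 1 := by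
      rw [map_smul, LinearMap.smul_apply, form_swap hω w y, smul_eq_mul]
      linear_combination hk
    have sT := isSkewEnd_transvecEnd hω (-k • w) y z
    refine ⟨Θ (transvecEnd ω (-k • w) y z) e, ?_⟩
    rw [hP _ (h.skew_inv _ sT), h.right_inv _ sT, transvecEnd_apply_self hky]
  · obtain ⟨a, b, v, hv, hev, hfv⟩ := decomp (Y e)
    have sN := isSkewEnd_polarEnd hω f v
    have sZ := (hY.sub sN).sub (sF.smul b)
    have := stab _ sZ a (by
      simp only [LinearMap.sub_apply, LinearMap.smul_apply, hNe v hev, rankOneEnd_apply, hfe, hv]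
      module) z
    simp only [LinearMap.sub_apply, LinearMap.smul_apply, map_sub, map_smul, lower v hev hfv,
      lowest] at this
    linear_combination (norm := module) this

/-- Over a local ring in which `2` is invertible, every automorphism of the symplectic Lie algebra
of rank at least two is implemented by a surjective linear map. -/
theorem IsSkewAut.exists_surjective_intertwiner [IsLocalRing A] (h : IsSkewAut ω Φ Θ)
    (hω : ω.IsAlt) (h2 : IsUnit (2 : A)) {κ : Type*} [Fintype κ] {b c : κ → V}
    (hbc : ∀ z, z = ∑ i, ω (c i) z • b i) {e₁ f₁ e₂ f₂ : V} (h₁ : ω e₁ f₁ = 1)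
    (h₂ : ω e₂ f₂ = 1) (hee : ω e₁ e₂ = 0) (hef : ω e₁ f₂ = 0) (hfe : ω f₁ e₂ = 0)
    (hff : ω f₁ f₂ = 0) :
    ∃ P : V →ₗ[A] V, Function.Surjective P ∧
      ∀ Y, IsSkewEnd ω Y → ∀ z, P (Y z) = Φ Y (P z) := by
  have key : ∀ a v, IsUnit (ω a v) → ∃ (u : A) (y w : V), IsUnit u ∧
      Φ (rankOneEnd ω a) = u • rankOneEnd ω y ∧ IsUnit (ω y w) := fun a v hav => by
    have sa := isSkewEnd_rankOneEnd hω a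
    obtain ⟨w, hw⟩ := h.exists_isUnit_form hω h2 hbc sa (v := v) (by simpa using hav)
    obtain ⟨u, y, hu, hy, hyw⟩ := (h.isExtremalEnd sa (isExtremalEnd_rankOneEnd hω a)
      ).exists_eq_smul_rankOneEnd hω h2 h₁ h₂ hee hef hfe hff (h.skew _ sa) hw
    exact ⟨u, y, w, hu, hy, hyw⟩
  obtain ⟨u, y, w, hu, hE, hw⟩ := key f₁ e₁ (by simp [form_swap hω f₁, h₁])
  obtain ⟨u', y', w', hu', hF, hw'⟩ := key e₁ f₁ (by simp [h₁])
  exact h.exists_intertwiner hω h2 h₁ hu hu' hE hF hw hw'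

end Symplectic

section StandardForm

/-- The standard symplectic matrix over a commutative ring. -/
def stdSympMatrix (A : Type*) [CommRing A] (m : ℕ) : Matrix (Fin m ⊕ Fin m) (Fin m ⊕ Fin m) A :=
  Matrix.fromBlocks 0 1 (-1) 0

/-- The standard symplectic form on `A ^ (2 * m)`. -/
noncomputable def stdSympForm (A : Type*) [CommRing A] (m : ℕ) :
    (Fin m ⊕ Fin m → A) →ₗ[A] (Fin m ⊕ Fin m → A) →ₗ[A] A :=
  Matrix.toLinearMap₂' A (stdSympMatrix A m)

variable {A : Type*} [CommRing A] {m : ℕ}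

theorem stdSympForm_apply (x y : Fin m ⊕ Fin m → A) : stdSympForm A m x y =
    ∑ i, (x (.inl i) * y (.inr i) - x (.inr i) * y (.inl i)) := by
  simp [stdSympForm, stdSympMatrix, Matrix.toLinearMap₂'_apply', dotProduct,
    Matrix.fromBlocks_mulVec, Matrix.neg_mulVec, Finset.sum_add_distrib, sub_eq_add_neg]

theorem stdSympForm_isAlt : (stdSympForm A m).IsAlt := fun x => by
  simp [stdSympForm_apply, mul_comm]

theorem isSkewEnd_toLin_iff (X : Matrix (Fin m ⊕ Fin m) (Fin m ⊕ Fin m) A) :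
    IsSkewEnd (stdSympForm A m) (Matrix.toLinAlgEquiv' X) ↔
      Xᵀ * stdSympMatrix A m = -(stdSympMatrix A m * X) := by
  have := isAdjointPair_toLinearMap₂' (stdSympMatrix A m) (stdSympMatrix A m) X (-X)
  rw [Matrix.IsAdjointPair, Matrix.mul_neg] at this
  rw [← this]
  refine forall₂_congr fun a b => ?_
  rw [map_neg, LinearMap.neg_apply, map_neg]
  rfl

/-- The dual basis, up to sign a permutation of the standard basis, for the symplectic form. -/
def sympDual (A : Type*) [CommRing A] (m : ℕ) : Fin m ⊕ Fin m → (Fin m ⊕ Fin m → A)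
  | .inl i => -Pi.single (.inr i) 1
  | .inr i => Pi.single (.inl i) 1

theorem stdSympForm_sympDual (k : Fin m ⊕ Fin m) (z : Fin m ⊕ Fin m → A) :
    stdSympForm A m (sympDual A m k) z = z k := by
  cases k <;> simp [stdSympForm_apply, sympDual, Pi.single_apply]

theorem eq_sum_stdSympForm (z : Fin m ⊕ Fin m → A) :
    z = ∑ k, stdSympForm A m (sympDual A m k) z • Pi.single k (1 : A) := by
  simp only [stdSympForm_sympDual]
  exact pi_eq_sum_univ' z

variable {F : Type*} [Field F] [Algebra F A]

/-- Extension of scalars from matrices over `F` to endomorphisms over an `F`-algebra. -/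
noncomputable def baseEnd (A : Type*) [CommRing A] [Algebra F A] (m : ℕ) :
    Matrix (Fin m ⊕ Fin m) (Fin m ⊕ Fin m) F →ₐ[F] Module.End A (Fin m ⊕ Fin m → A) :=
  ((Matrix.toLinAlgEquiv' (R := A) (n := Fin m ⊕ Fin m)).toAlgHom.restrictScalars F).comp
    (AlgHom.mapMatrix (Algebra.ofId F A))

theorem baseEnd_apply (X : Matrix (Fin m ⊕ Fin m) (Fin m ⊕ Fin m) F) :
    baseEnd A m X = Matrix.toLinAlgEquiv' (X.map (algebraMap F A)) := rfl

theorem baseEnd_single (X : Matrix (Fin m ⊕ Fin m) (Fin m ⊕ Fin m) F) (i j : Fin m ⊕ Fin m) :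
    baseEnd A m X (Pi.single j 1) i = algebraMap F A (X i j) := by
  simp [baseEnd_apply]

theorem stdSympForm_map (a b : Fin m ⊕ Fin m → F) :
    stdSympForm A m (algebraMap F A ∘ a) (algebraMap F A ∘ b) =
      algebraMap F A (stdSympForm F m a b) := by
  simp [stdSympForm_apply]

theorem single_eq_algebraMap_comp (k : Fin m ⊕ Fin m) :
    (Pi.single k 1 : Fin m ⊕ Fin m → A) = algebraMap F A ∘ Pi.single k 1 := by
  ext l
  by_cases h : l = k
  · subst h; simp
  · simp [h]

theorem baseEnd_polarEnd (a b : Fin m ⊕ Fin m → F) :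
    baseEnd A m (Matrix.toLinAlgEquiv'.symm (polarEnd (stdSympForm F m) a b)) =
      polarEnd (stdSympForm A m) (algebraMap F A ∘ a) (algebraMap F A ∘ b) := by
  refine LinearMap.pi_ext' fun k => LinearMap.ext_ring (funext fun l => ?_)
  have : (Matrix.toLinAlgEquiv'.symm (polarEnd (stdSympForm F m) a b)) l k =
      polarEnd (stdSympForm F m) a b (Pi.single k 1) l := by
    rw [Matrix.toLinAlgEquiv'_symm, LinearMap.toMatrixAlgEquiv'_apply]
  rw [LinearMap.comp_apply, LinearMap.coe_single, baseEnd_single, this, LinearMap.comp_apply,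
    LinearMap.coe_single, single_eq_algebraMap_comp (A := A) (F := F)]
  simp only [polarEnd_apply, stdSympForm_map, Pi.add_apply, Pi.smul_apply, smul_eq_mul, map_add,
    map_mul, Function.comp_apply]

theorem mem_spMatrix_iff (X : Matrix (Fin m ⊕ Fin m) (Fin m ⊕ Fin m) F) :
    X ∈ spMatrix F m ↔ IsSkewEnd (stdSympForm F m) (Matrix.toLinAlgEquiv' X) :=
  (isSkewEnd_toLin_iff X).symm

theorem isSkewEnd_baseEnd {X : Matrix (Fin m ⊕ Fin m) (Fin m ⊕ Fin m) F}
    (hX : X ∈ spMatrix F m) : IsSkewEnd (stdSympForm A m) (baseEnd A m X) := by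
  rw [baseEnd_apply, isSkewEnd_toLin_iff]
  have h : Xᵀ * stdSympMatrix F m = -(stdSympMatrix F m * X) := hX
  have hJ : stdSympMatrix A m = (stdSympMatrix F m).map (algebraMap F A) := by
    simp [stdSympMatrix, Matrix.fromBlocks_map, Matrix.map_neg]
  rw [hJ, ← Matrix.transpose_map, ← Matrix.map_mul, h, ← Matrix.map_mul,
    Matrix.map_neg _ (map_neg _)]

/-- The skew endomorphisms over an `F`-algebra are spanned by those defined over `F`. -/
theorem mem_span_baseEnd (h2 : IsUnit (2 : A)) {Y : Module.End A (Fin m ⊕ Fin m → A)}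
    (hY : IsSkewEnd (stdSympForm A m) Y) :
    Y ∈ Submodule.span A 
      (baseEnd A m '' (spMatrix F m : Set (Matrix (Fin m ⊕ Fin m) (Fin m ⊕ Fin m) F))) := by
  obtain ⟨k, hk⟩ := h2.exists_left_inv
  have h := two_smul_eq_sum_polarEnd (c := sympDual A m) (b := fun k => Pi.single k 1)
    eq_sum_stdSympForm stdSympForm_isAlt hY
  have : Y = k • (2 : A) • Y := by rw [smul_smul, hk, one_smul]
  rw [this, h]
  refine Submodule.smul_mem _ _ (Submodule.sum_mem _ fun i _ => Submodule.sum_mem _ fun j _ =>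
    Submodule.smul_mem _ _ (Submodule.subset_span ?_))
  refine ⟨Matrix.toLinAlgEquiv'.symm
    (polarEnd (stdSympForm F m) (Pi.single i 1) (Pi.single j 1)), ?_, ?_⟩
  · rw [SetLike.mem_coe, mem_spMatrix_iff, AlgEquiv.apply_symm_apply]
    exact isSkewEnd_polarEnd stdSympForm_isAlt _ _
  · rw [baseEnd_polarEnd, ← single_eq_algebraMap_comp, ← single_eq_algebraMap_comp]

/-- The `A`-linear extension of an `F`-linear map defined on matrices over `F`. -/
noncomputable def extendEnd
    (ρ : Matrix (Fin m ⊕ Fin m) (Fin m ⊕ Fin m) F →ₗ[F] Module.End A (Fin m ⊕ Fin m → A)) :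
    Module.End A (Fin m ⊕ Fin m → A) →ₗ[A] Module.End A (Fin m ⊕ Fin m → A) :=
  ∑ i, ∑ j, (LinearMap.proj i ∘ₗ LinearMap.applyₗ (Pi.single j (1 : A))).smulRight
    (ρ (Matrix.single i j 1))

theorem extendEnd_baseEnd
    (ρ : Matrix (Fin m ⊕ Fin m) (Fin m ⊕ Fin m) F →ₗ[F] Module.End A (Fin m ⊕ Fin m → A))
    (X : Matrix (Fin m ⊕ Fin m) (Fin m ⊕ Fin m) F) : extendEnd ρ (baseEnd A m X) = ρ X := by
  conv_rhs => rw [Matrix.matrix_eq_sum_single X]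
  simp only [extendEnd, LinearMap.sum_apply, LinearMap.smulRight_apply, LinearMap.comp_apply,
    LinearMap.applyₗ_apply_apply, LinearMap.proj_apply, baseEnd_single, map_sum]
  refine Finset.sum_congr rfl fun i _ => Finset.sum_congr rfl fun j _ => ?_
  rw [algebraMap_smul, ← map_smul, Matrix.smul_single, smul_eq_mul, mul_one]

end StandardForm

/-- Linear maps on the members of an independent family of subspaces have a common extension. -/
theorem iSupIndep.exists_linearMap_extending {F M N ι : Type*} [Field F] [AddCommGroup M]
    [Module F M] [AddCommGroup N] [Module F N] {p : ι → Submodule F M} (hp : iSupIndep p)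
    (f : ι → M →ₗ[F] N) : ∃ ρ : M →ₗ[F] N, ∀ i, ∀ x ∈ p i, ρ x = f i x := by
  classical
  obtain ⟨q, hq⟩ := LinearMap.exists_leftInverse_of_injective
    (DFinsupp.lsum ℕ fun i => (p i).subtype)
    (LinearMap.ker_eq_bot.2 hp.dfinsupp_lsum_injective)
  refine ⟨(DFinsupp.lsum ℕ fun i => f i ∘ₗ (p i).subtype) ∘ₗ q, fun i x hx => ?_⟩
  have := LinearMap.congr_fun hq (DFinsupp.single i ⟨x, hx⟩)
  simp only [LinearMap.comp_apply, DFinsupp.lsum_single, Submodule.subtype_apply,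
    LinearMap.id_apply] at this
  rw [LinearMap.comp_apply, this, DFinsupp.lsum_single]
  rfl

section Grading

variable {F G : Type*} [Field F] {m : ℕ}
  {ℒ : G → Submodule F (Matrix (Fin m ⊕ Fin m) (Fin m ⊕ Fin m) F)}
  {A : Type*} [CommRing A] [Algebra F A]

/-- A submodule of endomorphisms contains the skew ones as soon as it contains a graded spanning
set of the symplectic Lie algebra over the base field. -/
theorem IsSkewEnd.mem_of_graded (hsup : (⨆ g : G, ℒ g) = spMatrix F m) (h2 : IsUnit (2 : A))
    {p : Submodule A (Module.End A (Fin m ⊕ Fin m → A))}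
    (hp : ∀ g, ∀ X ∈ ℒ g, baseEnd A m X ∈ p) {Y : Module.End A (Fin m ⊕ Fin m → A)}
    (hY : IsSkewEnd (stdSympForm A m) Y) : Y ∈ p := by
  have hle : spMatrix F m ≤ (p.restrictScalars F).comap (baseEnd A m).toLinearMap :=
    hsup ▸ iSup_le hp
  refine Submodule.span_le.2 ?_ (mem_span_baseEnd (F := F) h2 hY)
  rintro _ ⟨X, hX, rfl⟩
  exact hle hX

variable [CommGroup G]

/-- The skew endomorphisms as a submodule. -/
def skewEnds {V : Type*} [AddCommGroup V] [Module A V] (ω : V →ₗ[A] V →ₗ[A] A) :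
    Submodule A (Module.End A V) where
  carrier := {X | IsSkewEnd ω X}
  add_mem' := IsSkewEnd.add
  zero_mem' a b := by simp
  smul_mem' c _ := IsSkewEnd.smul c

/-- A multiplicative character of the grading group twists the symplectic Lie algebra over an
extension of scalars by an automorphism. -/
theorem isSkewAut_extendEnd (hsub : ∀ g : G, ℒ g ≤ spMatrix F m)
    (hsup : (⨆ g : G, ℒ g) = spMatrix F m)
    (hbr : ∀ g h : G, ∀ x ∈ ℒ g, ∀ y ∈ ℒ h, x * y - y * x ∈ ℒ (g * h))
    (h2 : IsUnit (2 : A)) (χ : G →* A)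
    {ρ ρ' : Matrix (Fin m ⊕ Fin m) (Fin m ⊕ Fin m) F →ₗ[F] Module.End A (Fin m ⊕ Fin m → A)}
    (hρ : ∀ g, ∀ X ∈ ℒ g, ρ X = χ g • baseEnd A m X)
    (hρ' : ∀ g, ∀ X ∈ ℒ g, ρ' X = χ g⁻¹ • baseEnd A m X) :
    IsSkewAut (stdSympForm A m) (extendEnd ρ) (extendEnd ρ') where
  skew X hX := hX.mem_of_graded hsup h2 (p := (skewEnds _).comap (extendEnd ρ)) fun g X hX => by
    rw [Submodule.mem_comap, extendEnd_baseEnd, hρ g X hX]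
    exact (isSkewEnd_baseEnd (hsub g hX)).smul _
  skew_inv X hX := hX.mem_of_graded hsup h2 (p := (skewEnds _).comap (extendEnd ρ'))
    fun g X hX => by
      rw [Submodule.mem_comap, extendEnd_baseEnd, hρ' g X hX]
      exact (isSkewEnd_baseEnd (hsub g hX)).smul _
  left_inv X hX := hX.mem_of_graded hsup h2
    (p := LinearMap.eqLocus (extendEnd ρ' ∘ₗ extendEnd ρ) LinearMap.id) fun g X hX => by
      rw [LinearMap.mem_eqLocus, LinearMap.comp_apply, extendEnd_baseEnd, hρ g X hX, map_smul,
        extendEnd_baseEnd, hρ' g X hX, smul_smul, ← map_mul, mul_inv_cancel, map_one, one_smul,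
        LinearMap.id_apply]
  right_inv X hX := hX.mem_of_graded hsup h2
    (p := LinearMap.eqLocus (extendEnd ρ ∘ₗ extendEnd ρ') LinearMap.id) fun g X hX => by
      rw [LinearMap.mem_eqLocus, LinearMap.comp_apply, extendEnd_baseEnd, hρ' g X hX, map_smul,
        extendEnd_baseEnd, hρ g X hX, smul_smul, ← map_mul, inv_mul_cancel, map_one, one_smul,
        LinearMap.id_apply]
  commutator X Y hX hY := by
    refine hX.mem_of_graded hsup h2 (p := LinearMap.eqLocus
      (extendEnd ρ ∘ₗ (LinearMap.mulRight A Y - LinearMap.mulLeft A Y))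
      ((LinearMap.mulRight A (extendEnd ρ Y) - LinearMap.mulLeft A (extendEnd ρ Y)) ∘ₗ
        extendEnd ρ)) fun g X hX => ?_
    refine hY.mem_of_graded hsup h2 (p := LinearMap.eqLocus
      (extendEnd ρ ∘ₗ (LinearMap.mulLeft A (baseEnd A m X) - LinearMap.mulRight A (baseEnd A m X)))
      ((LinearMap.mulLeft A (extendEnd ρ (baseEnd A m X)) -
        LinearMap.mulRight A (extendEnd ρ (baseEnd A m X))) ∘ₗ extendEnd ρ)) fun h Y hY => ?_
    simp only [LinearMap.mem_eqLocus, LinearMap.comp_apply, LinearMap.sub_apply,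
      LinearMap.mulLeft_apply, LinearMap.mulRight_apply]
    rw [← map_mul, ← map_mul, ← map_sub, extendEnd_baseEnd, extendEnd_baseEnd, extendEnd_baseEnd,
      hρ g X hX, hρ h Y hY, hρ _ _ (hbr g h X hX Y hY), map_sub, map_mul, map_mul, map_mul,
      smul_mul_smul_comm, smul_mul_smul_comm, mul_comm (χ h), smul_sub]

/-- Over a local ring, an associative relation between skew matrices is preserved by the twist. -/
theorem lift_eq_zero_of_isLocalRing [IsLocalRing A] (hm : 2 ≤ m)
    (hsub : ∀ g : G, ℒ g ≤ spMatrix F m) (hsup : (⨆ g : G, ℒ g) = spMatrix F m)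
    (hbr : ∀ g h : G, ∀ x ∈ ℒ g, ∀ y ∈ ℒ h, x * y - y * x ∈ ℒ (g * h))
    (h2 : IsUnit (2 : A)) (χ : G →* A)
    {ρ ρ' : Matrix (Fin m ⊕ Fin m) (Fin m ⊕ Fin m) F →ₗ[F] Module.End A (Fin m ⊕ Fin m → A)}
    (hρ : ∀ g, ∀ X ∈ ℒ g, ρ X = χ g • baseEnd A m X)
    (hρ' : ∀ g, ∀ X ∈ ℒ g, ρ' X = χ g⁻¹ • baseEnd A m X)
    {x : FreeAlgebra F (spMatrix F m)} (hx : FreeAlgebra.lift F (spMatrix F m).subtype x = 0) :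
    FreeAlgebra.lift F (ρ ∘ₗ (spMatrix F m).subtype) x = 0 := by
  have hAut := isSkewAut_extendEnd hsub hsup hbr h2 χ hρ hρ'
  obtain ⟨P, hP, hPY⟩ := hAut.exists_surjective_intertwiner
    stdSympForm_isAlt h2 (c := sympDual A m) (b := fun k => Pi.single k 1) eq_sum_stdSympForm
    (e₁ := Pi.single (.inl ⟨0, by omega⟩) 1) (f₁ := Pi.single (.inr ⟨0, by omega⟩) 1)
    (e₂ := Pi.single (.inl ⟨1, by omega⟩) 1) (f₂ := Pi.single (.inr ⟨1, by omega⟩) 1)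
    (by simp [stdSympForm_apply, Pi.single_apply]) (by simp [stdSympForm_apply, Pi.single_apply])
    (by simp [stdSympForm_apply, Pi.single_apply])
    (by simp [stdSympForm_apply, Pi.single_apply])
    (by simp [stdSympForm_apply, Pi.single_apply])
    (by simp [stdSympForm_apply, Pi.single_apply])
  have key : ∀ x z, P (baseEnd A m (FreeAlgebra.lift F (spMatrix F m).subtype x) z) =
      FreeAlgebra.lift F (ρ ∘ₗ (spMatrix F m).subtype) x (P z) := fun x => by
    induction x using FreeAlgebra.induction with
    | grade0 r => intro z; simp [Algebra.algebraMap_eq_smul_one]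
    | grade1 X =>
      intro z
      rw [FreeAlgebra.lift_ι_apply, FreeAlgebra.lift_ι_apply, Submodule.subtype_apply,
        hPY _ (isSkewEnd_baseEnd X.2), extendEnd_baseEnd]
      rfl
    | mul x y hx hy => intro z; simp only [map_mul, Module.End.mul_apply, hx, hy]
    | add x y hx hy => intro z; simp only [map_add, LinearMap.add_apply, hx, hy]
  refine LinearMap.ext fun z => ?_
  obtain ⟨z, rfl⟩ := hP z
  rw [← key, hx]
  simp

/-- Extension of scalars for endomorphisms of free modules. -/
noncomputable def mapEnd {B : Type*} [CommRing B] [Algebra F B] (m : ℕ) (f : B →ₐ[F] A) :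
    Module.End B (Fin m ⊕ Fin m → B) →ₐ[F] Module.End A (Fin m ⊕ Fin m → A) :=
  (((Matrix.toLinAlgEquiv' (R := A) (n := Fin m ⊕ Fin m)).toAlgHom.restrictScalars F).comp
    (AlgHom.mapMatrix f)).comp
    ((Matrix.toLinAlgEquiv' (R := B) (n := Fin m ⊕ Fin m)).symm.toAlgHom.restrictScalars F)

theorem mapEnd_single {B : Type*} [CommRing B] [Algebra F B] (f : B →ₐ[F] A)
    (T : Module.End B (Fin m ⊕ Fin m → B)) (i j : Fin m ⊕ Fin m) :
    mapEnd m f T (Pi.single j 1) i = f (T (Pi.single j 1) i) := by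
  obtain ⟨T, rfl⟩ := Matrix.toLinAlgEquiv'.surjective T
  simp [mapEnd]

theorem end_ext_single {T T' : Module.End A (Fin m ⊕ Fin m → A)}
    (h : ∀ i j, T (Pi.single j 1) i = T' (Pi.single j 1) i) : T = T' :=
  LinearMap.pi_ext' fun j => LinearMap.ext_ring (funext fun i => h i j)

theorem mapEnd_smul_baseEnd {B : Type*} [CommRing B] [Algebra F B] (f : B →ₐ[F] A) (b : B)
    (X : Matrix (Fin m ⊕ Fin m) (Fin m ⊕ Fin m) F) :
    mapEnd m f (b • baseEnd B m X) = f b • baseEnd A m X :=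
  end_ext_single fun i j => by
    simp only [mapEnd_single, LinearMap.smul_apply, Pi.smul_apply, baseEnd_single, smul_eq_mul,
      map_mul, AlgHom.commutes]

/-- An associative relation between skew matrices is preserved by the twist. -/
theorem lift_eq_zero (hm : 2 ≤ m)
    (hsub : ∀ g : G, ℒ g ≤ spMatrix F m) (hsup : (⨆ g : G, ℒ g) = spMatrix F m)
    (hbr : ∀ g h : G, ∀ x ∈ ℒ g, ∀ y ∈ ℒ h, x * y - y * x ∈ ℒ (g * h))
    (h2 : IsUnit (2 : F)) (χ : G →* A)
    {ρ ρ' : Matrix (Fin m ⊕ Fin m) (Fin m ⊕ Fin m) F →ₗ[F] Module.End A (Fin m ⊕ Fin m → A)}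
    (hρ : ∀ g, ∀ X ∈ ℒ g, ρ X = χ g • baseEnd A m X)
    (hρ' : ∀ g, ∀ X ∈ ℒ g, ρ' X = χ g⁻¹ • baseEnd A m X)
    {x : FreeAlgebra F (spMatrix F m)} (hx : FreeAlgebra.lift F (spMatrix F m).subtype x = 0) :
    FreeAlgebra.lift F (ρ ∘ₗ (spMatrix F m).subtype) x = 0 := by
  refine end_ext_single fun i j => eq_zero_of_localization _ fun J _ => ?_
  let f : A →ₐ[F] Localization.AtPrime J := IsScalarTower.toAlgHom F A (Localization.AtPrime J)
  have h2' : IsUnit (2 : Localization.AtPrime J) := by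
    have := h2.map (algebraMap F (Localization.AtPrime J))
    rwa [map_ofNat] at this
  have h := lift_eq_zero_of_isLocalRing hm hsub hsup hbr h2' ((f : A →* _).comp χ)
    (ρ := (mapEnd m f).toLinearMap ∘ₗ ρ) (ρ' := (mapEnd m f).toLinearMap ∘ₗ ρ')
    (fun g X hX => by
      rw [LinearMap.comp_apply, hρ g X hX]; exact mapEnd_smul_baseEnd f _ X)
    (fun g X hX => by
      rw [LinearMap.comp_apply, hρ' g X hX]; exact mapEnd_smul_baseEnd f _ X) hx
  have hcomp : FreeAlgebra.lift F (((mapEnd m f).toLinearMap ∘ₗ ρ) ∘ₗ (spMatrix F m).subtype) =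
      (mapEnd m f).comp (FreeAlgebra.lift F (ρ ∘ₗ (spMatrix F m).subtype)) :=
    FreeAlgebra.hom_ext (funext fun X => by simp)
  rw [hcomp, AlgHom.comp_apply] at h
  have := mapEnd_single f (FreeAlgebra.lift F (ρ ∘ₗ (spMatrix F m).subtype) x) i j
  rw [h] at this
  exact this.symm

theorem isUnit_det_sympJ : IsUnit (sympJ F m).det := by
  refine Matrix.isUnit_det_of_left_inverse (B := -sympJ F m) ?_
  simp [sympJ, Matrix.fromBlocks_multiply, Matrix.fromBlocks_neg]

theorem sympInvolution_of_mem {X : Matrix (Fin m ⊕ Fin m) (Fin m ⊕ Fin m) F}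
    (hX : X ∈ spMatrix F m) : sympInvolution F m X = -X := by
  have h : Xᵀ * sympJ F m = -(sympJ F m * X) := hX
  change (sympJ F m)⁻¹ * Xᵀ * sympJ F m = -X
  rw [Matrix.mul_assoc, h, Matrix.mul_neg, Matrix.nonsing_inv_mul_cancel_left _ _ isUnit_det_sympJ]

theorem sympInvolution_mul (X Y : Matrix (Fin m ⊕ Fin m) (Fin m ⊕ Fin m) F) :
    sympInvolution F m (X * Y) = sympInvolution F m Y * sympInvolution F m X := by
  change (sympJ F m)⁻¹ * (X * Y)ᵀ * sympJ F m =
    (sympJ F m)⁻¹ * Yᵀ * sympJ F m * ((sympJ F m)⁻¹ * Xᵀ * sympJ F m)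
  rw [Matrix.transpose_mul]
  simp only [Matrix.mul_assoc, Matrix.mul_nonsing_inv_cancel_left _ _ isUnit_det_sympJ]

theorem sympInvolution_one : sympInvolution F m 1 = 1 := by
  change (sympJ F m)⁻¹ * 1ᵀ * sympJ F m = 1
  rw [Matrix.transpose_one, Matrix.mul_one, Matrix.nonsing_inv_mul _ isUnit_det_sympJ]

/-- The matrix algebra is generated by the symplectic Lie algebra. -/
theorem adjoin_spMatrix :
    Algebra.adjoin F (spMatrix F m : Set (Matrix (Fin m ⊕ Fin m) (Fin m ⊕ Fin m) F)) = ⊤ := by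
  have mem : ∀ Y : Module.End F (Fin m ⊕ Fin m → F), IsSkewEnd (stdSympForm F m) Y →
      Matrix.toLinAlgEquiv'.symm Y ∈
        Algebra.adjoin F (spMatrix F m : Set (Matrix (Fin m ⊕ Fin m) (Fin m ⊕ Fin m) F)) :=
    fun Y hY => Algebra.subset_adjoin
      (by rwa [SetLike.mem_coe, mem_spMatrix_iff, AlgEquiv.apply_symm_apply])
  refine eq_top_iff.2 fun X _ => ?_
  rw [Matrix.matrix_eq_sum_single X]
  refine Subalgebra.sum_mem _ fun i _ => Subalgebra.sum_mem _ fun j _ => ?_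
  let ω := stdSympForm F m
  have hω : ω.IsAlt := stdSympForm_isAlt
  have hc : ω (sympDual F m i) (Pi.single i 1) = 1 := by simp [ω, stdSympForm_sympDual]
  have key : Matrix.single i j (X i j) = X i j • (Matrix.toLinAlgEquiv'.symm
      (rankOneEnd ω (Pi.single i 1)) * Matrix.toLinAlgEquiv'.symm
        (transvecEnd ω (sympDual F m i) (Pi.single i 1) (-sympDual F m j))) := by
    refine Matrix.toLinAlgEquiv'.injective (LinearMap.ext fun z => ?_)
    have h := isSkewEnd_transvecEnd hω (sympDual F m i) (Pi.single i 1) (-sympDual F m j)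
      (Pi.single i 1) z
    rw [transvecEnd_apply_self hc, map_neg, LinearMap.neg_apply, neg_inj,
      stdSympForm_sympDual] at h
    rw [map_smul, map_mul, AlgEquiv.apply_symm_apply, AlgEquiv.apply_symm_apply,
      LinearMap.smul_apply, Module.End.mul_apply, rankOneEnd_apply, ← h,
      Matrix.toLinAlgEquiv'_apply, Matrix.single_mulVec]
    ext k
    simp [Function.update_apply, Pi.single_apply]
  rw [key]
  exact Subalgebra.smul_mem _ (Subalgebra.mul_mem _ (mem _ (isSkewEnd_rankOneEnd hω _))
    (mem _ (isSkewEnd_transvecEnd hω _ _ _))) _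

theorem adjoin_spMatrix_induction {p : Matrix (Fin m ⊕ Fin m) (Fin m ⊕ Fin m) F → Prop}
    (hsp : ∀ X ∈ spMatrix F m, p X) (halg : ∀ r, p (algebraMap F _ r))
    (hadd : ∀ X Y, p X → p Y → p (X + Y)) (hmul : ∀ X Y, p X → p Y → p (X * Y)) (X) : p X :=
  Algebra.adjoin_induction (p := fun X _ => p X) hsp halg (fun X Y _ _ => hadd X Y)
    (fun X Y _ _ => hmul X Y) (adjoin_spMatrix (F := F) (m := m) ▸ Algebra.mem_top)

/-- A twist of the symplectic Lie algebra extends to the associative algebra of matrices. -/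
theorem exists_algHom_extending (hm : 2 ≤ m)
    (hsub : ∀ g : G, ℒ g ≤ spMatrix F m) (hind : iSupIndep ℒ)
    (hsup : (⨆ g : G, ℒ g) = spMatrix F m)
    (hbr : ∀ g h : G, ∀ x ∈ ℒ g, ∀ y ∈ ℒ h, x * y - y * x ∈ ℒ (g * h))
    (h2 : IsUnit (2 : F)) (χ : G →* A) :
    ∃ Ψ : Matrix (Fin m ⊕ Fin m) (Fin m ⊕ Fin m) F →ₐ[F] Module.End A (Fin m ⊕ Fin m → A),
      ∀ g, ∀ X ∈ ℒ g, Ψ X = χ g • baseEnd A m X := by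
  obtain ⟨ρ, hρ⟩ := hind.exists_linearMap_extending fun g =>
    χ g • (baseEnd (F := F) A m).toLinearMap
  obtain ⟨ρ', hρ'⟩ := hind.exists_linearMap_extending fun g =>
    χ g⁻¹ • (baseEnd (F := F) A m).toLinearMap
  let α := FreeAlgebra.lift F (spMatrix F m).subtype
  let β := FreeAlgebra.lift F (ρ ∘ₗ (spMatrix F m).subtype)
  have hker : ∀ x, α x = 0 → β x = 0 := fun x => lift_eq_zero hm hsub hsup hbr h2 χ hρ hρ'
  have hα : α.range = ⊤ := by
    rw [eq_top_iff, ← adjoin_spMatrix, Algebra.adjoin_le_iff]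
    exact fun X hX => ⟨FreeAlgebra.ι F ⟨X, hX⟩, FreeAlgebra.lift_ι_apply _ _⟩
  obtain ⟨s, hs⟩ := α.toLinearMap.exists_rightInverse_of_surjective
    (LinearMap.range_eq_top.2 ((AlgHom.range_eq_top _).1 hα))
  have hs' : ∀ X, α (s X) = X := LinearMap.congr_fun hs
  have hβ : ∀ x, β (s (α x)) = β x := fun x => by
    rw [← sub_eq_zero, ← map_sub]
    exact hker _ (by rw [map_sub, hs', sub_self])
  refine ⟨AlgHom.ofLinearMap (β.toLinearMap ∘ₗ s) ?_ fun X Y => ?_, fun g X hX => ?_⟩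
  · have := hβ 1
    rwa [map_one α, map_one β] at this
  · have := hβ (s X * s Y)
    rwa [map_mul α, hs', hs', map_mul β] at this
  · have := hβ (FreeAlgebra.ι F ⟨X, hsub g hX⟩)
    simp only [α, β, FreeAlgebra.lift_ι_apply] at this
    exact this.trans (hρ g X hX)

/-- An algebra homomorphism mapping the symplectic Lie algebra to skew endomorphisms intertwines
the symplectic involution with the adjoint. -/
theorem stdSympForm_apply_sympInvolution
    {Ψ : Matrix (Fin m ⊕ Fin m) (Fin m ⊕ Fin m) F →ₐ[F] Module.End A (Fin m ⊕ Fin m → A)}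
    (hΨ : ∀ X ∈ spMatrix F m, IsSkewEnd (stdSympForm A m) (Ψ X))
    (X : Matrix (Fin m ⊕ Fin m) (Fin m ⊕ Fin m) F) : ∀ a b,
      stdSympForm A m (Ψ X a) b = stdSympForm A m a (Ψ (sympInvolution F m X) b) := by
  induction X using adjoin_spMatrix_induction with
  | hsp X hX =>
    intro a b
    rw [sympInvolution_of_mem hX, map_neg, LinearMap.neg_apply, map_neg, hΨ X hX]
  | halg r =>
    intro a b
    rw [Algebra.algebraMap_eq_smul_one, map_smul, map_smul, sympInvolution_one, map_smul, map_one,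
      LinearMap.smul_apply, LinearMap.smul_apply, Module.End.one_apply, Module.End.one_apply,
      ← algebraMap_smul A r a, ← algebraMap_smul A r b, map_smul, map_smul, LinearMap.smul_apply]
  | hadd X Y hX hY => intro a b; simp only [map_add, LinearMap.add_apply, hX, hY]
  | hmul X Y hX hY =>
    intro a b
    simp only [sympInvolution_mul, map_mul, Module.End.mul_apply, hX, hY]

theorem sympInvolution_sympInvolution (X : Matrix (Fin m ⊕ Fin m) (Fin m ⊕ Fin m) F) :
    sympInvolution F m (sympInvolution F m X) = X := by
  induction X using adjoin_spMatrix_induction with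
  | hsp X hX => rw [sympInvolution_of_mem hX, map_neg, sympInvolution_of_mem hX, neg_neg]
  | halg r => rw [Algebra.algebraMap_eq_smul_one, map_smul, map_smul, sympInvolution_one,
      sympInvolution_one]
  | hadd X Y hX hY => rw [map_add, map_add, hX, hY]
  | hmul X Y hX hY => rw [sympInvolution_mul, sympInvolution_mul, hX, hY]

/-- The matrices on which `Ψ` is the extension of scalars scaled by `c`. -/
noncomputable def twistEigenspace
    (Ψ : Matrix (Fin m ⊕ Fin m) (Fin m ⊕ Fin m) F →ₐ[F] Module.End A (Fin m ⊕ Fin m → A)) (c : A) :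
    Submodule F (Matrix (Fin m ⊕ Fin m) (Fin m ⊕ Fin m) F) :=
  LinearMap.eqLocus Ψ.toLinearMap (c • (baseEnd A m).toLinearMap)

section TwistEigenspace

variable {Ψ : Matrix (Fin m ⊕ Fin m) (Fin m ⊕ Fin m) F →ₐ[F] Module.End A (Fin m ⊕ Fin m → A)}

theorem mem_twistEigenspace {c : A} {X : Matrix (Fin m ⊕ Fin m) (Fin m ⊕ Fin m) F} :
    X ∈ twistEigenspace Ψ c ↔ Ψ X = c • baseEnd A m X := Iff.rfl

theorem mul_mem_twistEigenspace {c d : A} {X Y : Matrix (Fin m ⊕ Fin m) (Fin m ⊕ Fin m) F}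
    (hX : X ∈ twistEigenspace Ψ c) (hY : Y ∈ twistEigenspace Ψ d) :
    X * Y ∈ twistEigenspace Ψ (c * d) := by
  rw [mem_twistEigenspace] at *
  rw [map_mul, map_mul, hX, hY, smul_mul_smul_comm]

theorem sympInvolution_mem_twistEigenspace
    (hΨ : ∀ X ∈ spMatrix F m, IsSkewEnd (stdSympForm A m) (Ψ X)) {c : A}
    {X : Matrix (Fin m ⊕ Fin m) (Fin m ⊕ Fin m) F} (hX : X ∈ twistEigenspace Ψ c) :
    sympInvolution F m X ∈ twistEigenspace Ψ c := by
  rw [mem_twistEigenspace] at *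
  refine LinearMap.ext fun b => funext fun k => ?_
  rw [← stdSympForm_sympDual k (Ψ _ b), ← stdSympForm_apply_sympInvolution hΨ, hX,
    LinearMap.smul_apply, map_smul, LinearMap.smul_apply,
    stdSympForm_apply_sympInvolution (fun X hX => isSkewEnd_baseEnd hX), stdSympForm_sympDual]
  rfl

theorem map_sympInvolution_twistEigenspace
    (hΨ : ∀ X ∈ spMatrix F m, IsSkewEnd (stdSympForm A m) (Ψ X)) (c : A) :
    (twistEigenspace Ψ c).map (sympInvolution F m) = twistEigenspace Ψ c := by
  refine le_antisymm (Submodule.map_le_iff_le_comap.2 fun X hX =>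
    sympInvolution_mem_twistEigenspace hΨ hX) fun X hX =>
    ⟨_, sympInvolution_mem_twistEigenspace hΨ hX, sympInvolution_sympInvolution X⟩

theorem iSup_twistEigenspace (hsup : (⨆ g : G, ℒ g) = spMatrix F m) {χ : G →* A}
    (hℒ : ∀ g, ℒ g ≤ twistEigenspace Ψ (χ g)) : ⨆ g, twistEigenspace Ψ (χ g) = ⊤ := by
  refine eq_top_iff.2 fun X _ => ?_
  induction X using adjoin_spMatrix_induction with
  | hsp X hX => exact (hsup ▸ iSup_mono hℒ : spMatrix F m ≤ _) hX
  | halg r =>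
    refine Submodule.mem_iSup_of_mem 1 ?_
    rw [mem_twistEigenspace, map_one, one_smul, AlgHom.commutes, AlgHom.commutes]
  | hadd X Y hX hY => exact Submodule.add_mem _ (hX trivial) (hY trivial)
  | hmul X Y hX hY =>
    refine Submodule.iSup_induction _ (motive := fun X => X * Y ∈ _) (hX trivial)
      (fun g X hX => ?_) (by simp) fun X X' h h' => by
        rw [add_mul]; exact Submodule.add_mem _ h h'
    refine Submodule.iSup_induction _ (motive := fun Y => X * Y ∈ _) (hY trivial)
      (fun h Y hY => ?_) (by simp) fun X X' h h' => by
        rw [mul_add]; exact Submodule.add_mem _ h h'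
    refine Submodule.mem_iSup_of_mem (g * h) ?_
    rw [map_mul]
    exact mul_mem_twistEigenspace hX hY

end TwistEigenspace

/-- The entrywise coefficient of `Ψ X` at a group element. -/
noncomputable def coeffProj (Ψ : Matrix (Fin m ⊕ Fin m) (Fin m ⊕ Fin m) F →ₐ[F]
      Module.End (MonoidAlgebra F G) (Fin m ⊕ Fin m → MonoidAlgebra F G)) (g : G) :
    Matrix (Fin m ⊕ Fin m) (Fin m ⊕ Fin m) F →ₗ[F] Matrix (Fin m ⊕ Fin m) (Fin m ⊕ Fin m) F where
  toFun X := Matrix.of fun i j => (Ψ X (Pi.single j 1) i).coeff g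
  map_add' X Y := by ext; simp
  map_smul' c X := by ext; simp

theorem coeffProj_apply_of_mem [DecidableEq G] {Ψ : Matrix (Fin m ⊕ Fin m) (Fin m ⊕ Fin m) F →ₐ[F]
      Module.End (MonoidAlgebra F G) (Fin m ⊕ Fin m → MonoidAlgebra F G)} {g h : G}
    {X : Matrix (Fin m ⊕ Fin m) (Fin m ⊕ Fin m) F}
    (hX : X ∈ twistEigenspace Ψ (MonoidAlgebra.of F G h)) :
    coeffProj Ψ g X = if h = g then X else 0 := by
  ext i j
  change (Ψ X (Pi.single j 1) i).coeff g = _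
  rw [mem_twistEigenspace.1 hX, LinearMap.smul_apply, Pi.smul_apply, baseEnd_single, smul_eq_mul]
  split_ifs with hgh <;> simp [hgh]

end Grading

/-- Every `G`-grading of the Lie algebra `sp_{2m}(F)` (`m ≥ 2`,
`char F ≠ 2`) is the restriction of a `G`-grading of the associative matrix algebra
whose components are invariant under the symplectic involution `φ(X) = J⁻¹ Xᵀ J`. -/
theorem sp_grading_lifts
    {F : Type*} [Field F] [IsAlgClosed F] (hchar : ringChar F ≠ 2)
    {G : Type*} [CommGroup G] [DecidableEq G] {m : ℕ} (hm : 2 ≤ m)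
    (ℒ : G → Submodule F (Matrix (Fin m ⊕ Fin m) (Fin m ⊕ Fin m) F))
    (hsub : ∀ g : G, ℒ g ≤ spMatrix F m)
    (hind : iSupIndep ℒ)
    (hsup : (⨆ g : G, ℒ g) = spMatrix F m)
    (hbr : ∀ g h : G, ∀ x ∈ ℒ g, ∀ y ∈ ℒ h, x * y - y * x ∈ ℒ (g * h)) :
    ∃ ℛ : G → Submodule F (Matrix (Fin m ⊕ Fin m) (Fin m ⊕ Fin m) F),
      DirectSum.IsInternal ℛ ∧
      (∀ g h : G, ∀ x ∈ ℛ g, ∀ y ∈ ℛ h, x * y ∈ ℛ (g * h)) ∧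
      (∀ g : G, (ℛ g).map (sympInvolution F m) = ℛ g) ∧
      (∀ g : G, ℒ g = ℛ g ⊓ spMatrix F m) := by
  have h2 : IsUnit (2 : F) := (Ring.two_ne_zero hchar).isUnit
  obtain ⟨Ψ, hΨ⟩ := exists_algHom_extending hm hsub hind hsup hbr h2 (MonoidAlgebra.of F G)
  let ℛ : G → Submodule F (Matrix (Fin m ⊕ Fin m) (Fin m ⊕ Fin m) F) := fun g =>
    twistEigenspace Ψ (MonoidAlgebra.of F G g)
  have hℒ : ∀ g, ℒ g ≤ ℛ g := hΨ
  have hproj : ∀ g h, ∀ X ∈ ℛ h, coeffProj Ψ g X = if h = g then X else 0 :=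
    fun g h X hX => coeffProj_apply_of_mem hX
  have hskew : ∀ X ∈ spMatrix F m, IsSkewEnd (stdSympForm (MonoidAlgebra F G) m) (Ψ X) := by
    have hle : spMatrix F m ≤
        ((skewEnds (stdSympForm (MonoidAlgebra F G) m)).restrictScalars F).comap Ψ.toLinearMap :=
      hsup ▸ iSup_le fun g X hX => by
        change IsSkewEnd _ (Ψ X)
        rw [hΨ g X hX]
        exact (isSkewEnd_baseEnd (hsub g hX)).smul _
    exact hle
  refine ⟨ℛ, ?_, fun g h X hX Y hY => ?_, fun g => map_sympInvolution_twistEigenspace hskew _,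
    fun g => le_antisymm (le_inf (hℒ g) (hsub g)) fun X hX => ?_⟩
  · refine (DirectSum.isInternal_submodule_iff_iSupIndep_and_iSup_eq_top _).2
      ⟨fun g => Submodule.disjoint_def.2 fun X hX hX' => ?_, iSup_twistEigenspace hsup hℒ⟩
    have hle : ⨆ h, ⨆ (_ : h ≠ g), ℛ h ≤ LinearMap.ker (coeffProj Ψ g) :=
      iSup₂_le fun h hh Y hY => by rw [LinearMap.mem_ker, hproj g h Y hY, if_neg hh]
    rw [← hle hX', hproj g g X hX, if_pos rfl]
  · change X * Y ∈ twistEigenspace Ψ _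
    rw [map_mul]
    exact mul_mem_twistEigenspace hX hY
  · have hle : spMatrix F m ≤ (ℒ g).comap (coeffProj Ψ g) := hsup ▸ iSup_le fun h Y hY => by
      rw [Submodule.mem_comap, hproj g h Y (hℒ h hY)]
      split_ifs with hgh
      · exact hgh ▸ hY
      · exact Submodule.zero_mem _
    have := hle hX.2
    rwa [Submodule.mem_comap, hproj g g X hX.1, if_pos rfl] at this
end

section
/- Let F be an algebraically closed field with char F ≠ 2, let n ≥ 3, and if n = 3 assume also char F ≠ 3. Let Z = F·I ∩ sl_n(F) be the center of sl_n(F) and L = psl_n(F) = sl_n(F)/Z. Let G be an abelian group and L = ⊕_{g∈G} L_g a G-grading of the Lie algebra L. Then there exists a vector space decomposition M_n(F) = ⊕_{g∈G} R_g with [R_g, R_h] ⊆ R_{gh} for all g,h ∈ G (a G-grading of the Lie algebra gl_n(F)) such that L_g equals the image in L of R_g ∩ sl_n(F) for every g, and one of the following holds: (Type I) R_g R_h ⊆ R_{gh} for all g,h ∈ G, i.e., the decomposition is a grading of the associative algebra M_n(F); or (Type II) there exist an element h₀ ∈ G with h₀ ≠ e and h₀² = e, a group homomorphism χ : G → Fˣ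 with χ(h₀) = −1, and an F-linear anti-automorphism φ of M_n(F), such that the subspaces R̄_{ḡ} := R_g + R_{g h₀} (ḡ ∈ G/⟨h₀⟩) form a G/⟨h₀⟩-grading of the associative algebra M_n(F), φ(R̄_{ḡ}) = R̄_{ḡ} for all ḡ, and R_g = {X ∈ R̄_{ḡ} : φ(X) = −χ(g)X} for every g ∈ G. -/
/-- The Lie algebra `sl_n(F)` of traceless matrices, as a subspace of `Mₙ(F)`. -/
def slM (F : Type*) [Field F] (n : ℕ) : Submodule F (Matrix (Fin n) (Fin n) F) :=
  LinearMap.ker (Matrix.traceLinearMap (Fin n) F F)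

/-- The center `Z = F·I ∩ sl_n(F)` of `sl_n(F)`, as a subspace of `sl_n(F)`. -/
def slCenter (F : Type*) [Field F] (n : ℕ) : Submodule F ↥(slM F n) :=
  Submodule.comap (slM F n).subtype
    (Submodule.span F {(1 : Matrix (Fin n) (Fin n) F)})

/-- The commutator bracket on `sl_n(F)`. -/
def slBracket (F : Type*) [Field F] (n : ℕ) (x y : ↥(slM F n)) : ↥(slM F n) :=
  ⟨(x : Matrix (Fin n) (Fin n) F) * y - (y : Matrix (Fin n) (Fin n) F) * x,
    LinearMap.mem_ker.mpr (by
      rw [Matrix.traceLinearMap_apply, Matrix.trace_sub, Matrix.trace_mul_comm,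
        sub_self])⟩

open Matrix

section MatrixUnits

variable {F : Type*} [Field F] {n : ℕ}

/-- The quotient of `Mₙ(F)` by the scalar matrices. -/
abbrev PGL (F : Type*) [Field F] (n : ℕ) : Type _ :=
  Matrix (Fin n) (Fin n) F ⧸ Submodule.span F {(1 : Matrix (Fin n) (Fin n) F)}

/-- The projection of `Mₙ(F)` onto its quotient by the scalar matrices. -/
abbrev toPGL (F : Type*) [Field F] (n : ℕ) : Matrix (Fin n) (Fin n) F →ₗ[F] PGL F n :=
  (Submodule.span F {(1 : Matrix (Fin n) (Fin n) F)}).mkQ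

/-- The commutator as a bilinear map on `Mₙ(F)`. -/
def matBracket (F : Type*) [Field F] (n : ℕ) :
    Matrix (Fin n) (Fin n) F →ₗ[F] Matrix (Fin n) (Fin n) F →ₗ[F] Matrix (Fin n) (Fin n) F :=
  LinearMap.mul F (Matrix (Fin n) (Fin n) F) - (LinearMap.mul F (Matrix (Fin n) (Fin n) F)).flip

@[simp] lemma matBracket_apply (x y : Matrix (Fin n) (Fin n) F) : matBracket F n x y = ⁅x, y⁆ := rfl

/-- The adjoint action of `Mₙ(F)` on its quotient by the scalar matrices. -/
def adPGL (F : Type*) [Field F] (n : ℕ) :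
    Matrix (Fin n) (Fin n) F →ₗ[F] PGL F n →ₗ[F] PGL F n :=
  ((Submodule.span F {(1 : Matrix (Fin n) (Fin n) F)}).liftQ
    (((matBracket F n).compr₂ (toPGL F n)).flip) (by
      rw [Submodule.span_singleton_le_iff_mem, LinearMap.mem_ker]
      ext y
      simp [Ring.lie_def])).flip

@[simp] lemma adPGL_toPGL (y x : Matrix (Fin n) (Fin n) F) :
    adPGL F n y (toPGL F n x) = toPGL F n ⁅y, x⁆ := rfl

lemma toPGL_eq_zero_iff {x : Matrix (Fin n) (Fin n) F} :
    toPGL F n x = 0 ↔ ∃ c : F, c • (1 : Matrix (Fin n) (Fin n) F) = x := by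
  rw [Submodule.mkQ_apply, Submodule.Quotient.mk_eq_zero, Submodule.mem_span_singleton]

lemma toPGL_eq_zero_iff_entries (hn : 3 ≤ n) {x : Matrix (Fin n) (Fin n) F} :
    toPGL F n x = 0 ↔ (∀ k l, k ≠ l → x k l = 0) ∧ ∀ k l, x k k = x l l := by
  rw [toPGL_eq_zero_iff]
  constructor
  · rintro ⟨c, rfl⟩
    refine ⟨fun k l h => ?_, fun k l => ?_⟩ <;> simp [*]
  · rintro ⟨h1, h2⟩
    let i₀ : Fin n := ⟨0, by omega⟩
    refine ⟨x i₀ i₀, ?_⟩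
    ext k l
    by_cases h : k = l
    · subst h; simp [h2 k i₀]
    · simp [h, h1 k l h]

lemma Fin.exists_ne_and_ne (hn : 3 ≤ n) (i j : Fin n) : ∃ k, k ≠ i ∧ k ≠ j := by
  have : ({i, j} : Finset (Fin n)).card < (Finset.univ : Finset (Fin n)).card :=
    lt_of_le_of_lt Finset.card_le_two (by rw [Finset.card_univ, Fintype.card_fin]; omega)
  obtain ⟨k, -, hk⟩ := Finset.exists_mem_notMem_of_card_lt_card this
  exact ⟨k, by simpa using hk⟩

lemma Matrix.mul_single_one_apply (x : Matrix (Fin n) (Fin n) F) (i j k l : Fin n) :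
    (x * single i j (1 : F)) k l = if l = j then x k i else 0 := by
  split_ifs with h
  · subst h; simp
  · simp [h]

lemma Matrix.single_one_mul_apply (x : Matrix (Fin n) (Fin n) F) (i j k l : Fin n) :
    (single i j (1 : F) * x) k l = if k = i then x j l else 0 := by
  split_ifs with h
  · subst h; simp
  · simp [h]

lemma Matrix.lie_single_single (i j k l : Fin n) :
    ⁅single i j (1 : F), single k l (1 : F)⁆ =
      (if j = k then single i l 1 else 0) - if l = i then single k j 1 else 0 := by
  rw [Ring.lie_def]
  congr 1 <;> split_ifs with h
  · subst h; simp
  · simp [h]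
  · subst h; simp
  · simp [h]

lemma mem_of_trace_eq_zero (hn : 3 ≤ n) {K : Submodule F (Matrix (Fin n) (Fin n) F)}
    (h1 : ∀ i j : Fin n, i ≠ j → single i j (1 : F) ∈ K)
    (h2 : ∀ i j : Fin n, single i i (1 : F) - single j j (1 : F) ∈ K)
    {x : Matrix (Fin n) (Fin n) F} (hx : x.trace = 0) : x ∈ K := by
  let i₀ : Fin n := ⟨0, by omega⟩
  have key : x = ∑ i, ∑ j, x i j • (single i j (1 : F) - if i = j then single i₀ i₀ 1 else 0) := by
    have h3 : ∑ i, ∑ j, x i j • (if i = j then single i₀ i₀ (1 : F) else 0) = 0 := by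
      simp only [smul_ite, smul_zero, Finset.sum_ite_eq, Finset.mem_univ, if_true]
      rw [← Finset.sum_smul]
      change x.trace • _ = _
      rw [hx, zero_smul]
    simp only [smul_sub, Finset.sum_sub_distrib]
    rw [h3, sub_zero]
    conv_lhs => rw [matrix_eq_sum_single x]
    simp
  rw [key]
  refine Submodule.sum_mem _ fun i _ => Submodule.sum_mem _ fun j _ => Submodule.smul_mem _ _ ?_
  split_ifs with h
  · subst h; exact h2 _ _
  · simpa using h1 _ _ h

lemma mem_of_trace_eq_zero_of_lie_closed (hn : 3 ≤ n)
    {K : Submodule F (Matrix (Fin n) (Fin n) F)}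
    (hK : ∀ i j : Fin n, i ≠ j → ∀ x ∈ K, x.trace = 0 → ⁅single i j (1 : F), x⁆ ∈ K)
    {a b : Fin n} (hab : a ≠ b) (h : single a b (1 : F) ∈ K)
    {x : Matrix (Fin n) (Fin n) F} (hx : x.trace = 0) : x ∈ K := by
  have row : ∀ i j k : Fin n, i ≠ j → k ≠ j → single i j (1 : F) ∈ K → single k j (1 : F) ∈ K := by
    intro i j k hij hkj hm
    by_cases hki : k = i
    · rwa [hki]
    · have := hK k i hki _ hm (trace_single_eq_of_ne _ _ _ hij)
      rw [lie_single_single] at this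
      simpa [hkj.symm] using this
  have col : ∀ i j k : Fin n, i ≠ j → k ≠ i → single i j (1 : F) ∈ K → single i k (1 : F) ∈ K := by
    intro i j k hij hki hm
    by_cases hkj : k = j
    · rwa [hkj]
    · have := hK j k (Ne.symm hkj) _ hm (trace_single_eq_of_ne _ _ _ hij)
      rw [lie_single_single] at this
      simpa [hki] using this
  have all : ∀ i j : Fin n, i ≠ j → single i j (1 : F) ∈ K := by
    have main : ∀ i j : Fin n, i ≠ j → i ≠ b → single i j (1 : F) ∈ K := fun i j hij hib =>
      col _ b _ hib hij.symm (row a _ _ hab hib h)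
    intro i j hij
    by_cases hib : i = b
    · subst hib
      obtain ⟨c, hc1, hc2⟩ := Fin.exists_ne_and_ne hn a i
      exact col _ c _ (Ne.symm hc2) hij.symm (row a _ _ (Ne.symm hc1) (Ne.symm hc2)
        (main a c (Ne.symm hc1) hab))
    · exact main i j hij hib
  refine mem_of_trace_eq_zero hn all (fun i j => ?_) hx
  by_cases hij : i = j
  · simp [hij]
  · have := hK i j hij _ (all j i (Ne.symm hij)) (trace_single_eq_of_ne _ _ _ (Ne.symm hij))
    rw [lie_single_single] at this
    simpa using this

lemma mem_of_trace_eq_zero_of_centralizer_closed (hn : 3 ≤ n)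
    {K : Submodule F (Matrix (Fin n) (Fin n) F)} {a b : Fin n} (hab : a ≠ b)
    (hK : ∀ i j : Fin n, i ≠ j → i ≠ b → j ≠ a →
      ∀ x ∈ K, x.trace = 0 → ⁅single i j (1 : F), x⁆ ∈ K)
    (h : single b a (1 : F) ∈ K)
    {x : Matrix (Fin n) (Fin n) F} (hx : x.trace = 0) : x ∈ K := by
  have step : ∀ i j k l : Fin n, i ≠ j → i ≠ b → j ≠ a → k ≠ l → single k l (1 : F) ∈ K →
      (if j = k then single i l 1 else 0) - (if l = i then single k j (1 : F) else 0) ∈ K := by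
    intro i j k l h1 h2 h3 h4 h5
    rw [← lie_single_single]
    exact hK i j h1 h2 h3 _ h5 (trace_single_eq_of_ne _ _ _ h4)
  have h_bj : ∀ j, j ≠ b → single b j (1 : F) ∈ K := by
    intro j hjb
    by_cases hja : j = a
    · rwa [hja]
    · have := step a j b a (Ne.symm hja) hab hja hab.symm h
      simpa [hjb] using this
  have h_ia : ∀ i, i ≠ a → single i a (1 : F) ∈ K := by
    intro i hia
    by_cases hib : i = b
    · rwa [hib]
    · have := step i b b a hib hib hab.symm hab.symm h
      simpa [Ne.symm hia] using this
  have h_diag_ab : single a a (1 : F) - single b b 1 ∈ K := by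
    simpa using step a b b a hab hab hab.symm hab.symm h
  have h_aj' : ∀ j, j ≠ a → j ≠ b → single a j (1 : F) ∈ K := by
    intro j hja hjb
    have := step a b b j hab hab hab.symm (Ne.symm hjb) (h_bj j hjb)
    simpa [hja] using this
  have h_ib' : ∀ i, i ≠ a → i ≠ b → single i b (1 : F) ∈ K := by
    intro i hia hib
    have := step a b i a hab hab hab.symm hia (h_ia i hia)
    simpa [Ne.symm hib] using this
  have h_ab : single a b (1 : F) ∈ K := by
    obtain ⟨j, hja, hjb⟩ := Fin.exists_ne_and_ne hn a b
    have := step a j j b (Ne.symm hja) hab hja hjb (h_ib' j hja hjb)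
    simpa [hab.symm] using this
  have all : ∀ i j : Fin n, i ≠ j → single i j (1 : F) ∈ K := by
    intro i j hij
    by_cases hib : i = b
    · subst hib; exact h_bj j (Ne.symm hij)
    by_cases hja : j = a
    · subst hja; exact h_ia i hij
    by_cases hia : i = a
    · subst hia
      by_cases hjb : j = b
      · rwa [hjb]
      · exact h_aj' j hja hjb
    by_cases hjb : j = b
    · subst hjb; exact h_ib' i hia hib
    have := step a j i a (Ne.symm hja) hab hja hia (h_ia i hia)
    simpa [Ne.symm hij] using this
  have h_diag_a : ∀ j, single a a (1 : F) - single j j 1 ∈ K := by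
    intro j
    by_cases hja : j = a
    · simp [hja]
    · simpa using step a j j a (Ne.symm hja) hab hja hja (h_ia j hja)
  refine mem_of_trace_eq_zero hn all (fun i j => ?_) hx
  have := K.sub_mem (h_diag_a j) (h_diag_a i)
  simpa using this

end MatrixUnits

section InvariantMaps

variable {F : Type*} [Field F] {n : ℕ}

lemma Matrix.lie_diagonal_apply (v : Fin n → F) (x : Matrix (Fin n) (Fin n) F) (k l : Fin n) :
    ⁅diagonal v, x⁆ k l = (v k - v l) * x k l := by
  rw [Ring.lie_def, sub_apply, diagonal_mul, mul_diagonal]; ring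

lemma Matrix.lie_diagonal_single (v : Fin n → F) (i j : Fin n) :
    ⁅diagonal v, single i j (1 : F)⁆ = (v i - v j) • single i j 1 := by
  ext k l
  rw [lie_diagonal_apply, smul_apply, single_apply]
  split_ifs with h
  · simp [h.1, h.2]
  · simp

lemma Matrix.lie_single_apply (x : Matrix (Fin n) (Fin n) F) (i j k l : Fin n) :
    ⁅single i j (1 : F), x⁆ k l = (if k = i then x j l else 0) - if l = j then x k i else 0 := by
  rw [Ring.lie_def, sub_apply, single_one_mul_apply, mul_single_one_apply]

lemma Matrix.trace_lie (x y : Matrix (Fin n) (Fin n) F) : (⁅x, y⁆).trace = 0 := by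
  rw [Ring.lie_def, trace_sub, trace_mul_comm, sub_self]

lemma Matrix.trace_diagonal_single_sub (i j : Fin n) :
    (diagonal (Pi.single i 1 - Pi.single j 1 : Fin n → F)).trace = 0 := by
  simp [trace_diagonal]

lemma lie_single_eq_of_toPGL_eq_zero (hn : 3 ≤ n) {x : Matrix (Fin n) (Fin n) F} {i j : Fin n}
    (h : toPGL F n ⁅single i j (1 : F), x⁆ = 0) (k l : Fin n) :
    (if k = i then x j l else 0) = if l = j then x k i else 0 := by
  rw [toPGL_eq_zero_iff_entries hn] at h
  rw [← sub_eq_zero, ← lie_single_apply]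
  by_cases hkl : k = l
  · obtain ⟨t, hti, htj⟩ := Fin.exists_ne_and_ne hn i j
    rw [← hkl, h.2 k t, lie_single_apply]
    simp [hti, htj]
  · exact h.1 k l hkl

lemma toPGL_eq_smul_single_of_centralizes (hn : 3 ≤ n) {x : Matrix (Fin n) (Fin n) F}
    {a b : Fin n} (hab : a ≠ b)
    (h : ∀ i j : Fin n, i ≠ j → i ≠ b → j ≠ a → toPGL F n ⁅single i j (1 : F), x⁆ = 0) :
    toPGL F n x = x a b • toPGL F n (single a b 1) := by
  rw [← sub_eq_zero, ← map_smul, ← map_sub, toPGL_eq_zero_iff_entries hn]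
  have h' := fun i j h1 h2 h3 => lie_single_eq_of_toPGL_eq_zero hn (h i j h1 h2 h3)
  have diag : ∀ j, x j j = x a a := by
    intro j
    by_cases hj : j = a
    · rw [hj]
    · simpa using h' a j (Ne.symm hj) hab hj a j
  refine ⟨fun k l hkl => ?_, fun k l => ?_⟩
  · by_cases hka : k = a
    · subst hka
      by_cases hlb : l = b
      · subst hlb; simp
      · obtain ⟨j, hjl, hjk⟩ := Fin.exists_ne_and_ne hn l k
        have := h' l j (Ne.symm hjl) hlb hjk k j
        simp only [hkl, if_false, if_true] at this
        simp [← this, Ne.symm hlb]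
    · obtain ⟨i, hik, hib⟩ := Fin.exists_ne_and_ne hn k b
      have := h' i k hik hib hka i l
      simp only [Ne.symm hkl, if_false, if_true] at this
      simp [this, Ne.symm hka]
  · have : ∀ i, (x - x a b • single a b (1 : F)) i i = x i i := by
      intro i
      have : ¬ (a = i ∧ b = i) := fun h => hab (h.1.trans h.2.symm)
      simp [this]
    rw [this, this, diag, diag l]

/-- An `sl_n`-equivariant map from `sl_n` to `gl_n` modulo scalars is a multiple of the
canonical one. -/
lemma exists_eq_smul_toPGL_of_equivariant (hn : 3 ≤ n)
    (f : Matrix (Fin n) (Fin n) F →ₗ[F] PGL F n)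
    (hf : ∀ y x : Matrix (Fin n) (Fin n) F, y.trace = 0 → x.trace = 0 →
      f ⁅y, x⁆ = adPGL F n y (f x)) :
    ∃ t : F, ∀ x : Matrix (Fin n) (Fin n) F, x.trace = 0 → f x = t • toPGL F n x := by
  let a : Fin n := ⟨0, by omega⟩
  let b : Fin n := ⟨1, by omega⟩
  have hab : a ≠ b := by simp [a, b]
  obtain ⟨m, hm⟩ := Submodule.mkQ_surjective _ (f (single a b 1))
  have key := toPGL_eq_smul_single_of_centralizes hn hab (x := m) (by
    intro i j hij hib hja
    rw [← adPGL_toPGL, hm, ← hf _ _ (trace_single_eq_of_ne _ _ _ hij)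
      (trace_single_eq_of_ne _ _ _ hab), lie_single_single]
    simp [hja, hib.symm])
  refine ⟨m a b, fun x hx => ?_⟩
  refine mem_of_trace_eq_zero_of_lie_closed hn
    (K := LinearMap.eqLocus f (m a b • toPGL F n)) ?_ hab ?_ hx
  · intro i j hij x hx hx0
    rw [LinearMap.mem_eqLocus] at hx ⊢
    rw [hf _ _ (trace_single_eq_of_ne _ _ _ hij) hx0, hx]
    simp only [LinearMap.smul_apply, map_smul, adPGL_toPGL]
  · rw [LinearMap.mem_eqLocus, ← hm, LinearMap.smul_apply]
    exact key

/-- The anticommutator as a bilinear map on `Mₙ(F)`. -/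
def matCirc (F : Type*) [Field F] (n : ℕ) :
    Matrix (Fin n) (Fin n) F →ₗ[F] Matrix (Fin n) (Fin n) F →ₗ[F] Matrix (Fin n) (Fin n) F :=
  LinearMap.mul F (Matrix (Fin n) (Fin n) F) + (LinearMap.mul F (Matrix (Fin n) (Fin n) F)).flip

@[simp] lemma matCirc_apply (x y : Matrix (Fin n) (Fin n) F) :
    matCirc F n x y = x * y + y * x := rfl

lemma lie_matCirc (y x z : Matrix (Fin n) (Fin n) F) :
    ⁅y, matCirc F n x z⁆ = matCirc F n ⁅y, x⁆ z + matCirc F n x ⁅y, z⁆ := by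
  simp only [matCirc_apply, Ring.lie_def]; noncomm_ring

lemma exists_eq_smul_on_opposite_singles (hn : 3 ≤ n) (h2 : (2 : F) ≠ 0)
    (B : Matrix (Fin n) (Fin n) F →ₗ[F] Matrix (Fin n) (Fin n) F →ₗ[F] PGL F n)
    (hB : ∀ y x z : Matrix (Fin n) (Fin n) F, y.trace = 0 → x.trace = 0 → z.trace = 0 →
      adPGL F n y (B x z) = B ⁅y, x⁆ z + B x ⁅y, z⁆)
    (hsymm : ∀ x z : Matrix (Fin n) (Fin n) F, x.trace = 0 → z.trace = 0 → B x z = B z x)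
    {a b : Fin n} (hab : a ≠ b) :
    ∃ c : F, B (single a b 1) (single b a 1) =
      c • toPGL F n (single a a 1 + single b b 1) := by
  have tr := fun i j (h : i ≠ j) => trace_single_eq_of_ne (n := Fin n) i j (1 : F) h
  have hlie_diag : ⁅single b a (1 : F), single a b (1 : F)⁆ =
      single b b 1 - single a a 1 := by simp [lie_single_single]
  have hBaa : B (single a b 1) (single a b 1) = 0 := by
    obtain ⟨m, hm⟩ := Submodule.mkQ_surjective _ (B (single a b 1) (single a b 1))
    have key := toPGL_eq_smul_single_of_centralizes hn hab (x := m) (by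
      intro i j hij hib hja
      rw [← adPGL_toPGL, hm, hB _ _ _ (tr _ _ hij) (tr _ _ hab) (tr _ _ hab), lie_single_single]
      simp [hja, hib.symm])
    rw [toPGL, hm] at key
    have h4 := hB _ _ _ (trace_diagonal_single_sub a b) (tr _ _ hab) (tr _ _ hab)
    rw [lie_diagonal_single, key] at h4
    simp only [map_smul, adPGL_toPGL, lie_diagonal_single, LinearMap.smul_apply, key] at h4
    simp only [Pi.sub_apply, Pi.single_eq_same, Pi.single_eq_of_ne hab,
      Pi.single_eq_of_ne hab.symm, smul_smul, ← add_smul] at h4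
    rw [← sub_eq_zero, ← sub_smul] at h4
    rw [key]
    rcases smul_eq_zero.1 h4 with h5 | h5
    · have : m a b * 2 = 0 := by linear_combination -h5
      rw [(mul_eq_zero.1 this).resolve_right h2, zero_smul]
    · rw [h5, smul_zero]
  have tr_diag : (single b b (1 : F) - single a a 1).trace = 0 := by
    rw [← hlie_diag]; exact trace_lie _ _
  have hBh : B (single a b 1) (single b b 1 - single a a 1) = 0 := by
    have h4 := hB _ _ _ (tr b a hab.symm) (tr _ _ hab) (tr _ _ hab)
    rw [hBaa, hlie_diag, hsymm _ _ tr_diag (tr _ _ hab), map_zero, ← two_smul F] at h4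
    exact (smul_eq_zero.1 h4.symm).resolve_left h2
  obtain ⟨m, hm⟩ := Submodule.mkQ_surjective _ (B (single a b 1) (single b a 1))
  have off : ∀ k l, k ≠ l → m k l = 0 := by
    intro k l hkl
    obtain ⟨t, htk, htl⟩ := Fin.exists_ne_and_ne hn k l
    have h4 := hB _ _ _ (trace_diagonal_single_sub k t) (tr _ _ hab) (tr _ _ hab.symm)
    rw [lie_diagonal_single, lie_diagonal_single, ← hm, adPGL_toPGL] at h4
    simp only [map_smul, LinearMap.smul_apply, ← add_smul] at h4
    rw [sub_add_sub_cancel, sub_self, zero_smul, toPGL_eq_zero_iff_entries hn] at h4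
    have h5 := h4.1 k l hkl
    rw [lie_diagonal_apply] at h5
    simpa [Pi.single_eq_of_ne hkl.symm, Pi.single_eq_of_ne htk.symm,
      Pi.single_eq_of_ne htl.symm] using h5
  have diag_ab : m b b = m a a := by
    have h4 := hB _ _ _ (tr a b hab) (tr _ _ hab) (tr _ _ hab.symm)
    rw [lie_single_single a b b a, ← hm, adPGL_toPGL] at h4
    have h5 : ⁅single a b (1 : F), single a b (1 : F)⁆ = 0 := by simp [Ring.lie_def]
    rw [h5] at h4
    simp only [if_true, map_zero, LinearMap.zero_apply, zero_add] at h4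
    rw [← neg_sub, map_neg, hBh, neg_zero] at h4
    simpa using lie_single_eq_of_toPGL_eq_zero hn h4 a b
  have diag : ∀ i j, i ≠ a → i ≠ b → j ≠ a → j ≠ b → m j j = m i i := by
    intro i j hia hib hja hjb
    by_cases hij : i = j
    · rw [hij]
    have h4 := hB _ _ _ (tr i j hij) (tr _ _ hab) (tr _ _ hab.symm)
    rw [lie_single_single, lie_single_single, ← hm, adPGL_toPGL] at h4
    simp only [hja, hjb, hia.symm, hib.symm, if_false, sub_zero, map_zero, add_zero,
      LinearMap.zero_apply] at h4
    simpa using lie_single_eq_of_toPGL_eq_zero hn h4 i j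
  obtain ⟨t, hta, htb⟩ := Fin.exists_ne_and_ne hn a b
  refine ⟨m a a - m t t, ?_⟩
  rw [← hm, ← sub_eq_zero, ← map_smul, ← map_sub, toPGL_eq_zero_iff_entries hn]
  refine ⟨fun k l hkl => ?_, ?_⟩
  · have h1 : ¬ (a = k ∧ a = l) := fun h => hkl (h.1.symm.trans h.2)
    have h3 : ¬ (b = k ∧ b = l) := fun h => hkl (h.1.symm.trans h.2)
    simp [off k l hkl, h1, h3]
  · have : ∀ k, (m - (m a a - m t t) • (single a a (1 : F) + single b b 1) :
        Matrix (Fin n) (Fin n) F) k k = m t t := by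
      intro k
      by_cases hka : k = a
      · subst hka; simp [hab.symm]
      by_cases hkb : k = b
      · subst hkb; simp [hab, diag_ab]
      simp [Ne.symm hka, Ne.symm hkb, diag t k hta htb hka hkb]
    intro k l
    rw [this, this]

/-- A symmetric `sl_n`-equivariant bilinear map from `sl_n` to `gl_n` modulo scalars is a
multiple of the anticommutator. -/
lemma exists_eq_smul_matCirc_of_equivariant (hn : 3 ≤ n) (h2 : (2 : F) ≠ 0)
    (B : Matrix (Fin n) (Fin n) F →ₗ[F] Matrix (Fin n) (Fin n) F →ₗ[F] PGL F n)
    (hB : ∀ y x z : Matrix (Fin n) (Fin n) F, y.trace = 0 → x.trace = 0 → z.trace = 0 →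
      adPGL F n y (B x z) = B ⁅y, x⁆ z + B x ⁅y, z⁆)
    (hsymm : ∀ x z : Matrix (Fin n) (Fin n) F, x.trace = 0 → z.trace = 0 → B x z = B z x) :
    ∃ c : F, ∀ x z : Matrix (Fin n) (Fin n) F, x.trace = 0 → z.trace = 0 →
      B x z = c • toPGL F n (matCirc F n x z) := by
  let a : Fin n := ⟨0, by omega⟩
  let b : Fin n := ⟨1, by omega⟩
  have hab : a ≠ b := by simp [a, b]
  obtain ⟨c, hc⟩ := exists_eq_smul_on_opposite_singles hn h2 B hB hsymm hab
  refine ⟨c, ?_⟩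
  have tr := fun i j (h : i ≠ j) => trace_single_eq_of_ne (n := Fin n) i j (1 : F) h
  let C : Matrix (Fin n) (Fin n) F →ₗ[F] Matrix (Fin n) (Fin n) F →ₗ[F] PGL F n :=
    B - c • (matCirc F n).compr₂ (toPGL F n)
  have hCapp : ∀ x z, C x z = B x z - c • toPGL F n (matCirc F n x z) := fun _ _ => rfl
  have hC : ∀ y x z : Matrix (Fin n) (Fin n) F, y.trace = 0 → x.trace = 0 → z.trace = 0 →
      adPGL F n y (C x z) = C ⁅y, x⁆ z + C x ⁅y, z⁆ := by
    intro y x z hy hx hz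
    simp only [hCapp, map_sub, map_smul, adPGL_toPGL, lie_matCirc, hB y x z hy hx hz, map_add,
      smul_add]
    abel
  have hab0 : ∀ z : Matrix (Fin n) (Fin n) F, z.trace = 0 → C (single a b 1) z = 0 := by
    intro z hz
    refine mem_of_trace_eq_zero_of_centralizer_closed hn (K := LinearMap.ker (C (single a b 1)))
      hab ?_ ?_ hz
    · intro i j hij hib hja x hx hx0
      rw [LinearMap.mem_ker] at hx ⊢
      have := hC _ _ _ (tr i j hij) (tr _ _ hab) hx0
      rw [hx, lie_single_single] at this
      simpa [hja, hib.symm] using this.symm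
    · rw [LinearMap.mem_ker, hCapp, hc, matCirc_apply, single_mul_single_same,
        single_mul_single_same, mul_one, sub_self]
  intro x z hx hz
  rw [← sub_eq_zero, ← hCapp]
  have : x ∈ LinearMap.ker ((C.domRestrict₂ (slM F n))) := by
    refine mem_of_trace_eq_zero_of_lie_closed hn ?_ hab ?_ hx
    · intro i j hij x hx hx0
      rw [LinearMap.mem_ker] at hx ⊢
      ext ⟨z, hz⟩
      have e : ∀ z : Matrix (Fin n) (Fin n) F, z.trace = 0 → C x z = 0 :=
        fun z hz => LinearMap.congr_fun hx ⟨z, hz⟩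
      have := hC _ _ _ (tr i j hij) hx0 hz
      rw [e _ hz, e _ (trace_lie _ _), map_zero, add_zero] at this
      exact this.symm
    · rw [LinearMap.mem_ker]
      ext ⟨z, hz⟩
      exact hab0 z hz
  exact LinearMap.congr_fun this ⟨z, hz⟩

end InvariantMaps

section Derivations

variable {F : Type*} [Field F] {n : ℕ}

lemma exists_diagonal_separating (hn : 3 ≤ n) (h2 : (2 : F) ≠ 0) (h3 : n = 3 → (3 : F) ≠ 0)
    {i j k l : Fin n} (hij : i ≠ j) (hkl : k ≠ l) (h : ¬ (i = k ∧ j = l)) :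
    ∃ v : Fin n → F, ∑ p, v p = 0 ∧ v i - v j ≠ v k - v l := by
  by_contra! H
  have H' : ∀ p q, ((if i = p then (1 : F) else 0) - (if j = p then 1 else 0)
      - (if k = p then 1 else 0) + (if l = p then 1 else 0)) =
      (if i = q then (1 : F) else 0) - (if j = q then 1 else 0)
      - (if k = q then 1 else 0) + (if l = q then 1 else 0) := by
    intro p q
    have := H (Pi.single p 1 - Pi.single q 1) (by simp)
    simp only [Pi.sub_apply, Pi.single_apply] at this
    linear_combination this
  by_cases hik : i = k
  · subst hik
    have hjl : j ≠ l := fun e => h ⟨rfl, e⟩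
    have := H' i l
    simp [hij.symm, hkl, hkl.symm, hjl] at this
  by_cases hjl : j = l
  · subst hjl
    have := H' j i
    simp [hij, hij.symm, hkl, Ne.symm hik] at this
  by_cases hil : i = l
  · subst hil
    by_cases hjk : j = k
    · subst hjk
      obtain ⟨t, ht1, ht2⟩ := Fin.exists_ne_and_ne hn i j
      have := H' i t
      simp only [hij.symm, ht1.symm, ht2.symm, if_true, if_false] at this
      exact h2 (by linear_combination this)
    · by_cases ht : ∃ t, t ≠ i ∧ t ≠ j ∧ t ≠ k
      · obtain ⟨t, hti, htj, htk⟩ := ht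
        have := H' j t
        simp [hij, Ne.symm hjk, hti.symm, htj.symm, htk.symm] at this
      · push Not at ht
        have hcard : n = 3 := by
          refine le_antisymm ?_ hn
          have : (Finset.univ : Finset (Fin n)) ⊆ {i, j, k} := by
            intro t _
            have := ht t
            simp only [Finset.mem_insert, Finset.mem_singleton]
            tauto
          simpa using (Finset.card_le_card this).trans Finset.card_le_three
        have := H' i j
        simp only [hij, hij.symm, hkl, Ne.symm hjk, if_true, if_false] at this
        exact h3 hcard (by linear_combination this)
  by_cases hjk : j = k
  · subst hjk
    by_cases ht : ∃ t, t ≠ i ∧ t ≠ j ∧ t ≠ l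
    · obtain ⟨t, hti, htj, htl⟩ := ht
      have := H' i t
      simp [hij.symm, Ne.symm hil, hti.symm, htj.symm, htl.symm] at this
    · push Not at ht
      have hcard : n = 3 := by
        refine le_antisymm ?_ hn
        have : (Finset.univ : Finset (Fin n)) ⊆ {i, j, l} := by
          intro t _
          have := ht t
          simp only [Finset.mem_insert, Finset.mem_singleton]
          tauto
        simpa using (Finset.card_le_card this).trans Finset.card_le_three
      have := H' i j
      simp only [hij, hij.symm, Ne.symm hjl, Ne.symm hil, if_true, if_false] at this
      exact h3 hcard (by linear_combination this)
  · have := H' i j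
    simp only [hij, hij.symm, Ne.symm hik, Ne.symm hil, Ne.symm hjk, Ne.symm hjl,
      if_true, if_false] at this
    exact h2 (by linear_combination this)

lemma Matrix.lie_diagonal_diagonal (v w : Fin n → F) : ⁅diagonal v, diagonal w⁆ = 0 := by
  rw [Ring.lie_def, diagonal_mul_diagonal, diagonal_mul_diagonal, sub_eq_zero]
  congr 1; ext; ring

lemma Matrix.neg_lie_swap (x y : Matrix (Fin n) (Fin n) F) : -⁅y, x⁆ = ⁅x, y⁆ := by
  simp only [Ring.lie_def, neg_sub]

/-- A derivation from `sl_n` to `gl_n` modulo scalars is inner, up to changing it by a map which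
vanishes off the diagonal on diagonal matrices. -/
lemma exists_sub_lie_diagonal_off_diagonal (hn : 3 ≤ n)
    (D : Matrix (Fin n) (Fin n) F →ₗ[F] Matrix (Fin n) (Fin n) F)
    (hD : ∀ x y : Matrix (Fin n) (Fin n) F, x.trace = 0 → y.trace = 0 →
      toPGL F n (D ⁅x, y⁆) = toPGL F n (⁅D x, y⁆ + ⁅x, D y⁆)) :
    ∃ m : Matrix (Fin n) (Fin n) F, ∀ v : Fin n → F, ∑ p, v p = 0 →
      ∀ k l, k ≠ l → (D (diagonal v)) k l = ⁅m, diagonal v⁆ k l := by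
  choose t ht using Fin.exists_ne_and_ne hn
  refine ⟨Matrix.of fun k l => -(D (diagonal (Pi.single k 1 - Pi.single (t k l) 1))) k l, ?_⟩
  intro v hv k l hkl
  set w : Fin n → F := Pi.single k 1 - Pi.single (t k l) 1 with hw
  have hwk : w k = 1 := by simp [hw, Pi.single_eq_of_ne (ht k l).1.symm]
  have hwl : w l = 0 := by
    simp [hw, Pi.single_eq_of_ne hkl.symm, Pi.single_eq_of_ne (ht k l).2.symm]
  have h := hD (diagonal v) (diagonal w) (by simpa [trace_diagonal] using hv)
    (by simp [trace_diagonal, hw])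
  rw [lie_diagonal_diagonal, map_zero, map_zero, eq_comm, toPGL_eq_zero_iff_entries hn] at h
  have h := h.1 k l hkl
  rw [← neg_lie_swap (D _)] at h
  rw [← neg_lie_swap]
  simp only [Matrix.add_apply, Matrix.neg_apply, lie_diagonal_apply, of_apply, hwk, hwl,
    ← hw] at h ⊢
  linear_combination -h

/-- A derivation from `sl_n` to `gl_n` modulo scalars which vanishes off the diagonal on diagonal
matrices maps diagonal matrices to scalars and rescales the other matrix units. -/
lemma exists_eq_smul_single_of_derivation (hn : 3 ≤ n) (h2 : (2 : F) ≠ 0)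
    (h3 : n = 3 → (3 : F) ≠ 0)
    (D : Matrix (Fin n) (Fin n) F →ₗ[F] Matrix (Fin n) (Fin n) F)
    (hD : ∀ x y : Matrix (Fin n) (Fin n) F, x.trace = 0 → y.trace = 0 →
      toPGL F n (D ⁅x, y⁆) = toPGL F n (⁅D x, y⁆ + ⁅x, D y⁆))
    (hoff : ∀ v : Fin n → F, ∑ p, v p = 0 → ∀ k l, k ≠ l → (D (diagonal v)) k l = 0) :
    (∀ v : Fin n → F, ∑ p, v p = 0 → toPGL F n (D (diagonal v)) = 0) ∧
      ∀ i j : Fin n, i ≠ j → ∃ c : F,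
        toPGL F n (D (single i j 1)) = c • toPGL F n (single i j 1) := by
  have key : ∀ v : Fin n → F, ∑ p, v p = 0 → ∀ i j : Fin n, i ≠ j →
      (∀ k l, k ≠ l → (v i - v j) * D (single i j 1) k l =
        (D (diagonal v) i i - D (diagonal v) j j) * single i j (1 : F) k l +
          (v k - v l) * D (single i j 1) k l) ∧
      ∀ k l, (v i - v j) * D (single i j 1) k k = (v i - v j) * D (single i j 1) l l := by
    intro v hv i j hij
    have hd : D (diagonal v) = diagonal fun p => D (diagonal v) p p := by
      ext k l
      by_cases h : k = l
      · subst h; simp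
      · simp [h, hoff v hv k l h]
    have h := hD (diagonal v) (single i j 1) (by simpa [trace_diagonal] using hv)
      (trace_single_eq_of_ne _ _ _ hij)
    rw [lie_diagonal_single, ← sub_eq_zero, ← map_sub, toPGL_eq_zero_iff_entries hn, hd] at h
    simp only [Matrix.sub_apply, Matrix.add_apply, lie_diagonal_apply, map_smul,
      Matrix.smul_apply, smul_eq_mul] at h
    refine ⟨fun k l hkl => ?_, fun k l => ?_⟩
    · have := h.1 k l hkl
      by_cases hs : i = k ∧ j = l
      · obtain ⟨rfl, rfl⟩ := hs
        linear_combination this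
      · rw [single_apply_of_ne _ _ _ _ _ hs] at this ⊢
        linear_combination this
    · have := h.2 k l
      linear_combination this
  refine ⟨fun v hv => (toPGL_eq_zero_iff_entries hn).2 ⟨hoff v hv, fun i j => ?_⟩,
    fun i j hij => ⟨D (single i j 1) i j, ?_⟩⟩
  · by_cases hij : i = j
    · rw [hij]
    · have := (key v hv i j hij).1 i j hij
      rw [single_apply_same] at this
      linear_combination -this
  · rw [← sub_eq_zero, ← map_smul, ← map_sub, toPGL_eq_zero_iff_entries hn]
    simp only [Matrix.sub_apply, Matrix.smul_apply, smul_eq_mul]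
    refine ⟨fun k l hkl => ?_, fun k l => ?_⟩
    · by_cases hs : i = k ∧ j = l
      · obtain ⟨rfl, rfl⟩ := hs
        simp
      · obtain ⟨v, hv, hne⟩ := exists_diagonal_separating hn h2 h3 hij hkl hs
        have := (key v hv i j hij).1 k l hkl
        rw [single_apply_of_ne _ _ _ _ _ hs] at this ⊢
        have h0 : (v i - v j - (v k - v l)) * D (single i j 1) k l = 0 := by
          linear_combination this
        simpa using (mul_eq_zero.1 h0).resolve_left (sub_ne_zero.2 hne)
    · obtain ⟨t, hti, htj⟩ := Fin.exists_ne_and_ne hn i j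
      have := (key (Pi.single i 1 - Pi.single t 1) (by simp) i j hij).2 k l
      have hs : ∀ p, single i j (1 : F) p p = 0 := fun p =>
        single_apply_of_ne _ _ _ _ _ fun h => hij (h.1.trans h.2.symm)
      rw [hs, hs]
      simpa [Pi.single_eq_of_ne hij.symm, Pi.single_eq_of_ne hti.symm,
        Pi.single_eq_of_ne htj.symm] using this

/-- Every derivation from `sl_n` to `gl_n` modulo scalars is inner. -/
theorem exists_eq_toPGL_lie_of_derivation (hn : 3 ≤ n) (h2 : (2 : F) ≠ 0)
    (h3 : n = 3 → (3 : F) ≠ 0)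
    (D : Matrix (Fin n) (Fin n) F →ₗ[F] Matrix (Fin n) (Fin n) F)
    (hD : ∀ x y : Matrix (Fin n) (Fin n) F, x.trace = 0 → y.trace = 0 →
      toPGL F n (D ⁅x, y⁆) = toPGL F n (⁅D x, y⁆ + ⁅x, D y⁆)) :
    ∃ m : Matrix (Fin n) (Fin n) F, ∀ x : Matrix (Fin n) (Fin n) F, x.trace = 0 →
      toPGL F n (D x) = toPGL F n ⁅m, x⁆ := by
  obtain ⟨m, hm⟩ := exists_sub_lie_diagonal_off_diagonal hn D hD
  set D' := D - matBracket F n m with hD'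
  have hder : ∀ x y : Matrix (Fin n) (Fin n) F, x.trace = 0 → y.trace = 0 →
      toPGL F n (D' ⁅x, y⁆) = toPGL F n (⁅D' x, y⁆ + ⁅x, D' y⁆) := by
    intro x y hx hy
    have : ⁅D' x, y⁆ + ⁅x, D' y⁆ = (⁅D x, y⁆ + ⁅x, D y⁆) - ⁅m, ⁅x, y⁆⁆ := by
      simp only [hD', LinearMap.sub_apply, matBracket_apply, Ring.lie_def]
      noncomm_ring
    rw [this, map_sub, ← hD x y hx hy, ← map_sub]
    rfl
  obtain ⟨hdiag, hunit⟩ := exists_eq_smul_single_of_derivation hn h2 h3 D' hder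
    (fun v hv k l hkl => by
      simp only [hD', LinearMap.sub_apply, matBracket_apply, Matrix.sub_apply, hm v hv k l hkl,
        sub_self])
  choose! c hc using hunit
  have hinj : ∀ i j : Fin n, i ≠ j → ∀ s t : F,
      s • toPGL F n (single i j 1) = t • toPGL F n (single i j 1) → s = t := by
    intro i j hij s t h
    rw [← sub_eq_zero, ← map_smul, ← map_smul, ← map_sub, toPGL_eq_zero_iff_entries hn] at h
    have := h.1 i j hij
    simpa [sub_eq_zero] using this
  have htriple : ∀ i j k : Fin n, i ≠ j → j ≠ k → i ≠ k → c i k = c i j + c j k := by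
    intro i j k hij hjk hik
    have h := hder (single i j 1) (single j k 1) (trace_single_eq_of_ne _ _ _ hij)
      (trace_single_eq_of_ne _ _ _ hjk)
    have hE : ⁅single i j (1 : F), single j k (1 : F)⁆ = single i k 1 := by
      rw [lie_single_single, if_pos rfl, if_neg hik.symm, sub_zero]
    rw [hE, map_add, ← neg_lie_swap, map_neg, ← adPGL_toPGL, ← adPGL_toPGL, hc i j hij,
      hc j k hjk, map_smul, map_smul, adPGL_toPGL, adPGL_toPGL, ← neg_lie_swap (single j k 1), hE,
      hc i k hik, map_neg, smul_neg, neg_neg, ← add_smul] at h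
    exact hinj i k hik _ _ h
  have hanti : ∀ i j : Fin n, i ≠ j → c i j + c j i = 0 := by
    intro i j hij
    obtain ⟨k, hki, hkj⟩ := Fin.exists_ne_and_ne hn i j
    have h1 := htriple i j k hij hkj.symm hki.symm
    have h2 := htriple j i k hij.symm hki.symm hkj.symm
    linear_combination -h1 - h2
  let i₀ : Fin n := ⟨0, by omega⟩
  let t : Fin n → F := fun i => if i = i₀ then 0 else c i i₀
  have ht : ∀ i j, i ≠ j → c i j = t i - t j := by
    intro i j hij
    by_cases hi : i = i₀
    · have hj : j ≠ i₀ := fun h => hij (hi.trans h.symm)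
      simp only [t, if_pos hi, if_neg hj]
      rw [hi]
      linear_combination hanti j i₀ hj
    · by_cases hj : j = i₀
      · simp only [t, if_neg hi, if_pos hj, sub_zero]
        rw [hj]
      · simp only [t, if_neg hi, if_neg hj]
        linear_combination -(htriple i j i₀ hij hj hi)
  refine ⟨m + diagonal t, fun x hx => ?_⟩
  let K : Submodule F (Matrix (Fin n) (Fin n) F) :=
    LinearMap.ker (toPGL F n ∘ₗ (D' - matBracket F n (diagonal t)))
  have hK : x ∈ K := by
    refine mem_of_trace_eq_zero hn (fun i j hij => ?_) (fun i j => ?_) hx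
    · simp only [K, LinearMap.mem_ker, LinearMap.comp_apply, LinearMap.sub_apply, map_sub,
        matBracket_apply, hc i j hij, lie_diagonal_single, map_smul, ht i j hij, sub_self]
    · have : single i i (1 : F) - single j j 1 =
          diagonal (Pi.single i 1 - Pi.single j 1 : Fin n → F) := by
        rw [← diagonal_single, ← diagonal_single, diagonal_sub]; rfl
      rw [this]
      simp only [K, LinearMap.mem_ker, LinearMap.comp_apply, LinearMap.sub_apply,
        matBracket_apply]
      rw [map_sub, lie_diagonal_diagonal, hdiag _ (by simp), map_zero, sub_zero]
  have h := LinearMap.mem_ker.1 hK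
  rw [LinearMap.comp_apply, hD'] at h
  rw [← sub_eq_zero, ← map_sub, ← h]
  congr 1
  simp only [LinearMap.sub_apply, matBracket_apply, Ring.lie_def]
  noncomm_ring

end Derivations

/-- A `G`-grading with finite support on a vector space, given by its projections. -/
structure VectorGrading (F G V : Type*) [Field F] [AddCommGroup V] [Module F V] where
  /-- The projections onto the homogeneous components. -/
  proj : G → V →ₗ[F] V
  /-- A finite set containing the support. -/
  supp : Finset G
  proj_same : ∀ g x, proj g (proj g x) = proj g x
  proj_ne : ∀ g h x, g ≠ h → proj g (proj h x) = 0
  sum_proj : ∀ x, ∑ g ∈ supp, proj g x = x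

namespace VectorGrading

variable {F G U V W : Type*} [Field F]
  [AddCommGroup U] [Module F U] [AddCommGroup V] [Module F V] [AddCommGroup W] [Module F W]

section Basic

variable (P : VectorGrading F G V)

/-- The homogeneous component of degree `g`. -/
def comp (g : G) : Submodule F V := LinearMap.eqLocus (P.proj g) LinearMap.id

lemma mem_comp {g : G} {x : V} : x ∈ P.comp g ↔ P.proj g x = x := Iff.rfl

lemma proj_mem (g : G) (x : V) : P.proj g x ∈ P.comp g := P.proj_same g x

lemma proj_eq_zero_of_mem {g h : G} {x : V} (hx : x ∈ P.comp h) (hgh : g ≠ h) :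
    P.proj g x = 0 := by
  rw [← P.mem_comp.1 hx, P.proj_ne g h x hgh]

lemma proj_of_notMem_supp {g : G} (hg : g ∉ P.supp) (x : V) : P.proj g x = 0 := by
  conv_lhs => rw [← P.sum_proj x, map_sum]
  exact Finset.sum_eq_zero fun h hh => P.proj_ne g h x fun e => hg (e ▸ hh)

lemma eq_zero_of_notMem_supp {g : G} (hg : g ∉ P.supp) {x : V} (hx : x ∈ P.comp g) : x = 0 := by
  rw [← P.mem_comp.1 hx, P.proj_of_notMem_supp hg]

lemma sum_proj_of_subset {S : Finset G} (hS : P.supp ⊆ S) (x : V) : ∑ g ∈ S, P.proj g x = x := by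
  rw [← Finset.sum_subset hS fun g _ hg => P.proj_of_notMem_supp hg x, P.sum_proj]

lemma mem_of_comp_le {K : Submodule F V} (h : ∀ g, P.comp g ≤ K) (x : V) : x ∈ K := by
  rw [← P.sum_proj x]
  exact K.sum_mem fun g _ => h g (P.proj_mem g x)

lemma linearMap_ext {f f' : V →ₗ[F] W} (h : ∀ g, ∀ x ∈ P.comp g, f x = f' x) : f = f' :=
  LinearMap.ext fun x => P.mem_of_comp_le (K := LinearMap.eqLocus f f') h x

lemma eq_of_proj_eq {x y : V} (h : ∀ g, P.proj g x = P.proj g y) : x = y := by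
  rw [← P.sum_proj x, ← P.sum_proj y]
  exact Finset.sum_congr rfl fun g _ => h g

lemma exists_proj_ne_zero {x : V} (hx : x ≠ 0) : ∃ g, P.proj g x ≠ 0 := by
  by_contra! h
  exact hx (P.eq_of_proj_eq fun g => by rw [h, map_zero])

lemma exists_mem_comp_of_proj_eq_smul {x : V} (hx : x ≠ 0)
    (h : ∀ g, ∃ c : F, P.proj g x = c • x) : ∃ g, x ∈ P.comp g := by
  obtain ⟨g, hg⟩ := P.exists_proj_ne_zero hx
  obtain ⟨c, hc⟩ := h g
  have hc0 : c ≠ 0 := by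
    rintro rfl
    exact hg (by rw [hc, zero_smul])
  exact ⟨g, ((P.comp g).smul_mem_iff hc0).1 (hc ▸ P.proj_mem g x)⟩

end Basic

lemma isInternal_comp [DecidableEq G] (P : VectorGrading F G V) : DirectSum.IsInternal P.comp := by
  rw [DirectSum.isInternal_submodule_iff_iSupIndep_and_iSup_eq_top]
  refine ⟨fun g => ?_, eq_top_iff.2 fun x _ => P.mem_of_comp_le (fun g => le_iSup P.comp g) x⟩
  rw [Submodule.disjoint_def]
  intro x hx hx'
  have hle : ⨆ (h) (_ : h ≠ g), P.comp h ≤ LinearMap.ker (P.proj g) :=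
    iSup₂_le fun h hh y hy => P.proj_eq_zero_of_mem hy hh.symm
  rw [← P.mem_comp.1 hx, LinearMap.mem_ker.1 (hle hx')]

/-- The grading given by an internal direct sum decomposition. -/
theorem exists_comp_eq_of_isInternal [DecidableEq G] [Module.Finite F V] {ℒ : G → Submodule F V}
    (h : DirectSum.IsInternal ℒ) : ∃ P : VectorGrading F G V, ∀ g, P.comp g = ℒ g := by
  classical
  let := h.chooseDecomposition
  have hfin : {g | ℒ g ≠ ⊥}.Finite :=
    WellFoundedGT.finite_ne_bot_of_iSupIndep h.submodule_iSupIndep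
  let p : G → V →ₗ[F] V := fun g =>
    (ℒ g).subtype ∘ₗ DirectSum.component F G (fun g => ℒ g) g ∘ₗ
      (DirectSum.decomposeLinearEquiv ℒ).toLinearMap
  have hp : ∀ g x, p g x = DirectSum.decompose ℒ x g := fun g x => rfl
  have hmem : ∀ g x, p g x ∈ ℒ g := fun g x => (DirectSum.decompose ℒ x g).2
  refine ⟨⟨p, hfin.toFinset, fun g x => ?_, fun g k x hgk => ?_, fun x => ?_⟩, fun g => ?_⟩
  · rw [hp g (p g x), DirectSum.decompose_of_mem_same ℒ (hmem g x)]
  · rw [hp g (p k x), DirectSum.decompose_of_mem_ne ℒ (hmem k x) hgk.symm]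
  · conv_rhs => rw [← DirectSum.sum_support_decompose ℒ x]
    refine (Finset.sum_subset (fun g hg => ?_) fun g _ hg => ?_).symm
    · rw [Set.Finite.mem_toFinset]
      intro hbot
      rw [DFinsupp.mem_support_iff] at hg
      exact hg (Subtype.ext ((Submodule.mem_bot F).1 (hbot ▸ hmem g x)))
    · rw [DFinsupp.notMem_support_iff] at hg
      rw [hp, hg]; rfl
  · ext x
    exact ⟨fun hx => by rw [← (mem_comp _).1 hx]; exact hmem g x,
      fun hx => (mem_comp _).2 (DirectSum.decompose_of_mem_same ℒ hx)⟩

/-- The grading induced along an injective linear map with graded range. -/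
noncomputable def pullback (Q : VectorGrading F G V) (e : W →ₗ[F] V) (he : Function.Injective e)
    (h : ∀ g x, Q.proj g (e x) ∈ LinearMap.range e) : VectorGrading F G W where
  proj g := (LinearEquiv.ofInjective e he).symm.toLinearMap ∘ₗ
    (Q.proj g ∘ₗ e).codRestrict (LinearMap.range e) (h g)
  supp := Q.supp
  proj_same g x := by
    apply (LinearEquiv.ofInjective e he).injective
    ext
    simp only [LinearMap.comp_apply, LinearEquiv.coe_coe, LinearEquiv.apply_symm_apply,
      LinearMap.codRestrict_apply]
    rw [← LinearEquiv.ofInjective_apply e (h := he), LinearEquiv.apply_symm_apply]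
    exact Q.proj_same g (e x)
  proj_ne g k x hgk := by
    apply (LinearEquiv.ofInjective e he).injective
    ext
    simp only [LinearMap.comp_apply, LinearEquiv.coe_coe, LinearEquiv.apply_symm_apply,
      LinearMap.codRestrict_apply, map_zero]
    rw [← LinearEquiv.ofInjective_apply e (h := he), LinearEquiv.apply_symm_apply]
    exact Q.proj_ne g k (e x) hgk
  sum_proj x := by
    apply (LinearEquiv.ofInjective e he).injective
    ext
    simp only [map_sum, LinearMap.comp_apply, LinearEquiv.coe_coe, LinearEquiv.apply_symm_apply]
    rw [AddSubmonoidClass.coe_finsetSum]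
    exact Q.sum_proj (e x)

lemma apply_pullback_proj (Q : VectorGrading F G V) (e : W →ₗ[F] V) (he : Function.Injective e)
    (h : ∀ g x, Q.proj g (e x) ∈ LinearMap.range e) (g : G) (x : W) :
    e ((Q.pullback e he h).proj g x) = Q.proj g (e x) := by
  change e ((LinearEquiv.ofInjective e he).symm _) = _
  rw [← LinearEquiv.ofInjective_apply e (h := he), LinearEquiv.apply_symm_apply]
  rfl

lemma mem_pullback_comp {Q : VectorGrading F G V} {e : W →ₗ[F] V} {he : Function.Injective e}
    {h : ∀ g x, Q.proj g (e x) ∈ LinearMap.range e} {g : G} {x : W} :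
    x ∈ (Q.pullback e he h).comp g ↔ e x ∈ Q.comp g := by
  rw [mem_comp, mem_comp, ← apply_pullback_proj Q e he h]
  exact he.eq_iff.symm

variable [CommGroup G] [DecidableEq G]

/-- The grading concentrated in degree `1`. -/
def trivial (F G V : Type*) [Field F] [CommGroup G] [DecidableEq G] [AddCommGroup V] [Module F V] :
    VectorGrading F G V where
  proj g := if g = 1 then LinearMap.id else 0
  supp := {1}
  proj_same g x := by split_ifs <;> rfl
  proj_ne g h x hgh := by
    split_ifs with h1 h2
    · exact absurd (h1.trans h2.symm) hgh
    all_goals simp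
  sum_proj x := by simp

/-- The grading with the degrees translated by `b`. -/
def shift (P : VectorGrading F G V) (b : G) : VectorGrading F G V where
  proj g := P.proj (g * b)
  supp := P.supp.image (· * b⁻¹)
  proj_same g x := P.proj_same _ x
  proj_ne g h x hgh := P.proj_ne _ _ x fun e => hgh (mul_right_cancel e)
  sum_proj x := by
    rw [Finset.sum_image fun _ _ _ _ e => mul_right_cancel e]
    simpa using P.sum_proj x

lemma mem_shift_comp {P : VectorGrading F G V} {b g : G} {x : V} :
    x ∈ (P.shift b).comp g ↔ x ∈ P.comp (g * b) := Iff.rfl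

section Hom

variable (P : VectorGrading F G U) (Q : VectorGrading F G V)

lemma sum_proj_comp_apply (a : G) (f : U →ₗ[F] V) {g : G} {x : U} (hx : x ∈ P.comp g) :
    (∑ h ∈ P.supp, Q.proj (a * h) ∘ₗ f ∘ₗ P.proj h) x = Q.proj (a * g) (f x) := by
  rw [LinearMap.sum_apply]
  by_cases hg : g ∈ P.supp
  · rw [Finset.sum_eq_single_of_mem g hg fun h _ hh => ?_]
    · rw [LinearMap.comp_apply, LinearMap.comp_apply, P.mem_comp.1 hx]
    · rw [LinearMap.comp_apply, LinearMap.comp_apply, P.proj_eq_zero_of_mem hx hh, map_zero,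
        map_zero]
  · rw [P.eq_zero_of_notMem_supp hg hx]
    simp

/-- The induced grading on linear maps between graded vector spaces. -/
def hom : VectorGrading F G (U →ₗ[F] V) where
  proj a :=
    { toFun := fun f => ∑ h ∈ P.supp, Q.proj (a * h) ∘ₗ f ∘ₗ P.proj h
      map_add' := fun f f' => P.linearMap_ext fun g x hx => by
        rw [LinearMap.add_apply]
        simp only [sum_proj_comp_apply P Q a _ hx, LinearMap.add_apply, map_add]
      map_smul' := fun c f => P.linearMap_ext fun g x hx => by
        rw [RingHom.id_apply, LinearMap.smul_apply]
        simp only [sum_proj_comp_apply P Q a _ hx, LinearMap.smul_apply, map_smul] }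
  supp := (Q.supp ×ˢ P.supp).image fun p => p.1 * p.2⁻¹
  proj_same a f := P.linearMap_ext fun g x hx => by
    simp only [LinearMap.coe_mk, AddHom.coe_mk, sum_proj_comp_apply P Q a _ hx, Q.proj_same]
  proj_ne a b f hab := P.linearMap_ext fun g x hx => by
    simp only [LinearMap.coe_mk, AddHom.coe_mk, sum_proj_comp_apply P Q _ _ hx]
    exact Q.proj_ne _ _ _ fun e => hab (mul_right_cancel e)
  sum_proj f := P.linearMap_ext fun g x hx => by
    by_cases hg : g ∈ P.supp
    · simp only [LinearMap.coe_mk, AddHom.coe_mk]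
      rw [LinearMap.sum_apply]
      simp only [sum_proj_comp_apply P Q _ _ hx]
      rw [← Finset.sum_image (f := fun b => Q.proj b (f x)) (g := (· * g))
        fun _ _ _ _ e => mul_right_cancel e]
      refine Q.sum_proj_of_subset (fun k hk => ?_) _
      rw [Finset.mem_image]
      refine ⟨k * g⁻¹, Finset.mem_image.2 ⟨(k, g), Finset.mk_mem_product hk hg, rfl⟩, by simp⟩
    · rw [P.eq_zero_of_notMem_supp hg hx, map_zero, map_zero]

variable {P Q}

lemma hom_proj_apply (a : G) (f : U →ₗ[F] V) {g : G} {x : U} (hx : x ∈ P.comp g) :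
    (P.hom Q).proj a f x = Q.proj (a * g) (f x) :=
  sum_proj_comp_apply P Q a f hx

lemma mem_hom_comp {a : G} {f : U →ₗ[F] V} :
    f ∈ (P.hom Q).comp a ↔ ∀ g, ∀ x ∈ P.comp g, f x ∈ Q.comp (a * g) := by
  refine ⟨fun hf g x hx => ?_, fun h => P.linearMap_ext fun g x hx => ?_⟩
  · rw [Q.mem_comp, ← hom_proj_apply a f hx, (mem_comp _).1 hf]
  · rw [hom_proj_apply a f hx]
    exact h g x hx

lemma proj_apply_of_mem_hom_comp {a : G} {f : U →ₗ[F] V} (hf : f ∈ (P.hom Q).comp a) (g : G)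
    (x : U) : Q.proj (a * g) (f x) = f (P.proj g x) := by
  have : Q.proj (a * g) ∘ₗ f = f ∘ₗ P.proj g := P.linearMap_ext fun h y hy => by
    rw [LinearMap.comp_apply, LinearMap.comp_apply]
    by_cases hgh : g = h
    · subst hgh
      rw [P.mem_comp.1 hy, Q.mem_comp.1 (mem_hom_comp.1 hf g y hy)]
    · rw [P.proj_eq_zero_of_mem hy hgh, map_zero]
      exact Q.proj_eq_zero_of_mem (mem_hom_comp.1 hf h y hy) fun e => hgh (mul_left_cancel e)
  exact LinearMap.congr_fun this x

end Hom

end VectorGrading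

namespace VectorGrading

variable {F G U V W U' V' : Type*} [Field F] [CommGroup G] [DecidableEq G]
  [AddCommGroup U] [Module F U] [AddCommGroup V] [Module F V] [AddCommGroup W] [Module F W]
  [AddCommGroup U'] [Module F U'] [AddCommGroup V'] [Module F V']
  {P : VectorGrading F G U} {Q : VectorGrading F G V}
  {P' : VectorGrading F G U'} {Q' : VectorGrading F G V'}

lemma mem_comp_of_apply_mem {f : U →ₗ[F] V} (hf : f ∈ (P.hom Q).comp 1)
    (hinj : Function.Injective f) {g : G} {x : U} (hx : f x ∈ Q.comp g) : x ∈ P.comp g := by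
  rw [P.mem_comp]
  apply hinj
  rw [← proj_apply_of_mem_hom_comp hf, one_mul, Q.mem_comp.1 hx]

lemma hom_proj_comp_right {g : G} {T : U →ₗ[F] U'} (hT : T ∈ (P.hom P').comp g) (a : G)
    (f : U' →ₗ[F] V) : (P.hom Q).proj (a * g) (f ∘ₗ T) = (P'.hom Q).proj a f ∘ₗ T :=
  P.linearMap_ext fun k x hx => by
    rw [hom_proj_apply _ _ hx, LinearMap.comp_apply, LinearMap.comp_apply,
      hom_proj_apply _ _ (mem_hom_comp.1 hT k x hx), mul_assoc]

lemma hom_proj_comp_left {g : G} {T : V →ₗ[F] V'} (hT : T ∈ (Q.hom Q').comp g) (a : G)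
    (f : U →ₗ[F] V) : (P.hom Q').proj (a * g) (T ∘ₗ f) = T ∘ₗ (P.hom Q).proj a f :=
  P.linearMap_ext fun k x hx => by
    rw [hom_proj_apply _ _ hx, LinearMap.comp_apply, LinearMap.comp_apply,
      hom_proj_apply _ _ hx, ← proj_apply_of_mem_hom_comp hT]
    congr 2
    rw [mul_right_comm, mul_comm]

end VectorGrading

section AdjointGrading

variable {F : Type*} [Field F] {n : ℕ}

/-- The adjoint action of `Mₙ(F)` on `sl_n(F)`. -/
def slAd (F : Type*) [Field F] (n : ℕ) :
    Matrix (Fin n) (Fin n) F →ₗ[F] slM F n →ₗ[F] slM F n :=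
  LinearMap.mk₂ F (fun X x => ⟨⁅X, (x : Matrix (Fin n) (Fin n) F)⁆, trace_lie X x⟩)
    (fun _ _ _ => by ext1; simp only [Ring.lie_def, Submodule.coe_add]; noncomm_ring)
    (fun _ _ _ => by
      ext1; simp [Ring.lie_def, smul_sub])
    (fun _ _ _ => by ext1; simp only [Ring.lie_def, Submodule.coe_add]; noncomm_ring)
    (fun _ _ _ => by
      ext1; simp [Ring.lie_def, smul_sub])

@[simp] lemma coe_slAd_apply (X : Matrix (Fin n) (Fin n) F) (x : slM F n) :
    (slAd F n X x : Matrix (Fin n) (Fin n) F) = ⁅X, (x : Matrix (Fin n) (Fin n) F)⁆ := rfl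

lemma mem_slM {x : Matrix (Fin n) (Fin n) F} : x ∈ slM F n ↔ x.trace = 0 := Iff.rfl

/-- The projection of `sl_n(F)` to the quotient of `Mₙ(F)` by the scalar matrices. -/
abbrev slToPGL (F : Type*) [Field F] (n : ℕ) : slM F n →ₗ[F] PGL F n :=
  toPGL F n ∘ₗ (slM F n).subtype

/-- The embedding of `psl_n(F)` into the quotient of `Mₙ(F)` by the scalar matrices. -/
def pslToPGL (F : Type*) [Field F] (n : ℕ) : (slM F n ⧸ slCenter F n) →ₗ[F] PGL F n :=
  (slCenter F n).mapQ _ (slM F n).subtype le_rfl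

@[simp] lemma pslToPGL_mk (x : slM F n) :
    pslToPGL F n ((slCenter F n).mkQ x) = toPGL F n x := rfl

lemma pslToPGL_injective : Function.Injective (pslToPGL F n) := by
  rw [← LinearMap.ker_eq_bot, LinearMap.ker_eq_bot']
  intro u hu
  obtain ⟨x, rfl⟩ := Submodule.mkQ_surjective _ u
  rw [pslToPGL_mk, Submodule.mkQ_apply, Submodule.Quotient.mk_eq_zero] at hu
  exact (Submodule.Quotient.mk_eq_zero _).2 hu

lemma lie_eq_zero_of_mem_span_one {z : Matrix (Fin n) (Fin n) F}
    (hz : z ∈ Submodule.span F {(1 : Matrix (Fin n) (Fin n) F)}) (y : Matrix (Fin n) (Fin n) F) :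
    ⁅y, z⁆ = 0 := by
  obtain ⟨c, rfl⟩ := Submodule.mem_span_singleton.1 hz
  simp [Ring.lie_def]

/-- The adjoint action of `Mₙ(F)` on `psl_n(F)`. -/
def pslAd (F : Type*) [Field F] (n : ℕ) :
    Matrix (Fin n) (Fin n) F →ₗ[F] (slM F n ⧸ slCenter F n) →ₗ[F] (slM F n ⧸ slCenter F n) :=
  ((slCenter F n).liftQ (((slAd F n).compr₂ (slCenter F n).mkQ).flip) (by
    intro x hx
    rw [LinearMap.mem_ker]
    ext1 y
    rw [LinearMap.flip_apply, LinearMap.compr₂_apply, LinearMap.zero_apply]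
    have : slAd F n y x = 0 := Subtype.ext (lie_eq_zero_of_mem_span_one hx y)
    rw [this, map_zero])).flip

@[simp] lemma pslAd_mk (X : Matrix (Fin n) (Fin n) F) (x : slM F n) :
    pslAd F n X ((slCenter F n).mkQ x) = (slCenter F n).mkQ (slAd F n X x) := rfl

/-- The adjoint action of the quotient of `Mₙ(F)` by the scalar matrices on `psl_n(F)`. -/
def pglAd (F : Type*) [Field F] (n : ℕ) :
    PGL F n →ₗ[F] (slM F n ⧸ slCenter F n) →ₗ[F] (slM F n ⧸ slCenter F n) :=
  (Submodule.span F {(1 : Matrix (Fin n) (Fin n) F)}).liftQ (pslAd F n) (by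
    rw [Submodule.span_singleton_le_iff_mem, LinearMap.mem_ker]
    refine Submodule.linearMap_qext _ ?_
    ext1 x
    have : slAd F n 1 x = 0 := by ext1; simp [Ring.lie_def]
    rw [LinearMap.comp_apply, pslAd_mk, this, map_zero]; rfl)

@[simp] lemma pglAd_toPGL (X : Matrix (Fin n) (Fin n) F) :
    pglAd F n (toPGL F n X) = pslAd F n X := rfl

lemma pglAd_injective (hn : 3 ≤ n) : Function.Injective (pglAd F n) := by
  rw [← LinearMap.ker_eq_bot, LinearMap.ker_eq_bot']
  intro u hu
  obtain ⟨X, rfl⟩ := Submodule.mkQ_surjective _ u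
  have h : ∀ i j : Fin n, i ≠ j → toPGL F n ⁅single i j (1 : F), X⁆ = 0 := by
    intro i j hij
    have hx : single i j (1 : F) ∈ slM F n := trace_single_eq_of_ne _ _ _ hij
    have h0 := congrArg (pslToPGL F n) (LinearMap.congr_fun hu ((slCenter F n).mkQ ⟨_, hx⟩))
    change toPGL F n ⁅X, single i j (1 : F)⁆ = 0 at h0
    rw [← neg_lie_swap, map_neg, h0, neg_zero]
  have h' := fun i j hij => lie_single_eq_of_toPGL_eq_zero hn (h i j hij)
  refine (toPGL_eq_zero_iff_entries hn).2 ⟨fun k l hkl => ?_, fun k l => ?_⟩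
  · obtain ⟨t, htk, htl⟩ := Fin.exists_ne_and_ne hn k l
    simpa [htl.symm, hkl.symm] using h' t k htk t l
  · by_cases hkl : k = l
    · rw [hkl]
    · simpa using h' l k (Ne.symm hkl) l k

/-- The bracket of `psl_n(F)`. -/
def pslBracket (F : Type*) [Field F] (n : ℕ) :
    (slM F n ⧸ slCenter F n) →ₗ[F] (slM F n ⧸ slCenter F n) →ₗ[F] (slM F n ⧸ slCenter F n) :=
  pglAd F n ∘ₗ pslToPGL F n

lemma pslBracket_mk (x y : slM F n) :
    pslBracket F n ((slCenter F n).mkQ x) ((slCenter F n).mkQ y) =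
      (slCenter F n).mkQ (slAd F n x y) := rfl

lemma pslAd_pslBracket (X : Matrix (Fin n) (Fin n) F) (u v : slM F n ⧸ slCenter F n) :
    pslAd F n X (pslBracket F n u v) =
      pslBracket F n (pslAd F n X u) v + pslBracket F n u (pslAd F n X v) := by
  obtain ⟨x, rfl⟩ := Submodule.mkQ_surjective _ u
  obtain ⟨y, rfl⟩ := Submodule.mkQ_surjective _ v
  simp only [pslBracket_mk, pslAd_mk, ← map_add]
  congr 1
  ext1
  simp only [coe_slAd_apply, Submodule.coe_add, Ring.lie_def]
  noncomm_ring

/-- The derivations of `psl_n(F)` are induced by `gl_n(F)`. -/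
theorem exists_eq_pglAd_of_derivation (hn : 3 ≤ n) (h2 : (2 : F) ≠ 0) (h3 : n = 3 → (3 : F) ≠ 0)
    (d : (slM F n ⧸ slCenter F n) →ₗ[F] (slM F n ⧸ slCenter F n))
    (hd : ∀ u v, d (pslBracket F n u v) = pslBracket F n (d u) v + pslBracket F n u (d v)) :
    ∃ w, pglAd F n w = d := by
  obtain ⟨s, hs⟩ := LinearMap.exists_rightInverse_of_surjective (slCenter F n).mkQ
    (Submodule.range_mkQ _)
  replace hs : ∀ u, (slCenter F n).mkQ (s u) = u := LinearMap.congr_fun hs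
  obtain ⟨D, hD⟩ := LinearMap.exists_extend ((slM F n).subtype ∘ₗ s ∘ₗ d ∘ₗ (slCenter F n).mkQ)
  replace hD : ∀ x : slM F n, D x = s (d ((slCenter F n).mkQ x)) := LinearMap.congr_fun hD
  have hD' : ∀ x : slM F n, toPGL F n (D x) = pslToPGL F n (d ((slCenter F n).mkQ x)) := by
    intro x
    rw [hD, ← pslToPGL_mk, hs]
  obtain ⟨m, hm⟩ := exists_eq_toPGL_lie_of_derivation hn h2 h3 D (by
    intro x y hx hy
    lift x to slM F n using hx
    lift y to slM F n using hy
    rw [← coe_slAd_apply, hD', ← pslBracket_mk, hd, map_add, map_add, hD, hD]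
    congr 1
    · conv_lhs => rw [← hs (d ((slCenter F n).mkQ x))]
      rfl
    · conv_lhs => rw [← hs (d ((slCenter F n).mkQ y))]
      rfl)
  refine ⟨toPGL F n m, Submodule.linearMap_qext _ (LinearMap.ext fun x => ?_)⟩
  apply pslToPGL_injective
  rw [LinearMap.comp_apply, LinearMap.comp_apply, ← hD', hm x x.2]
  rfl

variable {G : Type*} [CommGroup G] [DecidableEq G]

open VectorGrading in
/-- A grading of `psl_n(F)` induces a grading of the quotient of `gl_n(F)` by the scalar
matrices. -/
theorem exists_pgl_grading (hn : 3 ≤ n) (h2 : (2 : F) ≠ 0) (h3 : n = 3 → (3 : F) ≠ 0)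
    (Q : VectorGrading F G (slM F n ⧸ slCenter F n))
    (hQ : ∀ g h : G, ∀ u ∈ Q.comp g, ∀ v ∈ Q.comp h, pslBracket F n u v ∈ Q.comp (g * h)) :
    ∃ P : VectorGrading F G (PGL F n),
      (∀ g, ∀ X, toPGL F n X ∈ P.comp g → adPGL F n X ∈ (P.hom P).comp g) ∧
      ∀ g, ∀ x : slM F n, (slCenter F n).mkQ x ∈ Q.comp g ↔ slToPGL F n x ∈ P.comp g := by
  have hbr : pslBracket F n ∈ (Q.hom (Q.hom Q)).comp 1 :=
    mem_hom_comp.2 fun g u hu => mem_hom_comp.2 fun h v hv => by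
      rw [one_mul]; exact hQ g h u hu v hv
  have hbr' : ∀ h, ∀ v ∈ Q.comp h, (pslBracket F n).flip v ∈ (Q.hom Q).comp h := fun h v hv =>
    mem_hom_comp.2 fun g u hu => by rw [mul_comm]; exact hQ g h u hu v hv
  have hstable : ∀ a u, (Q.hom Q).proj a (pglAd F n u) ∈ LinearMap.range (pglAd F n) := by
    intro a u
    obtain ⟨X, rfl⟩ := Submodule.mkQ_surjective _ u
    refine exists_eq_pglAd_of_derivation hn h2 h3 _ fun u v => ?_
    set d := (Q.hom Q).proj a (pslAd F n X) with hd
    change d _ = pslBracket F n (d u) v + pslBracket F n u (d v)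
    have key : (pslBracket F n).compr₂ d = pslBracket F n ∘ₗ d + (pslBracket F n).compl₂ d := by
      refine Q.linearMap_ext fun g u hu => Q.linearMap_ext fun h v hv => ?_
      have huv := hQ g h u hu v hv
      simp only [LinearMap.compr₂_apply, LinearMap.add_apply, LinearMap.comp_apply,
        LinearMap.compl₂_apply]
      rw [hd, hom_proj_apply _ _ huv, hom_proj_apply _ _ hu, hom_proj_apply _ _ hv,
        pslAd_pslBracket, map_add]
      congr 1
      · have := proj_apply_of_mem_hom_comp (hbr' h v hv) (a * g) (pslAd F n X u)
        rw [LinearMap.flip_apply, LinearMap.flip_apply] at this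
        rw [← this]
        congr 2
        rw [mul_comm h, mul_assoc]
      · have hu' := mem_hom_comp.1 hbr g u hu
        have := proj_apply_of_mem_hom_comp hu' (a * h) (pslAd F n X v)
        rw [← this]
        congr 2
        rw [one_mul, mul_left_comm]
    exact LinearMap.congr_fun₂ key u v
  refine ⟨(Q.hom Q).pullback (pglAd F n) (pglAd_injective hn) hstable, fun g X hX => ?_,
    fun g x => ?_⟩
  · rw [mem_pullback_comp, pglAd_toPGL] at hX
    refine mem_hom_comp.2 fun h u hu => ?_
    obtain ⟨Y, rfl⟩ := Submodule.mkQ_surjective _ u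
    rw [mem_pullback_comp, pglAd_toPGL] at hu
    rw [mem_pullback_comp, adPGL_toPGL, pglAd_toPGL]
    refine mem_hom_comp.2 fun k w hw => ?_
    have hcomm : pslAd F n ⁅X, Y⁆ w =
        pslAd F n X (pslAd F n Y w) - pslAd F n Y (pslAd F n X w) := by
      obtain ⟨z, rfl⟩ := Submodule.mkQ_surjective _ w
      simp only [pslAd_mk, ← map_sub]
      congr 1
      ext1
      simp only [coe_slAd_apply, AddSubgroupClass.coe_sub, Ring.lie_def]
      noncomm_ring
    rw [hcomm]
    refine Submodule.sub_mem _ ?_ ?_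
    · rw [mul_assoc]
      exact mem_hom_comp.1 hX _ _ (mem_hom_comp.1 hu _ _ hw)
    · rw [mul_comm g, mul_assoc]
      exact mem_hom_comp.1 hu _ _ (mem_hom_comp.1 hX _ _ hw)
  · have hι : pslToPGL F n ∈ (Q.hom ((Q.hom Q).pullback (pglAd F n) (pglAd_injective hn)
        hstable)).comp 1 := mem_hom_comp.2 fun h u hu => by
      rw [mem_pullback_comp]
      have := mem_hom_comp.1 hbr h u hu
      rwa [pslBracket, LinearMap.comp_apply] at this
    refine ⟨fun hx => ?_, fun hx => mem_comp_of_apply_mem hι pslToPGL_injective hx⟩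
    have := mem_hom_comp.1 hι g _ hx
    rw [pslToPGL_mk, one_mul] at this
    exact this

end AdjointGrading

section SlGrading

variable {F : Type*} [Field F] {n : ℕ}

/-- The trace pairing of `sl_n(F)` with the quotient of `Mₙ(F)` by the scalar matrices. -/
def slTrace (F : Type*) [Field F] (n : ℕ) : slM F n →ₗ[F] PGL F n →ₗ[F] F :=
  ((Submodule.span F {(1 : Matrix (Fin n) (Fin n) F)}).liftQ
    ((((LinearMap.mul F (Matrix (Fin n) (Fin n) F)).compr₂ (traceLinearMap (Fin n) F F)) ∘ₗ
      (slM F n).subtype).flip) (by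
      rw [Submodule.span_singleton_le_iff_mem, LinearMap.mem_ker]
      ext x
      simpa using mem_slM.1 x.2)).flip

@[simp] lemma slTrace_toPGL (x : slM F n) (X : Matrix (Fin n) (Fin n) F) :
    slTrace F n x (toPGL F n X) = (x * X : Matrix (Fin n) (Fin n) F).trace := rfl

lemma slTrace_injective : Function.Injective (slTrace F n) := by
  rw [← LinearMap.ker_eq_bot, LinearMap.ker_eq_bot']
  intro x hx
  ext i j
  have := LinearMap.congr_fun hx (toPGL F n (single j i 1))
  rw [slTrace_toPGL, trace_mul_single] at this
  simpa using this

lemma slTrace_surjective (f : PGL F n →ₗ[F] F) : f ∈ LinearMap.range (slTrace F n) := by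
  let x : Matrix (Fin n) (Fin n) F := Matrix.of fun i j => f (toPGL F n (single j i 1))
  have hx : x ∈ slM F n := by
    rw [mem_slM, trace]
    simp only [x, diag_apply, of_apply, ← map_sum]
    have : ∑ i : Fin n, single i i (1 : F) = 1 := by
      rw [← diagonal_one, ← sum_single_eq_diagonal]
    rw [this, toPGL_eq_zero_iff.2 ⟨1, one_smul _ _⟩, map_zero]
  refine ⟨⟨x, hx⟩, Submodule.linearMap_qext _ ?_⟩
  refine Matrix.ext_linearMap _ fun i j => LinearMap.ext_ring ?_
  change (slTrace F n ⟨x, hx⟩) (toPGL F n (single i j 1)) = f (toPGL F n (single i j 1))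
  rw [slTrace_toPGL, trace_mul_single]
  simp [x]

lemma slTrace_slAd (y : Matrix (Fin n) (Fin n) F) (x : slM F n) (u : PGL F n) :
    slTrace F n (slAd F n y x) u = -slTrace F n x (adPGL F n y u) := by
  obtain ⟨X, rfl⟩ := Submodule.mkQ_surjective _ u
  rw [adPGL_toPGL, slTrace_toPGL, slTrace_toPGL, coe_slAd_apply, ← trace_neg, Ring.lie_def,
    Ring.lie_def, ← sub_eq_zero, ← trace_sub]
  have : ((y * x - x * y) * X - -((x : Matrix (Fin n) (Fin n) F) * (y * X - X * y))) =
    y * (x * X) - x * X * y := by noncomm_ring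
  rw [this, trace_sub, trace_mul_comm, sub_self]

lemma single_mem_slM {i j : Fin n} (hij : i ≠ j) : single i j (1 : F) ∈ slM F n :=
  trace_single_eq_of_ne _ _ _ hij

lemma exists_eq_smul_slToPGL (hn : 3 ≤ n) (f : slM F n →ₗ[F] PGL F n)
    (hf : ∀ y x : slM F n, f (slAd F n y x) = adPGL F n y (f x)) :
    ∃ t : F, f = t • slToPGL F n := by
  obtain ⟨f', hf'⟩ := LinearMap.exists_extend f
  replace hf' : ∀ x : slM F n, f' x = f x := LinearMap.congr_fun hf'
  obtain ⟨t, ht⟩ := exists_eq_smul_toPGL_of_equivariant hn f' (by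
    intro y x hy hx
    lift x to slM F n using hx
    lift y to slM F n using hy
    rw [← coe_slAd_apply, hf', hf', hf])
  exact ⟨t, LinearMap.ext fun x => (hf' x).symm.trans (ht x x.2)⟩

/-- The map sending `X` to `z ↦ X z + z X` modulo scalars, with `z` in `sl_n(F)`. -/
def circPGL (F : Type*) [Field F] (n : ℕ) :
    Matrix (Fin n) (Fin n) F →ₗ[F] slM F n →ₗ[F] PGL F n :=
  ((matCirc F n).compl₂ (slM F n).subtype).compr₂ (toPGL F n)

@[simp] lemma circPGL_apply (X : Matrix (Fin n) (Fin n) F) (z : slM F n) :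
    circPGL F n X z = toPGL F n (matCirc F n X z) := rfl

lemma exists_eq_smul_circPGL (hn : 3 ≤ n) (h2 : (2 : F) ≠ 0)
    (B : slM F n →ₗ[F] slM F n →ₗ[F] PGL F n)
    (hB : ∀ y x z : slM F n,
      adPGL F n y (B x z) = B (slAd F n y x) z + B x (slAd F n y z))
    (hsymm : ∀ x z : slM F n, B x z = B z x) :
    ∃ t : F, B = t • circPGL F n ∘ₗ (slM F n).subtype := by
  obtain ⟨p, hp⟩ := LinearMap.exists_leftInverse_of_injective (slM F n).subtype
    (Submodule.ker_subtype _)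
  replace hp : ∀ x : slM F n, p x = x := LinearMap.congr_fun hp
  obtain ⟨t, ht⟩ := exists_eq_smul_matCirc_of_equivariant hn h2 (B.compl₁₂ p p) (by
    intro y x z hy hx hz
    lift x to slM F n using hx
    lift y to slM F n using hy
    lift z to slM F n using hz
    simp only [LinearMap.compl₁₂_apply]
    rw [← coe_slAd_apply, ← coe_slAd_apply, hp, hp, hp, hp, hB]) (by
    intro x z hx hz
    lift x to slM F n using hx
    lift z to slM F n using hz
    simp only [LinearMap.compl₁₂_apply, hp]
    exact hsymm x z)
  refine ⟨t, LinearMap.ext₂ fun x z => ?_⟩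
  have := ht x z x.2 z.2
  simp only [LinearMap.compl₁₂_apply, hp] at this
  exact this

variable {G : Type*} [CommGroup G]

open VectorGrading

lemma mem_of_toPGL_mem_comp {P : VectorGrading F G (PGL F n)}
    {K : Submodule F (Matrix (Fin n) (Fin n) F)}
    (h : ∀ g, ∀ X, toPGL F n X ∈ P.comp g → X ∈ K) (X : Matrix (Fin n) (Fin n) F) : X ∈ K := by
  have hK : LinearMap.ker (toPGL F n) ≤ K := fun Y hY =>
    h 1 Y (by rw [LinearMap.mem_ker.1 hY]; exact Submodule.zero_mem _)
  rw [← Submodule.comap_map_eq_self hK]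
  refine P.mem_of_comp_le (K := K.map (toPGL F n)) (fun g u hu => ?_) (toPGL F n X)
  obtain ⟨Y, rfl⟩ := Submodule.mkQ_surjective _ u
  exact ⟨Y, h g Y hu, rfl⟩

variable [DecidableEq G]

/-- A grading of `gl_n(F)` modulo scalars induces a grading of `sl_n(F)`. -/
theorem exists_sl_grading (hn : 3 ≤ n) (P : VectorGrading F G (PGL F n))
    (hP : ∀ g, ∀ X, toPGL F n X ∈ P.comp g → adPGL F n X ∈ (P.hom P).comp g) :
    ∃ S : VectorGrading F G (slM F n), slToPGL F n ∈ (S.hom P).comp 1 ∧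
      ∀ g, ∀ X, toPGL F n X ∈ P.comp g → slAd F n X ∈ (S.hom S).comp g := by
  obtain ⟨S, hS⟩ : ∃ S : VectorGrading F G (slM F n),
      ∀ g, ∀ X, toPGL F n X ∈ P.comp g → slAd F n X ∈ (S.hom S).comp g := by
    refine ⟨(P.hom (trivial F G F)).pullback (slTrace F n) slTrace_injective
      fun g x => slTrace_surjective _, fun g X hX => mem_hom_comp.2 fun k x hx => ?_⟩
    rw [mem_pullback_comp] at hx ⊢
    refine mem_hom_comp.2 fun h u hu => ?_
    rw [slTrace_slAd, mul_assoc, mul_left_comm]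
    exact Submodule.neg_mem _ (mem_hom_comp.1 hx _ _ (mem_hom_comp.1 (hP g X hX) h u hu))
  have hne : slToPGL F n ≠ 0 := by
    intro h
    let a : Fin n := ⟨0, by omega⟩
    let b : Fin n := ⟨1, by omega⟩
    have hab : a ≠ b := by simp [a, b]
    have := LinearMap.congr_fun h ⟨_, single_mem_slM hab⟩
    have := ((toPGL_eq_zero_iff_entries hn).1 this).1 a b hab
    simp at this
  obtain ⟨b, hb⟩ := (S.hom P).exists_mem_comp_of_proj_eq_smul hne fun a => by
    refine exists_eq_smul_slToPGL hn _ fun y x => ?_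
    have key : ∀ Y : Matrix (Fin n) (Fin n) F,
        Y ∈ LinearMap.eqLocus ((slAd F n).compr₂ ((S.hom P).proj a (slToPGL F n)))
          ((adPGL F n).compl₂ ((S.hom P).proj a (slToPGL F n))) :=
      mem_of_toPGL_mem_comp (P := P) fun g X hX => by
        change (S.hom P).proj a (slToPGL F n) ∘ₗ slAd F n X =
          adPGL F n X ∘ₗ (S.hom P).proj a (slToPGL F n)
        rw [← hom_proj_comp_right (hS g X hX), ← hom_proj_comp_left (hP g X hX)]
        rfl
    exact LinearMap.congr_fun (key y) x
  refine ⟨S.shift b⁻¹, mem_hom_comp.2 fun g x hx => ?_,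
    fun g X hX => mem_hom_comp.2 fun k x hx => ?_⟩
  · have := mem_hom_comp.1 hb _ _ (mem_shift_comp.1 hx)
    rwa [mul_comm g, mul_inv_cancel_left, ← one_mul g] at this
  · rw [mem_shift_comp, mul_assoc]
    exact mem_hom_comp.1 (hS g X hX) _ _ (mem_shift_comp.1 hx)

lemma adPGL_circPGL (y : Matrix (Fin n) (Fin n) F) (X : Matrix (Fin n) (Fin n) F) (z : slM F n) :
    adPGL F n y (circPGL F n X z) = circPGL F n ⁅y, X⁆ z + circPGL F n X (slAd F n y z) := by
  rw [circPGL_apply, adPGL_toPGL, lie_matCirc, map_add]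
  rfl

lemma hom_hom_proj_apply {U V W : Type*} [AddCommGroup U] [Module F U] [AddCommGroup V]
    [Module F V] [AddCommGroup W] [Module F W] {P : VectorGrading F G U} {Q : VectorGrading F G V}
    {R : VectorGrading F G W} (a : G) (B : U →ₗ[F] V →ₗ[F] W) {k l : G} {x : U}
    (hx : x ∈ P.comp k) {z : V} (hz : z ∈ Q.comp l) :
    (P.hom (Q.hom R)).proj a B x z = R.proj (a * k * l) (B x z) := by
  rw [hom_proj_apply _ _ hx, hom_proj_apply _ _ hz]

lemma circPGL_subtype_ne_zero (hn : 3 ≤ n) : circPGL F n ∘ₗ (slM F n).subtype ≠ 0 := by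
  intro h
  let a : Fin n := ⟨0, by omega⟩
  let b : Fin n := ⟨1, by omega⟩
  let c : Fin n := ⟨2, by omega⟩
  have hab : a ≠ b := by simp [a, b]
  have hbc : b ≠ c := by simp [b, c]
  have hac : a ≠ c := by simp [a, c]
  have := LinearMap.congr_fun₂ h ⟨_, single_mem_slM hab⟩ ⟨_, single_mem_slM hbc⟩
  have := ((toPGL_eq_zero_iff_entries hn).1 this).1 a c hac
  simp [single_mul_single_of_ne, hac.symm] at this

/-- The symmetrized product of `sl_n(F)` with values in `gl_n(F)` modulo scalars is homogeneous. -/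
theorem exists_circPGL_mem_comp (hn : 3 ≤ n) (h2 : (2 : F) ≠ 0) {P : VectorGrading F G (PGL F n)}
    {S : VectorGrading F G (slM F n)}
    (hP : ∀ g, ∀ X, toPGL F n X ∈ P.comp g → adPGL F n X ∈ (P.hom P).comp g)
    (hcan : slToPGL F n ∈ (S.hom P).comp 1)
    (hS : ∀ g, ∀ X, toPGL F n X ∈ P.comp g → slAd F n X ∈ (S.hom S).comp g) :
    ∃ h₀, circPGL F n ∘ₗ (slM F n).subtype ∈ (S.hom (S.hom P)).comp h₀ := by
  refine (S.hom (S.hom P)).exists_mem_comp_of_proj_eq_smul (circPGL_subtype_ne_zero hn) fun a => ?_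
  set B := (S.hom (S.hom P)).proj a (circPGL F n ∘ₗ (slM F n).subtype) with hBdef
  have hBapply : ∀ k l, ∀ x ∈ S.comp k, ∀ z ∈ S.comp l,
      B x z = P.proj (a * k * l) (circPGL F n x z) := fun k l x hx z hz =>
    hom_hom_proj_apply a _ hx hz
  refine exists_eq_smul_circPGL hn h2 B (fun y x z => ?_) (fun x z => ?_)
  · let K : Submodule F (slM F n) :=
      { carrier := {y | ∀ x z, adPGL F n y (B x z) = B (slAd F n y x) z + B x (slAd F n y z)}
        add_mem' := fun {y y'} hy hy' x z => by
          simp only [Submodule.coe_add, map_add, LinearMap.add_apply, hy x z, hy' x z]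
          abel
        zero_mem' := fun x z => by simp
        smul_mem' := fun t y hy x z => by
          simp only [Submodule.coe_smul, map_smul, LinearMap.smul_apply, hy x z, smul_add] }
    refine S.mem_of_comp_le (K := K) (fun g y hy x z => ?_) y x z
    have hy' : toPGL F n y ∈ P.comp g := by
      have := mem_hom_comp.1 hcan g y hy
      rwa [one_mul] at this
    have key : B.compr₂ (adPGL F n y) = B ∘ₗ slAd F n y + B.compl₂ (slAd F n y) := by
      refine S.linearMap_ext fun k x hx => S.linearMap_ext fun l z hz => ?_
      have hyx := mem_hom_comp.1 (hS g y hy') k x hx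
      have hyz := mem_hom_comp.1 (hS g y hy') l z hz
      simp only [LinearMap.compr₂_apply, LinearMap.add_apply, LinearMap.comp_apply,
        LinearMap.compl₂_apply]
      rw [hBapply _ _ _ hx _ hz, hBapply _ _ _ hyx _ hz, hBapply _ _ _ hx _ hyz,
        ← proj_apply_of_mem_hom_comp (hP g y hy'), adPGL_circPGL, map_add,
        show a * (g * k) * l = g * (a * k * l) by ac_rfl,
        show a * k * (g * l) = g * (a * k * l) by ac_rfl]
      rfl
    exact LinearMap.congr_fun₂ key x z
  · have key : B = B.flip := by
      refine S.linearMap_ext fun k x hx => S.linearMap_ext fun l z hz => ?_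
      rw [LinearMap.flip_apply, hBapply _ _ _ hx _ hz, hBapply _ _ _ hz _ hx, mul_right_comm]
      rw [circPGL_apply, circPGL_apply, matCirc_apply, matCirc_apply, add_comm]
    exact LinearMap.congr_fun₂ key x z

end SlGrading

section GlGrading

variable {F : Type*} [Field F] {n : ℕ}

lemma circPGL_one : circPGL F n 1 = (2 : F) • slToPGL F n := by
  ext1 z
  rw [circPGL_apply, matCirc_apply, one_mul, mul_one, LinearMap.smul_apply, LinearMap.comp_apply,
    Submodule.subtype_apply, map_add, two_smul]

lemma circPGL_injective (hn : 3 ≤ n) (h2 : (2 : F) ≠ 0) : Function.Injective (circPGL F n) := by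
  rw [← LinearMap.ker_eq_bot, LinearMap.ker_eq_bot']
  intro X hX
  have key : ∀ i j : Fin n, i ≠ j → ∀ k l, k ≠ l →
      (if l = j then X k i else 0) + (if k = i then X j l else 0) = 0 := by
    intro i j hij k l hkl
    have := LinearMap.congr_fun hX ⟨_, single_mem_slM hij⟩
    have := ((toPGL_eq_zero_iff_entries hn).1 this).1 k l hkl
    rwa [LinearMap.compl₂_apply, Submodule.subtype_apply, matCirc_apply,
      Matrix.add_apply, mul_single_one_apply, single_one_mul_apply] at this
  have hdiag : ∀ i j, i ≠ j → X i i + X j j = 0 := fun i j hij => by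
    simpa using key i j hij i j hij
  ext k i
  rw [Matrix.zero_apply]
  by_cases hki : k = i
  · subst hki
    obtain ⟨s, hsk, -⟩ := Fin.exists_ne_and_ne hn k k
    obtain ⟨t, htk, hts⟩ := Fin.exists_ne_and_ne hn k s
    have : (2 : F) * X k k = 0 := by
      linear_combination hdiag k s hsk.symm + hdiag k t htk.symm - hdiag s t hts.symm
    exact (mul_eq_zero.1 this).resolve_left h2
  · obtain ⟨j, hjk, hji⟩ := Fin.exists_ne_and_ne hn k i
    simpa [hki] using key i j hji.symm k j hjk.symm

variable {G : Type*} [CommGroup G] [DecidableEq G]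

open VectorGrading

variable {P : VectorGrading F G (PGL F n)} {S : VectorGrading F G (slM F n)} {h₀ : G}

lemma exists_proj_circPGL_eq (hn : 3 ≤ n) (h2 : (2 : F) ≠ 0)
    (hP : ∀ g, ∀ X, toPGL F n X ∈ P.comp g → adPGL F n X ∈ (P.hom P).comp g)
    (hcan : slToPGL F n ∈ (S.hom P).comp 1)
    (hS : ∀ g, ∀ X, toPGL F n X ∈ P.comp g → slAd F n X ∈ (S.hom S).comp g)
    (hμ : circPGL F n ∘ₗ (slM F n).subtype ∈ (S.hom (S.hom P)).comp h₀)
    {g : G} {X : Matrix (Fin n) (Fin n) F} (hX : toPGL F n X ∈ P.comp g) {a : G}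
    (ha : a ≠ h₀ * g) :
    ∃ t : F, (S.hom P).proj a (circPGL F n X) = circPGL F n (t • 1) := by
  set f := (S.hom P).proj a (circPGL F n X) with hf
  obtain ⟨t, ht⟩ := exists_eq_smul_slToPGL hn f fun y x => by
    have key : (slAd F n).compr₂ f ∘ₗ (slM F n).subtype =
        (adPGL F n).compl₂ f ∘ₗ (slM F n).subtype := by
      refine S.linearMap_ext fun k y hy => ?_
      have hy' : toPGL F n y ∈ P.comp k := by
        have := mem_hom_comp.1 hcan k y hy
        rwa [one_mul] at this
      change f ∘ₗ slAd F n y = adPGL F n y ∘ₗ f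
      rw [hf, ← hom_proj_comp_right (hS k y hy'), ← hom_proj_comp_left (hP k y hy'),
        ← sub_eq_zero, ← map_sub]
      have : circPGL F n X ∘ₗ slAd F n y - adPGL F n y ∘ₗ circPGL F n X =
          circPGL F n (slAd F n X y) := by
        ext1 z
        rw [LinearMap.sub_apply, LinearMap.comp_apply, LinearMap.comp_apply, adPGL_circPGL,
          coe_slAd_apply, ← neg_lie_swap (y : Matrix (Fin n) (Fin n) F) X, map_neg,
          LinearMap.neg_apply]
        abel
      rw [this]
      have hXy := mem_hom_comp.1 hμ _ _ (mem_hom_comp.1 (hS g X hX) k y hy)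
      refine (S.hom P).proj_eq_zero_of_mem hXy fun e => ha ?_
      rw [← mul_assoc] at e
      exact mul_right_cancel e
    exact LinearMap.congr_fun₂ key y x
  refine ⟨t / 2, ?_⟩
  rw [map_smul, circPGL_one, smul_smul, div_mul_cancel₀ t h2, ht]

/-- The gradings of `sl_n(F)` and of its projection modulo scalars come from a grading of
`gl_n(F)`. -/
theorem exists_gl_grading (hn : 3 ≤ n) (h2 : (2 : F) ≠ 0)
    (hP : ∀ g, ∀ X, toPGL F n X ∈ P.comp g → adPGL F n X ∈ (P.hom P).comp g)
    (hcan : slToPGL F n ∈ (S.hom P).comp 1)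
    (hS : ∀ g, ∀ X, toPGL F n X ∈ P.comp g → slAd F n X ∈ (S.hom S).comp g)
    (hμ : circPGL F n ∘ₗ (slM F n).subtype ∈ (S.hom (S.hom P)).comp h₀) :
    ∃ R : VectorGrading F G (Matrix (Fin n) (Fin n) F),
      toPGL F n ∈ (R.hom P).comp 1 ∧ (slM F n).subtype ∈ (S.hom R).comp 1 ∧
      circPGL F n ∈ (R.hom (S.hom P)).comp h₀ ∧ 1 ∈ R.comp h₀⁻¹ ∧
      ∀ g h, ∀ X ∈ R.comp g, ∀ Y ∈ R.comp h, ⁅X, Y⁆ ∈ R.comp (g * h) := by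
  have hproj := fun {g X} hX {a} ha =>
    exists_proj_circPGL_eq (g := g) (X := X) (a := a) hn h2 hP hcan hS hμ hX ha
  have hstable : ∀ a X, (S.hom P).proj a (circPGL F n X) ∈ LinearMap.range (circPGL F n) := by
    intro a X
    refine mem_of_toPGL_mem_comp (P := P) (K := (LinearMap.range (circPGL F n)).comap
      ((S.hom P).proj a ∘ₗ circPGL F n)) (fun g Y hY => ?_) X
    have hne : ∀ b, b ≠ h₀ * g →
        (S.hom P).proj b (circPGL F n Y) ∈ LinearMap.range (circPGL F n) := fun b hb => by
      obtain ⟨t, ht⟩ := hproj hY hb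
      exact ⟨_, ht.symm⟩
    rw [Submodule.mem_comap, LinearMap.comp_apply]
    by_cases ha : a = h₀ * g
    · have hsum := (S.hom P).sum_proj_of_subset (Finset.subset_insert a _) (circPGL F n Y)
      rw [← Finset.add_sum_erase _ _ (Finset.mem_insert_self a _)] at hsum
      rw [eq_sub_of_add_eq hsum]
      refine Submodule.sub_mem _ ⟨Y, rfl⟩ (Submodule.sum_mem _ fun b hb => hne b ?_)
      exact ha ▸ Finset.ne_of_mem_erase hb
    · exact hne a ha
  let R := ((S.hom P).pullback (circPGL F n) (circPGL_injective hn h2) hstable).shift h₀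
  have hR : ∀ g X, X ∈ R.comp g ↔ circPGL F n X ∈ (S.hom P).comp (g * h₀) := fun g X => by
    rw [mem_shift_comp, mem_pullback_comp]
  have hRproj : ∀ g X, circPGL F n (R.proj g X) = (S.hom P).proj (g * h₀) (circPGL F n X) :=
    fun g X => apply_pullback_proj _ _ _ _ _ _
  have htoPGL : ∀ g X, toPGL F n (R.proj g X) = P.proj g (toPGL F n X) := by
    intro g X
    refine mem_of_toPGL_mem_comp (P := P) (K := LinearMap.eqLocus (toPGL F n ∘ₗ R.proj g)
      (P.proj g ∘ₗ toPGL F n)) (fun k Y hY => ?_) X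
    have hne : ∀ b, b ≠ k → toPGL F n (R.proj b Y) = 0 := by
      intro b hb
      obtain ⟨t, ht⟩ := hproj hY (a := b * h₀) fun e =>
        hb (mul_left_cancel ((mul_comm _ _).trans e))
      rw [← hRproj] at ht
      rw [circPGL_injective hn h2 ht, toPGL_eq_zero_iff]
      exact ⟨t, rfl⟩
    change toPGL F n (R.proj g Y) = P.proj g (toPGL F n Y)
    by_cases hg : g = k
    · subst hg
      rw [P.mem_comp.1 hY]
      conv_rhs => rw [← R.sum_proj_of_subset (Finset.subset_insert g _) Y, map_sum]
      rw [Finset.sum_eq_single_of_mem g (Finset.mem_insert_self g _) fun b _ hb => hne b hb]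
    · rw [hne g hg, P.proj_eq_zero_of_mem hY hg]
  have htoPGL' : ∀ g, ∀ X ∈ R.comp g, toPGL F n X ∈ P.comp g := fun g X hX => by
    rw [P.mem_comp, ← htoPGL, R.mem_comp.1 hX]
  refine ⟨R, mem_hom_comp.2 fun g X hX => ?_, mem_hom_comp.2 fun g x hx => ?_,
    mem_hom_comp.2 fun g X hX => ?_, ?_, fun g h X hX Y hY => ?_⟩
  · rw [one_mul]; exact htoPGL' g X hX
  · rw [one_mul, hR, mul_comm]
    exact mem_hom_comp.1 hμ g x hx
  · rw [mul_comm]; exact (hR g X).1 hX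
  · rw [hR, inv_mul_cancel, circPGL_one]
    exact Submodule.smul_mem _ _ hcan
  · have hX' := htoPGL' g X hX
    rw [hR] at hY ⊢
    have : circPGL F n ⁅X, Y⁆ = adPGL F n X ∘ₗ circPGL F n Y - circPGL F n Y ∘ₗ slAd F n X := by
      ext1 z
      rw [LinearMap.sub_apply, LinearMap.comp_apply, LinearMap.comp_apply, adPGL_circPGL,
        add_sub_cancel_right]
    rw [this]
    refine mem_hom_comp.2 fun k z hz => Submodule.sub_mem _ ?_ ?_
    · have := mem_hom_comp.1 (hP g X hX') _ _ (mem_hom_comp.1 hY k z hz)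
      rwa [← mul_assoc, ← mul_assoc] at this
    · have := mem_hom_comp.1 hY _ _ (mem_hom_comp.1 (hS g X hX') k z hz)
      rwa [show h * h₀ * (g * k) = g * h * h₀ * k by ac_rfl] at this

end GlGrading

section Symmetrized

variable {F : Type*} [Field F] {n : ℕ}

/-- The map sending `X` to `z ↦ X z + z X`, with `z` in `sl_n(F)`. -/
def slCirc (F : Type*) [Field F] (n : ℕ) :
    Matrix (Fin n) (Fin n) F →ₗ[F] slM F n →ₗ[F] Matrix (Fin n) (Fin n) F :=
  (matCirc F n).compl₂ (slM F n).subtype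

@[simp] lemma slCirc_apply (X : Matrix (Fin n) (Fin n) F) (z : slM F n) :
    slCirc F n X z = X * z + z * X := rfl

lemma toPGL_slCirc (X : Matrix (Fin n) (Fin n) F) (z : slM F n) :
    toPGL F n (slCirc F n X z) = circPGL F n X z := rfl

lemma circPGL_slCirc_sub (X : Matrix (Fin n) (Fin n) F) (z w : slM F n) :
    circPGL F n (slCirc F n X z) w - circPGL F n (slCirc F n X w) z =
      adPGL F n X (adPGL F n z (slToPGL F n w)) := by
  rw [LinearMap.comp_apply, Submodule.subtype_apply, adPGL_toPGL, adPGL_toPGL, circPGL_apply,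
    circPGL_apply, ← map_sub]
  congr 1
  simp only [slCirc_apply, matCirc_apply, Ring.lie_def]
  noncomm_ring

lemma exists_three_ne (hn : 3 ≤ n) : ∃ a b c : Fin n, a ≠ b ∧ b ≠ c ∧ a ≠ c :=
  ⟨⟨0, by omega⟩, ⟨1, by omega⟩, ⟨2, by omega⟩, by simp, by simp, by simp⟩

lemma not_forall_slToPGL_mem_span (hn : 3 ≤ n) (u : PGL F n) :
    ¬ ∀ w : slM F n, slToPGL F n w ∈ Submodule.span F {u} := by
  intro h
  obtain ⟨a, b, c, hab, hbc, hac⟩ := exists_three_ne hn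
  obtain ⟨s, hs⟩ := Submodule.mem_span_singleton.1 (h ⟨_, single_mem_slM hab⟩)
  obtain ⟨t, ht⟩ := Submodule.mem_span_singleton.1 (h ⟨_, single_mem_slM hbc⟩)
  have hst : t • toPGL F n (single a b 1) = s • toPGL F n (single b c 1) := by
    change t • slToPGL F n ⟨_, single_mem_slM hab⟩ = s • slToPGL F n ⟨_, single_mem_slM hbc⟩
    rw [← hs, ← ht, smul_comm]
  rw [← sub_eq_zero, ← map_smul, ← map_smul, ← map_sub, toPGL_eq_zero_iff_entries hn] at hst
  have h0 : s = 0 := by simpa [hab, hac] using hst.1 b c hbc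
  rw [h0, zero_smul] at hs
  have := ((toPGL_eq_zero_iff_entries hn).1 hs.symm).1 a b hab
  simp at this

lemma not_forall_adPGL_eq (hn : 3 ≤ n) (c : Matrix (Fin n) (Fin n) F →ₗ[F] slM F n →ₗ[F] F) :
    ¬ ∀ (X : Matrix (Fin n) (Fin n) F) (z w : slM F n),
      adPGL F n X (adPGL F n z (slToPGL F n w)) =
        c X z • slToPGL F n w - c X w • slToPGL F n z := by
  intro h
  obtain ⟨i, j, k, hij, hjk, hik⟩ := exists_three_ne hn
  have h := h (single k i 1) ⟨_, single_mem_slM hij⟩ ⟨_, single_mem_slM hjk⟩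
  simp only [LinearMap.comp_apply, Submodule.subtype_apply, adPGL_toPGL, lie_single_single,
    if_true, hik.symm, if_false, sub_zero] at h
  rw [← sub_eq_zero, ← map_smul, ← map_smul, ← map_sub, ← map_sub,
    toPGL_eq_zero_iff_entries hn] at h
  have := h.2 k j
  simp [hij, hjk, hjk.symm, hik] at this

variable {G : Type*} [CommGroup G] [DecidableEq G]

open VectorGrading

variable {P : VectorGrading F G (PGL F n)} {S : VectorGrading F G (slM F n)}
  {R : VectorGrading F G (Matrix (Fin n) (Fin n) F)} {h₀ : G}

/-- The symmetrized product of `gl_n(F)` with `sl_n(F)` is homogeneous up to scalars. -/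
lemma exists_slCirc_eq_add_smul_one (hn : 3 ≤ n)
    (htoPGL : toPGL F n ∈ (R.hom P).comp 1)
    (hcirc : circPGL F n ∈ (R.hom (S.hom P)).comp h₀) (h1 : 1 ∈ R.comp h₀⁻¹) :
    ∃ (star : Matrix (Fin n) (Fin n) F →ₗ[F] slM F n →ₗ[F] Matrix (Fin n) (Fin n) F)
      (c : Matrix (Fin n) (Fin n) F →ₗ[F] slM F n →ₗ[F] F),
      star ∈ (R.hom (S.hom R)).comp h₀ ∧ (∀ X z, slCirc F n X z = star X z + c X z • 1) ∧
      ∀ g k, ∀ X ∈ R.comp g, ∀ z ∈ S.comp k, h₀ * g * k = h₀⁻¹ → c X z = 0 := by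
  let star := (R.hom (S.hom R)).proj h₀ (slCirc F n)
  have hstar : star.compr₂ (toPGL F n) = circPGL F n :=
    R.linearMap_ext fun g X hX => S.linearMap_ext fun k z hz => by
      change toPGL F n (star X z) = circPGL F n X z
      rw [hom_hom_proj_apply h₀ (slCirc F n) hX hz, ← proj_apply_of_mem_hom_comp htoPGL, one_mul,
        toPGL_slCirc]
      exact mem_hom_comp.1 (mem_hom_comp.1 hcirc g X hX) k z hz
  replace hstar : ∀ X z, toPGL F n (star X z) = circPGL F n X z := LinearMap.congr_fun₂ hstar
  let i₀ : Fin n := ⟨0, by omega⟩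
  let c := (slCirc F n - star).compr₂ (entryLinearMap F F i₀ i₀)
  have hc : ∀ X z, slCirc F n X z = star X z + c X z • 1 := fun X z => by
    have : toPGL F n (slCirc F n X z - star X z) = 0 := by
      rw [map_sub, hstar, toPGL_slCirc, sub_self]
    obtain ⟨t, ht⟩ := toPGL_eq_zero_iff.1 this
    have hct : c X z = t := by
      change (slCirc F n X z - star X z) i₀ i₀ = t
      rw [← ht]; simp
    rw [hct, ht]; abel
  refine ⟨star, c, proj_mem _ _ _, hc, fun g k X hX z hz hgk => ?_⟩
  have h3 : R.proj h₀⁻¹ (slCirc F n X z) = star X z := by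
    rw [← hgk]; exact (hom_hom_proj_apply h₀ (slCirc F n) hX hz).symm
  have h4 : star X z ∈ R.comp h₀⁻¹ := h3 ▸ R.proj_mem _ _
  rw [hc, map_add, map_smul, R.mem_comp.1 h4, R.mem_comp.1 h1, add_eq_left] at h3
  have := congrFun (congrFun h3 i₀) i₀
  simpa using this

theorem slCirc_mem_comp (hn : 3 ≤ n) (h2 : (2 : F) ≠ 0)
    (hP : ∀ g, ∀ X, toPGL F n X ∈ P.comp g → adPGL F n X ∈ (P.hom P).comp g)
    (hcan : slToPGL F n ∈ (S.hom P).comp 1)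
    (htoPGL : toPGL F n ∈ (R.hom P).comp 1)
    (hcirc : circPGL F n ∈ (R.hom (S.hom P)).comp h₀) (h1 : 1 ∈ R.comp h₀⁻¹) :
    h₀ * h₀ = 1 ∧ slCirc F n ∈ (R.hom (S.hom R)).comp h₀ := by
  obtain ⟨star, c, hstar, hc, hc0⟩ := exists_slCirc_eq_add_smul_one hn htoPGL hcirc h1
  have hstar' : ∀ g k, ∀ X ∈ R.comp g, ∀ z ∈ S.comp k, star X z ∈ R.comp (h₀ * g * k) :=
    fun g k X hX z hz => mem_hom_comp.1 (mem_hom_comp.1 hstar g X hX) k z hz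
  have hA : ∀ g k l, ∀ X ∈ R.comp g, ∀ z ∈ S.comp k, ∀ w ∈ S.comp l,
      circPGL F n (star X z) w ∈ P.comp (h₀ * h₀ * (g * k * l)) := fun g k l X hX z hz w hw => by
    have := mem_hom_comp.1 (mem_hom_comp.1 hcirc _ _ (hstar' g k X hX z hz)) l w hw
    rwa [show h₀ * (h₀ * g * k) * l = h₀ * h₀ * (g * k * l) by ac_rfl] at this
  have hcan' : ∀ k, ∀ z ∈ S.comp k, slToPGL F n z ∈ P.comp k := fun k z hz => by
    have := mem_hom_comp.1 hcan k z hz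
    rwa [one_mul] at this
  have hB : ∀ g k l, ∀ X ∈ R.comp g, ∀ z ∈ S.comp k, ∀ w ∈ S.comp l,
      adPGL F n X (adPGL F n z (slToPGL F n w)) ∈ P.comp (g * k * l) :=
    fun g k l X hX z hz w hw => by
      have hX' := mem_hom_comp.1 htoPGL g X hX
      rw [one_mul] at hX'
      rw [mul_assoc]
      exact mem_hom_comp.1 (hP g X hX') _ _
        (mem_hom_comp.1 (hP k z (hcan' k z hz)) l _ (hcan' l w hw))
  have hid : ∀ (X : Matrix (Fin n) (Fin n) F) (z w : slM F n),
      circPGL F n (star X z) w - circPGL F n (star X w) z +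
      ((2 * c X z) • slToPGL F n w - (2 * c X w) • slToPGL F n z) =
        adPGL F n X (adPGL F n z (slToPGL F n w)) := fun X z w => by
    rw [← circPGL_slCirc_sub, hc, hc]
    simp only [map_add, map_smul, circPGL_one, LinearMap.add_apply, LinearMap.smul_apply, smul_smul,
      mul_comm (2 : F)]
    abel
  have hh₀ : h₀ * h₀ = 1 := by
    by_contra hne
    have hproj : ∀ g k l, ∀ X ∈ R.comp g, ∀ z ∈ S.comp k, ∀ w ∈ S.comp l,
        P.proj (h₀ * h₀ * (g * k * l)) ((2 * c X z) • slToPGL F n w) = 0 :=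
      fun g k l X hX z hz w hw => by
        by_cases h : h₀ * g * k = h₀⁻¹
        · rw [hc0 g k X hX z hz h, mul_zero, zero_smul, map_zero]
        · refine P.proj_eq_zero_of_mem (Submodule.smul_mem _ _ (hcan' l w hw)) fun e => h ?_
          rw [eq_inv_iff_mul_eq_one]
          refine mul_right_cancel (b := l) ?_
          rw [one_mul]
          conv_rhs => rw [← e]
          ac_rfl
    have hhom : ∀ g k l, ∀ X ∈ R.comp g, ∀ z ∈ S.comp k, ∀ w ∈ S.comp l,
        adPGL F n X (adPGL F n z (slToPGL F n w)) =
          (2 * c X z) • slToPGL F n w - (2 * c X w) • slToPGL F n z :=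
      fun g k l X hX z hz w hw => by
        have h := congrArg (P.proj (h₀ * h₀ * (g * k * l))) (hid X z w)
        have hA' := hA g l k X hX w hw z hz
        have hproj' := hproj g l k X hX w hw z hz
        rw [mul_right_comm g l k] at hA' hproj'
        rw [map_add, map_sub _ (_ • _), hproj g k l X hX z hz w hw, hproj', sub_zero, add_zero,
          P.proj_eq_zero_of_mem (hB g k l X hX z hz w hw) (by simpa using hne),
          P.mem_comp.1 (Submodule.sub_mem _ (hA g k l X hX z hz w hw) hA')] at h
        rw [← hid, h, zero_add]
    let K : Submodule F (Matrix (Fin n) (Fin n) F) :=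
      { carrier := {X | ∀ z w : slM F n, adPGL F n X (adPGL F n z (slToPGL F n w)) =
          (2 * c X z) • slToPGL F n w - (2 * c X w) • slToPGL F n z}
        add_mem' := fun {X Y} hX hY z w => by
          simp only [map_add, LinearMap.add_apply, hX z w, hY z w, mul_add, add_smul]
          abel
        zero_mem' := fun z w => by simp
        smul_mem' := fun t X hX z w => by
          simp only [map_smul, LinearMap.smul_apply, hX z w, smul_sub, smul_smul, smul_eq_mul,
            mul_left_comm t] }
    refine not_forall_adPGL_eq hn ((2 : F) • c) fun X z w => ?_
    refine R.mem_of_comp_le (K := K) (fun g X hX z w => ?_) X z w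
    have key : (((adPGL F n).compl₂ (slToPGL F n)) ∘ₗ (slM F n).subtype).compr₂ (adPGL F n X) =
        (LinearMap.lsmul F (PGL F n) ∘ₗ ((2 : F) • c X)).compl₂ (slToPGL F n) -
          ((LinearMap.lsmul F (PGL F n) ∘ₗ ((2 : F) • c X)).compl₂ (slToPGL F n)).flip :=
      S.linearMap_ext fun k z hz => S.linearMap_ext fun l w hw => hhom g k l X hX z hz w hw
    exact LinearMap.congr_fun₂ key z w
  refine ⟨hh₀, mem_hom_comp.2 fun g X hX => mem_hom_comp.2 fun k z hz => ?_⟩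
  suffices h : c X z = 0 by
    rw [hc, h, zero_smul, add_zero]
    exact hstar' g k X hX z hz
  by_contra hcXz
  have hgk : g * k ≠ 1 := fun h => hcXz (hc0 g k X hX z hz (by
    rw [mul_assoc, h, mul_one, eq_inv_iff_mul_eq_one, hh₀]))
  refine not_forall_slToPGL_mem_span hn (slToPGL F n z) fun w => ?_
  refine S.mem_of_comp_le (K := (Submodule.span F {slToPGL F n z}).comap (slToPGL F n))
    (fun l w hw => ?_) w
  rw [Submodule.mem_comap]
  have hgkl : l ≠ g * k * l := fun e => hgk (by simpa using e)
  have h := congrArg (P.proj l) (hid X z w)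
  have hA1 := hA g k l X hX z hz w hw
  have hA2 := hA g l k X hX w hw z hz
  rw [hh₀, one_mul] at hA1 hA2
  rw [mul_right_comm g l k] at hA2
  rw [map_add, P.proj_eq_zero_of_mem (Submodule.sub_mem _ hA1 hA2) hgkl,
    P.proj_eq_zero_of_mem (hB g k l X hX z hz w hw) hgkl, zero_add, map_sub, sub_eq_zero,
    P.mem_comp.1 (Submodule.smul_mem _ _ (hcan' l w hw)), map_smul] at h
  rw [← Submodule.smul_mem_iff _ (mul_ne_zero h2 hcXz), h]
  refine Submodule.smul_mem _ _ ?_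
  by_cases hlk : l = k
  · rw [hlk, P.mem_comp.1 (hcan' k z hz)]
    exact Submodule.mem_span_singleton_self _
  · rw [P.proj_eq_zero_of_mem (hcan' k z hz) hlk]
    exact Submodule.zero_mem _

end Symmetrized

section Decomposition

variable {F : Type*} [Field F] {n : ℕ}

lemma single_mem_of_matCirc_mem (hn : 3 ≤ n) (h2 : (2 : F) ≠ 0)
    {K : Submodule F (Matrix (Fin n) (Fin n) F)}
    (hK : ∀ y z : slM F n, matCirc F n y z ∈ K) (i j : Fin n) : single i j 1 ∈ K := by
  by_cases hij : i = j
  · subst hij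
    obtain ⟨j, hj, -⟩ := Fin.exists_ne_and_ne hn i i
    obtain ⟨k, hki, hkj⟩ := Fin.exists_ne_and_ne hn i j
    have hij' := hK ⟨_, single_mem_slM hj.symm⟩ ⟨_, single_mem_slM hj⟩
    have hik' := hK ⟨_, single_mem_slM hki.symm⟩ ⟨_, single_mem_slM hki⟩
    have hjk' := hK ⟨_, single_mem_slM hkj.symm⟩ ⟨_, single_mem_slM hkj⟩
    have h := K.sub_mem (K.add_mem hij' hik') hjk'
    simp only [matCirc_apply, single_mul_single_same, mul_one] at h
    rw [← K.smul_mem_iff h2, two_smul]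
    convert h using 1
    abel
  · obtain ⟨k, hki, hkj⟩ := Fin.exists_ne_and_ne hn i j
    have h := hK ⟨_, single_mem_slM hki.symm⟩ ⟨_, single_mem_slM hkj⟩
    simpa [matCirc_apply, single_mul_single_of_ne, Ne.symm hij] using h

lemma mem_of_matCirc_mem (hn : 3 ≤ n) (h2 : (2 : F) ≠ 0)
    {K : Submodule F (Matrix (Fin n) (Fin n) F)}
    (hK : ∀ y z : slM F n, matCirc F n y z ∈ K) (X : Matrix (Fin n) (Fin n) F) : X ∈ K := by
  rw [matrix_eq_sum_single X]
  refine K.sum_mem fun i _ => K.sum_mem fun j _ => ?_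
  rw [← mul_one (X i j), ← smul_eq_mul, ← smul_single]
  exact K.smul_mem _ (single_mem_of_matCirc_mem hn h2 hK i j)

variable {G : Type*} [CommGroup G] [DecidableEq G]

open VectorGrading

variable {S : VectorGrading F G (slM F n)}
  {R : VectorGrading F G (Matrix (Fin n) (Fin n) F)} {h₀ : G}

/-- If the symmetrized product of `gl_n(F)` with `sl_n(F)` is homogeneous, so is that of
`gl_n(F)` with itself. -/
theorem matCirc_mem_comp (hn : 3 ≤ n) (h2 : (2 : F) ≠ 0) (hh₀ : h₀ * h₀ = 1)
    (hsub : (slM F n).subtype ∈ (S.hom R).comp 1)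
    (hR : ∀ g h, ∀ X ∈ R.comp g, ∀ Y ∈ R.comp h, ⁅X, Y⁆ ∈ R.comp (g * h))
    (hcirc : slCirc F n ∈ (R.hom (S.hom R)).comp h₀) :
    matCirc F n ∈ (R.hom (R.hom R)).comp h₀ := by
  have hsub' : ∀ k, ∀ z ∈ S.comp k, (z : Matrix (Fin n) (Fin n) F) ∈ R.comp k := fun k z hz => by
    have := mem_hom_comp.1 hsub k z hz
    rwa [one_mul] at this
  have hcirc' : ∀ g k, ∀ X ∈ R.comp g, ∀ z ∈ S.comp k, X * z + z * X ∈ R.comp (h₀ * g * k) :=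
    fun g k X hX z hz => mem_hom_comp.1 (mem_hom_comp.1 hcirc g X hX) k z hz
  refine mem_hom_comp.2 fun g X hX => ?_
  rw [mem_comp]
  let f := matCirc F n X
  let f' := (R.hom R).proj (h₀ * g) f
  have key : ((slCirc F n ∘ₗ (slM F n).subtype).compr₂ f') =
      ((slCirc F n ∘ₗ (slM F n).subtype).compr₂ f) :=
    S.linearMap_ext fun k y hy => S.linearMap_ext fun l z hz => by
      have hyz := hcirc' k l y (hsub' k y hy) z hz
      have hXyz := hcirc' (h₀ * g * k) l _ (hcirc' g k X hX y hy) z hz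
      have hlie := hR k (g * l) y (hsub' k y hy) _ (hR g l X hX z (hsub' l z hz))
      have e : h₀ * (h₀ * g * k) * l = k * (g * l) := by
        rw [← one_mul (k * (g * l)), ← hh₀]; ac_rfl
      rw [e] at hXyz
      change f' (slCirc F n y z) = f (slCirc F n y z)
      rw [slCirc_apply, hom_proj_apply _ _ hyz,
        show h₀ * g * (h₀ * k * l) = k * (g * l) by rw [← e]; ac_rfl]
      refine R.mem_comp.1 ?_
      convert Submodule.sub_mem _ hXyz hlie using 1
      simp only [f, matCirc_apply, Ring.lie_def]
      noncomm_ring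
  refine LinearMap.ext fun Y => ?_
  exact mem_of_matCirc_mem hn h2 (K := LinearMap.eqLocus f' f)
    (fun y z => LinearMap.congr_fun₂ key y z) Y

end Decomposition

section Character

/-- A character of an abelian group with value `-1` at a given element of order two. -/
theorem exists_monoidHom_apply_eq_neg_one {F G : Type*} [Field F] [IsAlgClosed F] [CommGroup G]
    {h : G} (h1 : h ≠ 1) (hh : h * h = 1) : ∃ χ : G →* Fˣ, χ h = -1 := by
  let : DivisibleBy (Additive Fˣ) ℕ := divisibleByOfSMulRightSurj _ _ fun {k} hk u => by
    obtain ⟨z, hz⟩ := IsAlgClosed.exists_pow_nat_eq (u.toMul : F) (Nat.pos_of_ne_zero hk)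
    have hz0 : z ≠ 0 := by
      rintro rfl
      exact u.toMul.ne_zero (by rw [← hz, zero_pow hk])
    exact ⟨Additive.ofMul (Units.mk0 z hz0), Additive.toMul.injective (Units.ext hz)⟩
  let : DivisibleBy (Additive Fˣ) ℤ := AddGroup.divisibleByIntOfDivisibleByNat _
  let f : ZMod 2 →+ Additive G := ZMod.lift 2 ⟨(zmultiplesHom _) (Additive.ofMul h), by
    rw [zmultiplesHom_apply, Nat.cast_ofNat, two_zsmul, ← ofMul_mul, hh, ofMul_one]⟩
  let f' : ZMod 2 →+ Additive Fˣ := ZMod.lift 2 ⟨(zmultiplesHom _) (Additive.ofMul (-1)), by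
    rw [zmultiplesHom_apply, Nat.cast_ofNat, two_zsmul, ← ofMul_mul, neg_mul_neg, one_mul,
      ofMul_one]⟩
  have hf1 : f 1 = Additive.ofMul h := by
    have := ZMod.lift_coe 2 ⟨(zmultiplesHom _) (Additive.ofMul h), by
      rw [zmultiplesHom_apply, Nat.cast_ofNat, two_zsmul, ← ofMul_mul, hh, ofMul_one]⟩ 1
    simpa [f] using this
  have hf1' : f' 1 = Additive.ofMul (-1) := by
    have := ZMod.lift_coe 2 ⟨(zmultiplesHom _) (Additive.ofMul (-1 : Fˣ)), by
      rw [zmultiplesHom_apply, Nat.cast_ofNat, two_zsmul, ← ofMul_mul, neg_mul_neg, one_mul,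
        ofMul_one]⟩ 1
    simpa [f'] using this
  have hf : Function.Injective f := by
    rw [injective_iff_map_eq_zero]
    intro a ha
    fin_cases a
    · rfl
    · exact absurd (hf1.symm.trans ha) (ofMul_eq_zero.not.2 h1)
  obtain ⟨χ, hχ⟩ := (Module.Baer.of_divisible (Additive Fˣ)).extension_property_addMonoidHom f hf f'
  refine ⟨MonoidHom.toAdditive.symm χ, ?_⟩
  have := DFunLike.congr_fun hχ 1
  rw [AddMonoidHom.comp_apply, hf1, hf1'] at this
  exact this

end Character

namespace VectorGrading

variable {F G V : Type*} [Field F] [AddCommGroup V] [Module F V] [CommGroup G]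
  (P : VectorGrading F G V)

/-- The action of a character on a graded vector space. -/
def twist (χ : G →* Fˣ) : V →ₗ[F] V := ∑ g ∈ P.supp, (χ g : F) • P.proj g

variable {P} in
lemma twist_apply_of_mem (χ : G →* Fˣ) {g : G} {x : V} (hx : x ∈ P.comp g) :
    P.twist χ x = (χ g : F) • x := by
  rw [twist, LinearMap.sum_apply]
  by_cases hg : g ∈ P.supp
  · rw [Finset.sum_eq_single_of_mem g hg fun h _ hh => ?_]
    · rw [LinearMap.smul_apply, P.mem_comp.1 hx]
    · rw [LinearMap.smul_apply, P.proj_eq_zero_of_mem hx hh, smul_zero]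
  · simp [P.eq_zero_of_notMem_supp hg hx]

lemma twist_twist {χ ψ : G →* Fˣ} (h : ∀ g, ψ g * χ g = 1) (x : V) :
    P.twist χ (P.twist ψ x) = x := by
  have : P.twist χ ∘ₗ P.twist ψ = LinearMap.id := P.linearMap_ext fun g y hy => by
    rw [LinearMap.comp_apply, twist_apply_of_mem _ hy, map_smul, twist_apply_of_mem _ hy,
      smul_smul, ← Units.val_mul, h, Units.val_one, one_smul, LinearMap.id_apply]
  exact LinearMap.congr_fun this x

/-- The negative of the action of a character on a graded vector space. -/
def negTwist (χ : G →* Fˣ) : V ≃ₗ[F] V :=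
  LinearEquiv.trans
    (LinearEquiv.ofLinearMap (P.twist χ) (P.twist χ⁻¹)
      (LinearMap.ext fun x => P.twist_twist (fun g => inv_mul_cancel (χ g)) x)
      (LinearMap.ext fun x => P.twist_twist (fun g => mul_inv_cancel (χ g)) x) : V ≃ₗ[F] V)
    (LinearEquiv.neg F)

variable {P} in
lemma negTwist_apply_of_mem (χ : G →* Fˣ) {g : G} {x : V} (hx : x ∈ P.comp g) :
    P.negTwist χ x = -((χ g : F) • x) := by
  rw [negTwist, LinearEquiv.trans_apply, LinearEquiv.neg_apply, LinearEquiv.coe_ofLinearMap,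
    twist_apply_of_mem χ hx]

variable {P} {h₀ : G}

lemma map_negTwist_add (χ : G →* Fˣ) (g h : G) :
    (P.comp g + P.comp h).map (P.negTwist χ).toLinearMap = P.comp g + P.comp h := by
  have key : ∀ k, (P.comp k).map (P.negTwist χ).toLinearMap = P.comp k := fun k => by
    ext x
    constructor
    · rintro ⟨y, hy, rfl⟩
      rw [LinearEquiv.coe_coe, negTwist_apply_of_mem χ hy]
      exact neg_mem (Submodule.smul_mem _ _ hy)
    · intro hx
      refine ⟨-(((χ k)⁻¹ : Fˣ) : F) • x, Submodule.smul_mem _ _ hx, ?_⟩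
      rw [LinearEquiv.coe_coe, map_smul, negTwist_apply_of_mem χ hx, neg_smul, smul_neg, neg_neg,
        smul_smul, ← Units.val_mul, inv_mul_cancel, Units.val_one, one_smul]
  rw [Submodule.add_eq_sup, Submodule.map_sup, key, key]

lemma mem_comp_iff_negTwist_apply (h2 : (2 : F) ≠ 0) {χ : G →* Fˣ} (hχ : χ h₀ = -1) (g : G)
    (x : V) : x ∈ P.comp g ↔
      x ∈ P.comp g + P.comp (g * h₀) ∧ P.negTwist χ x = -((χ g : F) • x) := by
  rw [Submodule.add_eq_sup]
  refine ⟨fun hx => ⟨Submodule.mem_sup_left hx, negTwist_apply_of_mem χ hx⟩, ?_⟩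
  rintro ⟨hx, hφ⟩
  obtain ⟨y, hy, z, hz, rfl⟩ := Submodule.mem_sup.1 hx
  rw [map_add, negTwist_apply_of_mem χ hy, negTwist_apply_of_mem χ hz, map_mul, hχ, smul_add,
    neg_add, add_right_inj, mul_neg_one, Units.val_neg, neg_smul, neg_neg, eq_neg_iff_add_eq_zero,
    ← smul_add, ← two_smul F z, smul_smul, smul_eq_zero,
    or_iff_right (mul_ne_zero (χ g).ne_zero h2)] at hφ
  rw [hφ, add_zero]
  exact hy

end VectorGrading

section Assembly

variable {F : Type*} [Field F] {n : ℕ} {G : Type*} [CommGroup G] [DecidableEq G]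

open VectorGrading

variable {R : VectorGrading F G (Matrix (Fin n) (Fin n) F)} {h₀ : G}

lemma two_smul_mul (x y : Matrix (Fin n) (Fin n) F) :
    (2 : F) • (x * y) = ⁅x, y⁆ + matCirc F n x y := by
  rw [matCirc_apply, Ring.lie_def, two_smul]
  abel

lemma mul_mem_comp_sup (h2 : (2 : F) ≠ 0)
    (hR : ∀ g h, ∀ X ∈ R.comp g, ∀ Y ∈ R.comp h, ⁅X, Y⁆ ∈ R.comp (g * h))
    (hcirc : matCirc F n ∈ (R.hom (R.hom R)).comp h₀) {g h : G} {x y : Matrix (Fin n) (Fin n) F}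
    (hx : x ∈ R.comp g) (hy : y ∈ R.comp h) :
    x * y ∈ R.comp (g * h) ⊔ R.comp (g * h * h₀) := by
  rw [← Submodule.smul_mem_iff _ h2, two_smul_mul]
  refine add_mem (Submodule.mem_sup_left (hR g h x hx y hy)) (Submodule.mem_sup_right ?_)
  have := mem_hom_comp.1 (mem_hom_comp.1 hcirc g x hx) h y hy
  rwa [mul_assoc, mul_comm] at this

lemma add_mul_mem_comp_add (h2 : (2 : F) ≠ 0) (hh₀ : h₀ * h₀ = 1)
    (hR : ∀ g h, ∀ X ∈ R.comp g, ∀ Y ∈ R.comp h, ⁅X, Y⁆ ∈ R.comp (g * h))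
    (hcirc : matCirc F n ∈ (R.hom (R.hom R)).comp h₀) (g g' : G) (x : Matrix (Fin n) (Fin n) F)
    (hx : x ∈ R.comp g + R.comp (g * h₀)) (y : Matrix (Fin n) (Fin n) F)
    (hy : y ∈ R.comp g' + R.comp (g' * h₀)) :
    x * y ∈ R.comp (g * g') + R.comp (g * g' * h₀) := by
  rw [Submodule.add_eq_sup] at *
  obtain ⟨x₁, hx₁, x₂, hx₂, rfl⟩ := Submodule.mem_sup.1 hx
  obtain ⟨y₁, hy₁, y₂, hy₂, rfl⟩ := Submodule.mem_sup.1 hy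
  have h₁₁ := mul_mem_comp_sup h2 hR hcirc hx₁ hy₁
  have h₁₂ := mul_mem_comp_sup h2 hR hcirc hx₁ hy₂
  have h₂₁ := mul_mem_comp_sup h2 hR hcirc hx₂ hy₁
  have h₂₂ := mul_mem_comp_sup h2 hR hcirc hx₂ hy₂
  have e : ∀ k, k * h₀ * h₀ = k := fun k => by rw [mul_assoc, hh₀, mul_one]
  rw [← mul_assoc, e, sup_comm] at h₁₂
  rw [mul_right_comm, e, sup_comm] at h₂₁
  rw [mul_right_comm, ← mul_assoc, e] at h₂₂
  rw [add_mul, mul_add, mul_add]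
  exact add_mem (add_mem h₁₁ h₁₂) (add_mem h₂₁ h₂₂)

lemma negTwist_mul (h2 : (2 : F) ≠ 0)
    (hR : ∀ g h, ∀ X ∈ R.comp g, ∀ Y ∈ R.comp h, ⁅X, Y⁆ ∈ R.comp (g * h))
    (hcirc : matCirc F n ∈ (R.hom (R.hom R)).comp h₀) {χ : G →* Fˣ} (hχ : χ h₀ = -1)
    (x y : Matrix (Fin n) (Fin n) F) :
    R.negTwist χ (x * y) = R.negTwist χ y * R.negTwist χ x := by
  let φ := (R.negTwist χ).toLinearMap
  have key : (LinearMap.mul F (Matrix (Fin n) (Fin n) F)).compr₂ φ =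
      ((LinearMap.mul F (Matrix (Fin n) (Fin n) F)).compl₁₂ φ φ).flip :=
    R.linearMap_ext fun g x hx => R.linearMap_ext fun h y hy => by
      change R.negTwist χ (x * y) = R.negTwist χ y * R.negTwist χ x
      have hxy := mem_hom_comp.1 (mem_hom_comp.1 hcirc g x hx) h y hy
      refine smul_right_injective _ h2 ?_
      simp only
      rw [← map_smul, two_smul_mul, map_add, negTwist_apply_of_mem χ hx, negTwist_apply_of_mem χ hy,
        negTwist_apply_of_mem χ (hR g h x hx y hy), negTwist_apply_of_mem χ hxy, neg_mul_neg,
        smul_mul_smul_comm, smul_comm (2 : F), two_smul_mul, map_mul, map_mul, map_mul, hχ,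
        Ring.lie_def, Ring.lie_def, matCirc_apply, matCirc_apply]
      simp only [Units.val_mul, Units.val_neg, neg_mul, one_mul, neg_smul, neg_neg]
      rw [← smul_neg, ← smul_add, mul_comm (χ h : F)]
      congr 1
      abel
  exact LinearMap.congr_fun₂ key x y

/-- Every grading of `psl_n(F)` lifts to a grading of `gl_n(F)` for which the symmetrized product
is homogeneous of some degree `h₀` with `h₀ ^ 2 = 1`. -/
theorem exists_grading_lift (hn : 3 ≤ n) (h2 : (2 : F) ≠ 0) (h3 : n = 3 → (3 : F) ≠ 0)
    (Q : VectorGrading F G (slM F n ⧸ slCenter F n))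
    (hQ : ∀ g h : G, ∀ u ∈ Q.comp g, ∀ v ∈ Q.comp h, pslBracket F n u v ∈ Q.comp (g * h)) :
    ∃ (R : VectorGrading F G (Matrix (Fin n) (Fin n) F)) (h₀ : G), h₀ * h₀ = 1 ∧
      (∀ g h, ∀ X ∈ R.comp g, ∀ Y ∈ R.comp h, ⁅X, Y⁆ ∈ R.comp (g * h)) ∧
      matCirc F n ∈ (R.hom (R.hom R)).comp h₀ ∧
      ∀ g, Q.comp g = ((R.comp g).comap (slM F n).subtype).map (slCenter F n).mkQ := by
  obtain ⟨P, hP, hQP⟩ := exists_pgl_grading hn h2 h3 Q hQ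
  obtain ⟨S, hcan, hS⟩ := exists_sl_grading hn P hP
  obtain ⟨h₀, hμ⟩ := exists_circPGL_mem_comp hn h2 hP hcan hS
  obtain ⟨R, htoPGL, hsub, hcirc, h1, hR⟩ := exists_gl_grading hn h2 hP hcan hS hμ
  obtain ⟨hh₀, hcirc'⟩ := slCirc_mem_comp hn h2 hP hcan htoPGL hcirc h1
  refine ⟨R, h₀, hh₀, hR, matCirc_mem_comp hn h2 hh₀ hsub hR hcirc', fun g => ?_⟩
  ext u
  constructor
  · intro hu
    obtain ⟨x, rfl⟩ := Submodule.mkQ_surjective _ u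
    refine ⟨S.proj g x, ?_, pslToPGL_injective ?_⟩
    · have := mem_hom_comp.1 hsub g _ (S.proj_mem g x)
      rwa [one_mul] at this
    · change slToPGL F n (S.proj g x) = slToPGL F n x
      rw [← proj_apply_of_mem_hom_comp hcan, one_mul]
      exact P.mem_comp.1 ((hQP g x).1 hu)
  · rintro ⟨x, hx, rfl⟩
    have := mem_hom_comp.1 htoPGL g _ hx
    rw [one_mul] at this
    exact (hQP g x).2 this

end Assembly

/-- Every `G`-grading of `psl_n(F)` (`n ≥ 3`, `char F ≠ 2`, and
`char F ≠ 3` if `n = 3`) lifts to a `G`-grading of the Lie algebra `gl_n(F)` which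
is either a grading of the associative algebra `Mₙ(F)` (Type I), or is obtained from
a `G/⟨h₀⟩`-grading of `Mₙ(F)` together with a compatible anti-automorphism `φ` and a
character `χ` with `χ(h₀) = −1` (Type II). -/
theorem psl_grading_lifts
    {F : Type*} [Field F] [IsAlgClosed F] (hchar : ringChar F ≠ 2)
    {G : Type*} [CommGroup G] [DecidableEq G] {n : ℕ} (hn : 3 ≤ n)
    (hn3 : n = 3 → ringChar F ≠ 3)
    (ℒ : G → Submodule F (↥(slM F n) ⧸ slCenter F n))
    (hinternal : DirectSum.IsInternal ℒ)
    (hbr : ∀ g h : G, ∀ x y : ↥(slM F n),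
      Submodule.Quotient.mk x ∈ ℒ g → Submodule.Quotient.mk y ∈ ℒ h →
      Submodule.Quotient.mk (slBracket F n x y) ∈ ℒ (g * h)) :
    ∃ ℛ : G → Submodule F (Matrix (Fin n) (Fin n) F),
      -- a G-grading of the Lie algebra gl_n(F) ...
      DirectSum.IsInternal ℛ ∧
      (∀ g h : G, ∀ x ∈ ℛ g, ∀ y ∈ ℛ h, x * y - y * x ∈ ℛ (g * h)) ∧
      -- ... inducing the given grading on psl_n(F)
      (∀ g : G, ℒ g =
        Submodule.map (slCenter F n).mkQ ((ℛ g).comap (slM F n).subtype)) ∧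
      -- Type I or Type II
      ((∀ g h : G, ∀ x ∈ ℛ g, ∀ y ∈ ℛ h, x * y ∈ ℛ (g * h)) ∨
       (∃ h₀ : G, h₀ ≠ 1 ∧ h₀ ^ 2 = 1 ∧
        ∃ χ : G →* Fˣ, χ h₀ = -1 ∧
        ∃ φ : Matrix (Fin n) (Fin n) F ≃ₗ[F] Matrix (Fin n) (Fin n) F,
          -- φ is an anti-automorphism
          (∀ x y : Matrix (Fin n) (Fin n) F, φ (x * y) = φ y * φ x) ∧
          -- the coarsened components R̄_ḡ = R_g + R_{gh₀} form an associative grading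
          (∀ g g' : G, ∀ x ∈ ℛ g + ℛ (g * h₀), ∀ y ∈ ℛ g' + ℛ (g' * h₀),
            x * y ∈ ℛ (g * g') + ℛ (g * g' * h₀)) ∧
          -- φ preserves the coarsened grading
          (∀ g : G, (ℛ g + ℛ (g * h₀)).map φ.toLinearMap = ℛ g + ℛ (g * h₀)) ∧
          -- and recovers the fine components by eigenspaces
          (∀ g : G, ∀ X : Matrix (Fin n) (Fin n) F,
            X ∈ ℛ g ↔ (X ∈ ℛ g + ℛ (g * h₀) ∧ φ X = -((χ g : F) • X))))) := by
  classical
  have h2 : (2 : F) ≠ 0 := Ring.two_ne_zero hchar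
  have h3 : n = 3 → (3 : F) ≠ 0 := fun h h3 => hn3 h <| by
    have hdvd : ringChar F ∣ 3 := (ringChar.spec F 3).1 (by exact_mod_cast h3)
    exact ((Nat.dvd_prime Nat.prime_three).1 hdvd).resolve_left CharP.ringChar_ne_one
  obtain ⟨Q, hQℒ⟩ := VectorGrading.exists_comp_eq_of_isInternal hinternal
  obtain ⟨R, h₀, hh₀, hR, hcirc, hQR⟩ := exists_grading_lift hn h2 h3 Q fun g h u hu v hv => by
    obtain ⟨x, rfl⟩ := Submodule.mkQ_surjective _ u
    obtain ⟨y, rfl⟩ := Submodule.mkQ_surjective _ v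
    rw [hQℒ] at *
    exact hbr g h x y hu hv
  refine ⟨R.comp, R.isInternal_comp, hR, fun g => by rw [← hQℒ, hQR], ?_⟩
  by_cases h1 : h₀ = 1
  · refine Or.inl fun g h x hx y hy => ?_
    have := mul_mem_comp_sup h2 hR hcirc hx hy
    rwa [h1, mul_one, sup_idem] at this
  · obtain ⟨χ, hχ⟩ := exists_monoidHom_apply_eq_neg_one (F := F) h1 hh₀
    exact Or.inr ⟨h₀, h1, by rw [sq, hh₀], χ, hχ, R.negTwist χ, negTwist_mul h2 hR hcirc hχ,
      add_mul_mem_comp_add h2 hh₀ hR hcirc, fun g => VectorGrading.map_negTwist_add χ g (g * h₀),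
      VectorGrading.mem_comp_iff_negTwist_apply h2 hχ⟩
end
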